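/- arXiv:1508.03849 — 5 statements merged into one kernel-verified Lean document; each statement's English description precedes it below -/
import Mathlib

section
/- Let G be a group satisfying hypothesis (H*), let t ∈ G have order 4, and let u = g * t * g⁻¹ for some g ∈ G (so u is any conjugate of t). Then (t * u)^2 = 1, (t * u⁻¹)^9 = 1, and (t * u^2)^4 = 1. -/
/-- A group `K` is a locally cyclic 2-group: every element has order a power of 2
and every finitely generated subgroup is cyclic. -/
def IsLocallyCyclic2Group (K : Type*) [Group K] : Prop :=
  (∀ k : K, ∃ n : ℕ, orderOf k = 2 ^ n) ∧
  ∀ S : Subgroup K, S.FG → IsCyclic S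

/-- Hypothesis (H): `G` is periodic, `π(G) = {2, 3}`, and the order of the product of
any two elements of order at most 4 does not exceed 9. -/
def HypH (G : Type*) [Group G] : Prop :=
  (∀ g : G, IsOfFinOrder g) ∧
  (∀ p : ℕ, p.Prime → ((∃ g : G, p ∣ orderOf g) ↔ p = 2 ∨ p = 3)) ∧
  ∀ x y : G, orderOf x ≤ 4 → orderOf y ≤ 4 → orderOf (x * y) ≤ 9

/-- Hypothesis (H*): `G` satisfies (H) and the centralizer of every involution of `G`
is a locally cyclic 2-group. -/
def HypHStar (G : Type*) [Group G] : Prop :=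
  HypH G ∧ ∀ a : G, a ≠ 1 → a ^ 2 = 1 →
    IsLocallyCyclic2Group (Subgroup.centralizer {a})


set_option maxHeartbeats 4000000 in
theorem core_collapse {Q : Type*} (t x : Q → Q) (q : Q)
    (ti : ∀ {a b}, t a = t b → a = b) (xi : ∀ {a b}, x a = x b → a = b)
    (h0 : t (x q) = q)
    (r0 : ∀ q, x (x (x q)) = q)
    (r1 : ∀ q, t (t (t (t q))) = q)
    (r2 : ∀ q, t (x (t (t (x (t q))))) = q)
    (r3 : ∀ q, x (t (t (x (t (t q))))) = q)
    (r4 : ∀ q, x (t (x (t (x (t (x (t (x (t (x (t (x (t (x (t (x (t q))))))))))))))))) = q)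
    (r5 : ∀ q, t (t (x (t (t (x q))))) = q)
    (r6 : ∀ q, t (x (t (x (t (x (t (x (t (x (t (x (t (x (t (x (t (x q))))))))))))))))) = q)
    (r7 : ∀ q, x (t (x (t (t (t (x (t (x (t (t (t (x (t (x (t (t (t (x (t (x (t (t (t (x (t (x (t (t (t (x (t (x (t (t (t (x (t (x (t (t (t (x (t (x (t (t (t (x (t (x (t (t (t q))))))))))))))))))))))))))))))))))))))))))))))))))))) = q)
    : x q = q := by
  obtain ⟨v1, e1⟩ : ∃ v, x q = v := ⟨_, rfl⟩
  have e2 : t v1 = q := e1 ▸ h0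
  obtain ⟨v2, e3⟩ : ∃ v, x v1 = v := ⟨_, rfl⟩
  have e4 : x v2 = q := by have h := r0 q; rw [e1, e3] at h; exact h
  obtain ⟨v3, e5⟩ : ∃ v, t q = v := ⟨_, rfl⟩
  obtain ⟨v4, e6⟩ : ∃ v, t v3 = v := ⟨_, rfl⟩
  have e7 : t v4 = v1 := by have h := r1 v1; rw [e2, e5, e6] at h; exact h
  have e8 : x v3 = v4 := by have h := r2 v1; rw [e2, e1, e2, e5] at h; exact ti (h.trans (by rw [e7]))
  obtain ⟨v5, e9⟩ : ∃ v, x v4 = v := ⟨_, rfl⟩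
  have e10 : x v5 = v3 := by have h := r0 v3; rw [e8, e9] at h; exact h
  obtain ⟨v6, e11⟩ : ∃ v, t v2 = v := ⟨_, rfl⟩
  have e12 : t v6 = v5 := by have h := r3 v2; rw [e11] at h; exact xi (ti (ti (xi (h.trans (by rw [e10, e6, e7, e3])))))
  obtain ⟨v7, e13⟩ : ∃ v, t v5 = v := ⟨_, rfl⟩
  have e14 : t v7 = v2 := by have h := r1 v2; rw [e11, e12, e13] at h; exact h
  obtain ⟨v8, e15⟩ : ∃ v, x v6 = v := ⟨_, rfl⟩
  obtain ⟨v9, e16⟩ : ∃ v, x v8 = v := ⟨_, rfl⟩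
  have e17 : x v9 = v6 := by have h := r0 v6; rw [e15, e16] at h; exact h
  obtain ⟨v10, e18⟩ : ∃ v, x v7 = v := ⟨_, rfl⟩
  obtain ⟨v11, e19⟩ : ∃ v, x v10 = v := ⟨_, rfl⟩
  have e20 : x v11 = v7 := by have h := r0 v7; rw [e18, e19] at h; exact h
  obtain ⟨v12, e21⟩ : ∃ v, t v8 = v := ⟨_, rfl⟩
  have e22 : t v12 = v11 := by have h := r3 v8; rw [e21] at h; exact xi (ti (ti (xi (h.trans (by rw [e20, e14, e11, e15])))))
  obtain ⟨v13, e23⟩ : ∃ v, t v11 = v := ⟨_, rfl⟩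
  have e24 : t v13 = v8 := by have h := r1 v8; rw [e21, e22, e23] at h; exact h
  obtain ⟨v14, e25⟩ : ∃ v, t v9 = v := ⟨_, rfl⟩
  have e26 : t v14 = v10 := by have h := r3 v9; rw [e25] at h; exact xi (ti (ti (xi (h.trans (by rw [e19, e23, e24, e16])))))
  obtain ⟨v15, e27⟩ : ∃ v, t v10 = v := ⟨_, rfl⟩
  have e28 : t v15 = v9 := by have h := r1 v9; rw [e25, e26, e27] at h; exact h
  obtain ⟨v16, e29⟩ : ∃ v, x v12 = v := ⟨_, rfl⟩
  obtain ⟨v17, e30⟩ : ∃ v, x v16 = v := ⟨_, rfl⟩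
  have e31 : x v17 = v12 := by have h := r0 v12; rw [e29, e30] at h; exact h
  obtain ⟨v18, e32⟩ : ∃ v, x v13 = v := ⟨_, rfl⟩
  obtain ⟨v19, e33⟩ : ∃ v, x v18 = v := ⟨_, rfl⟩
  have e34 : x v19 = v13 := by have h := r0 v13; rw [e32, e33] at h; exact h
  obtain ⟨v20, e35⟩ : ∃ v, t v16 = v := ⟨_, rfl⟩
  have e36 : t v20 = v19 := by have h := r3 v16; rw [e35] at h; exact xi (ti (ti (xi (h.trans (by rw [e34, e24, e21, e29])))))
  obtain ⟨v21, e37⟩ : ∃ v, t v19 = v := ⟨_, rfl⟩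
  have e38 : t v21 = v16 := by have h := r1 v16; rw [e35, e36, e37] at h; exact h
  obtain ⟨v22, e39⟩ : ∃ v, t v17 = v := ⟨_, rfl⟩
  have e40 : t v22 = v18 := by have h := r3 v17; rw [e39] at h; exact xi (ti (ti (xi (h.trans (by rw [e33, e37, e38, e30])))))
  obtain ⟨v23, e41⟩ : ∃ v, t v18 = v := ⟨_, rfl⟩
  have e42 : t v23 = v17 := by have h := r1 v17; rw [e39, e40, e41] at h; exact h
  obtain ⟨v24, e43⟩ : ∃ v, x v14 = v := ⟨_, rfl⟩
  obtain ⟨v25, e44⟩ : ∃ v, x v24 = v := ⟨_, rfl⟩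
  have e45 : x v25 = v14 := by have h := r0 v14; rw [e43, e44] at h; exact h
  obtain ⟨v26, e46⟩ : ∃ v, x v15 = v := ⟨_, rfl⟩
  obtain ⟨v27, e47⟩ : ∃ v, x v26 = v := ⟨_, rfl⟩
  have e48 : x v27 = v15 := by have h := r0 v15; rw [e46, e47] at h; exact h
  obtain ⟨v28, e49⟩ : ∃ v, t v24 = v := ⟨_, rfl⟩
  have e50 : t v28 = v27 := by have h := r3 v24; rw [e49] at h; exact xi (ti (ti (xi (h.trans (by rw [e48, e28, e25, e43])))))
  obtain ⟨v29, e51⟩ : ∃ v, t v27 = v := ⟨_, rfl⟩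
  have e52 : t v29 = v24 := by have h := r1 v24; rw [e49, e50, e51] at h; exact h
  obtain ⟨v30, e53⟩ : ∃ v, t v25 = v := ⟨_, rfl⟩
  have e54 : t v30 = v26 := by have h := r3 v25; rw [e53] at h; exact xi (ti (ti (xi (h.trans (by rw [e47, e51, e52, e44])))))
  obtain ⟨v31, e55⟩ : ∃ v, t v26 = v := ⟨_, rfl⟩
  have e56 : t v31 = v25 := by have h := r1 v25; rw [e53, e54, e55] at h; exact h
  obtain ⟨v32, e57⟩ : ∃ v, x v20 = v := ⟨_, rfl⟩
  obtain ⟨v33, e58⟩ : ∃ v, x v32 = v := ⟨_, rfl⟩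
  have e59 : x v33 = v20 := by have h := r0 v20; rw [e57, e58] at h; exact h
  obtain ⟨v34, e60⟩ : ∃ v, t v32 = v := ⟨_, rfl⟩
  have e61 : x v34 = v23 := by have h := r4 v23; rw [e42, e31, e22, e20, e14, e4, e5, e8, e7, e3, e11, e15, e21, e29, e35, e57, e60] at h; exact h
  obtain ⟨v35, e62⟩ : ∃ v, x v23 = v := ⟨_, rfl⟩
  have e63 : x v35 = v34 := by have h := r0 v23; rw [e62] at h; exact xi (h.trans (by rw [e61]))
  obtain ⟨v36, e64⟩ : ∃ v, x v22 = v := ⟨_, rfl⟩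
  have e65 : t v36 = v32 := by have h := r5 v34; rw [e61, e42, e39, e64] at h; exact ti (h.trans (by rw [e60]))
  obtain ⟨v37, e66⟩ : ∃ v, x v36 = v := ⟨_, rfl⟩
  have e67 : x v37 = v22 := by have h := r0 v22; rw [e64, e66] at h; exact h
  obtain ⟨v38, e68⟩ : ∃ v, t v34 = v := ⟨_, rfl⟩
  have e69 : x v38 = v21 := by have h := r2 v34; rw [e68] at h; exact ti (ti (xi (ti (h.trans (by rw [e38, e35, e57, e60])))))
  have e70 : t v38 = v36 := by have h := r1 v32; rw [e60, e68] at h; exact ti (h.trans (by rw [e65]))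
  obtain ⟨v39, e71⟩ : ∃ v, t v37 = v := ⟨_, rfl⟩
  have e72 : t v39 = v35 := by have h := r3 v37; rw [e71] at h; exact xi (ti (ti (xi (h.trans (by rw [e63, e68, e70, e66])))))
  obtain ⟨v40, e73⟩ : ∃ v, t v35 = v := ⟨_, rfl⟩
  have e74 : t v40 = v37 := by have h := r1 v37; rw [e71, e72, e73] at h; exact h
  obtain ⟨v41, e75⟩ : ∃ v, x v28 = v := ⟨_, rfl⟩
  obtain ⟨v42, e76⟩ : ∃ v, x v41 = v := ⟨_, rfl⟩
  have e77 : x v42 = v28 := by have h := r0 v28; rw [e75, e76] at h; exact h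
  obtain ⟨v43, e78⟩ : ∃ v, x v29 = v := ⟨_, rfl⟩
  obtain ⟨v44, e79⟩ : ∃ v, x v43 = v := ⟨_, rfl⟩
  have e80 : x v44 = v29 := by have h := r0 v29; rw [e78, e79] at h; exact h
  obtain ⟨v45, e81⟩ : ∃ v, t v41 = v := ⟨_, rfl⟩
  have e82 : t v45 = v44 := by have h := r3 v41; rw [e81] at h; exact xi (ti (ti (xi (h.trans (by rw [e80, e52, e49, e75])))))
  obtain ⟨v46, e83⟩ : ∃ v, t v44 = v := ⟨_, rfl⟩
  have e84 : t v46 = v41 := by have h := r1 v41; rw [e81, e82, e83] at h; exact h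
  obtain ⟨v47, e85⟩ : ∃ v, t v42 = v := ⟨_, rfl⟩
  have e86 : t v47 = v43 := by have h := r3 v42; rw [e85] at h; exact xi (ti (ti (xi (h.trans (by rw [e79, e83, e84, e76])))))
  obtain ⟨v48, e87⟩ : ∃ v, t v43 = v := ⟨_, rfl⟩
  have e88 : t v48 = v42 := by have h := r1 v42; rw [e85, e86, e87] at h; exact h
  obtain ⟨v49, e89⟩ : ∃ v, x v30 = v := ⟨_, rfl⟩
  obtain ⟨v50, e90⟩ : ∃ v, x v49 = v := ⟨_, rfl⟩
  have e91 : x v50 = v30 := by have h := r0 v30; rw [e89, e90] at h; exact h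
  obtain ⟨v51, e92⟩ : ∃ v, x v31 = v := ⟨_, rfl⟩
  obtain ⟨v52, e93⟩ : ∃ v, x v51 = v := ⟨_, rfl⟩
  have e94 : x v52 = v31 := by have h := r0 v31; rw [e92, e93] at h; exact h
  obtain ⟨v53, e95⟩ : ∃ v, t v49 = v := ⟨_, rfl⟩
  have e96 : t v53 = v52 := by have h := r3 v49; rw [e95] at h; exact xi (ti (ti (xi (h.trans (by rw [e94, e56, e53, e89])))))
  obtain ⟨v54, e97⟩ : ∃ v, t v52 = v := ⟨_, rfl⟩
  have e98 : t v54 = v49 := by have h := r1 v49; rw [e95, e96, e97] at h; exact h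
  obtain ⟨v55, e99⟩ : ∃ v, t v50 = v := ⟨_, rfl⟩
  have e100 : t v55 = v51 := by have h := r3 v50; rw [e99] at h; exact xi (ti (ti (xi (h.trans (by rw [e93, e97, e98, e90])))))
  obtain ⟨v56, e101⟩ : ∃ v, t v51 = v := ⟨_, rfl⟩
  have e102 : t v56 = v50 := by have h := r1 v50; rw [e99, e100, e101] at h; exact h
  have e103 : x v56 = v48 := by have h := r6 v56; exact ti (xi (ti (xi (ti (xi (ti (xi (ti (xi (ti (xi (ti (xi (ti (xi (ti (h.trans (by rw [e88, e77, e50, e48, e28, e17, e12, e10, e6, e9, e13, e18, e27, e46, e55, e92, e101]))))))))))))))))))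
  have e104 : x v47 = v55 := by have h := r2 v51; rw [e101, e103, e88, e85] at h; exact ti (h.trans (by rw [e100]))
  obtain ⟨v57, e105⟩ : ∃ v, x v55 = v := ⟨_, rfl⟩
  have e106 : x v57 = v47 := by have h := r0 v47; rw [e104, e105] at h; exact h
  obtain ⟨v58, e107⟩ : ∃ v, x v48 = v := ⟨_, rfl⟩
  have e108 : x v58 = v56 := by have h := r0 v48; rw [e107] at h; exact xi (h.trans (by rw [e103]))
  obtain ⟨v59, e109⟩ : ∃ v, t v57 = v := ⟨_, rfl⟩
  have e110 : t v59 = v58 := by have h := r3 v57; rw [e109] at h; exact xi (ti (ti (xi (h.trans (by rw [e108, e102, e99, e105])))))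
  obtain ⟨v60, e111⟩ : ∃ v, t v58 = v := ⟨_, rfl⟩
  have e112 : t v60 = v57 := by have h := r1 v57; rw [e109, e110, e111] at h; exact h
  obtain ⟨v61, e113⟩ : ∃ v, x v39 = v := ⟨_, rfl⟩
  obtain ⟨v62, e114⟩ : ∃ v, x v61 = v := ⟨_, rfl⟩
  have e115 : x v62 = v39 := by have h := r0 v39; rw [e113, e114] at h; exact h
  obtain ⟨v63, e116⟩ : ∃ v, x v40 = v := ⟨_, rfl⟩
  obtain ⟨v64, e117⟩ : ∃ v, x v63 = v := ⟨_, rfl⟩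
  have e118 : x v64 = v40 := by have h := r0 v40; rw [e116, e117] at h; exact h
  obtain ⟨v65, e119⟩ : ∃ v, t v61 = v := ⟨_, rfl⟩
  have e120 : t v65 = v64 := by have h := r3 v61; rw [e119] at h; exact xi (ti (ti (xi (h.trans (by rw [e118, e74, e71, e113])))))
  obtain ⟨v66, e121⟩ : ∃ v, t v64 = v := ⟨_, rfl⟩
  have e122 : t v66 = v61 := by have h := r1 v61; rw [e119, e120, e121] at h; exact h
  obtain ⟨v67, e123⟩ : ∃ v, t v62 = v := ⟨_, rfl⟩
  have e124 : t v67 = v63 := by have h := r3 v62; rw [e123] at h; exact xi (ti (ti (xi (h.trans (by rw [e117, e121, e122, e114])))))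
  obtain ⟨v68, e125⟩ : ∃ v, t v63 = v := ⟨_, rfl⟩
  have e126 : t v68 = v62 := by have h := r1 v62; rw [e123, e124, e125] at h; exact h
  obtain ⟨v69, e127⟩ : ∃ v, x v53 = v := ⟨_, rfl⟩
  obtain ⟨v70, e128⟩ : ∃ v, x v69 = v := ⟨_, rfl⟩
  have e129 : x v70 = v53 := by have h := r0 v53; rw [e127, e128] at h; exact h
  obtain ⟨v71, e130⟩ : ∃ v, x v54 = v := ⟨_, rfl⟩
  obtain ⟨v72, e131⟩ : ∃ v, x v71 = v := ⟨_, rfl⟩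
  have e132 : x v72 = v54 := by have h := r0 v54; rw [e130, e131] at h; exact h
  obtain ⟨v73, e133⟩ : ∃ v, t v69 = v := ⟨_, rfl⟩
  have e134 : t v73 = v72 := by have h := r3 v69; rw [e133] at h; exact xi (ti (ti (xi (h.trans (by rw [e132, e98, e95, e127])))))
  obtain ⟨v74, e135⟩ : ∃ v, t v72 = v := ⟨_, rfl⟩
  have e136 : t v74 = v69 := by have h := r1 v69; rw [e133, e134, e135] at h; exact h
  obtain ⟨v75, e137⟩ : ∃ v, t v70 = v := ⟨_, rfl⟩
  have e138 : t v75 = v71 := by have h := r3 v70; rw [e137] at h; exact xi (ti (ti (xi (h.trans (by rw [e131, e135, e136, e128])))))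
  obtain ⟨v76, e139⟩ : ∃ v, x v68 = v := ⟨_, rfl⟩
  obtain ⟨v77, e140⟩ : ∃ v, x v76 = v := ⟨_, rfl⟩
  have e141 : x v77 = v68 := by have h := r0 v68; rw [e139, e140] at h; exact h
  obtain ⟨v78, e142⟩ : ∃ v, x v59 = v := ⟨_, rfl⟩
  obtain ⟨v79, e143⟩ : ∃ v, x v78 = v := ⟨_, rfl⟩
  have e144 : x v79 = v59 := by have h := r0 v59; rw [e142, e143] at h; exact h
  obtain ⟨v80, e145⟩ : ∃ v, x v60 = v := ⟨_, rfl⟩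
  obtain ⟨v81, e146⟩ : ∃ v, x v80 = v := ⟨_, rfl⟩
  have e147 : x v81 = v60 := by have h := r0 v60; rw [e145, e146] at h; exact h
  obtain ⟨v82, e148⟩ : ∃ v, t v78 = v := ⟨_, rfl⟩
  have e149 : t v82 = v81 := by have h := r3 v78; rw [e148] at h; exact xi (ti (ti (xi (h.trans (by rw [e147, e112, e109, e142])))))
  obtain ⟨v83, e150⟩ : ∃ v, t v81 = v := ⟨_, rfl⟩
  have e151 : t v83 = v78 := by have h := r1 v78; rw [e148, e149, e150] at h; exact h
  obtain ⟨v84, e152⟩ : ∃ v, t v79 = v := ⟨_, rfl⟩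
  have e153 : t v84 = v80 := by have h := r3 v79; rw [e152] at h; exact xi (ti (ti (xi (h.trans (by rw [e146, e150, e151, e143])))))
  obtain ⟨v85, e154⟩ : ∃ v, t v80 = v := ⟨_, rfl⟩
  have e155 : t v85 = v79 := by have h := r1 v79; rw [e152, e153, e154] at h; exact h
  obtain ⟨v86, e156⟩ : ∃ v, x v85 = v := ⟨_, rfl⟩
  obtain ⟨v87, e157⟩ : ∃ v, x v86 = v := ⟨_, rfl⟩
  have e158 : x v87 = v85 := by have h := r0 v85; rw [e156, e157] at h; exact h
  have e159 : t v86 = v87 := by have h := r4 v85; rw [e155, e144, e110, e108, e102, e91, e54, e47, e51, e78, e87, e107, e111, e145, e154, e156] at h; exact xi (h.trans (by rw [e158]))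
  obtain ⟨v88, e160⟩ : ∃ v, x v84 = v := ⟨_, rfl⟩
  have e161 : t v88 = v86 := by have h := r5 v87; rw [e158, e155, e152, e160] at h; exact ti (h.trans (by rw [e159]))
  obtain ⟨v89, e162⟩ : ∃ v, t v87 = v := ⟨_, rfl⟩
  have e163 : x v89 = v84 := by have h := r2 v87; rw [e162] at h; exact ti (ti (xi (ti (h.trans (by rw [e153, e154, e156, e159])))))
  have e164 : t v89 = v88 := by have h := r1 v87; rw [e162] at h; exact ti (ti (h.trans (by rw [e161, e159])))
  obtain ⟨v90, e165⟩ : ∃ v, t v71 = v := ⟨_, rfl⟩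
  have e166 : t v90 = v70 := by have h := r1 v71; rw [e165] at h; exact ti (ti (h.trans (by rw [e137, e138])))
  obtain ⟨v91, e167⟩ : ∃ v, t v76 = v := ⟨_, rfl⟩
  have e168 : x v91 = v90 := by have h := r4 v90; rw [e166, e129, e96, e94, e56, e45, e26, e19, e23, e32, e41, e62, e73, e116, e125, e139, e167] at h; exact h
  obtain ⟨v92, e169⟩ : ∃ v, x v75 = v := ⟨_, rfl⟩
  have e170 : t v92 = v76 := by have h := r5 v91; rw [e168, e166, e137, e169] at h; exact ti (h.trans (by rw [e167]))
  obtain ⟨v93, e171⟩ : ∃ v, t v91 = v := ⟨_, rfl⟩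
  have e172 : t v93 = v92 := by have h := r1 v92; rw [e170, e167, e171] at h; exact h
  obtain ⟨v94, e173⟩ : ∃ v, t v77 = v := ⟨_, rfl⟩
  obtain ⟨v95, e174⟩ : ∃ v, t v94 = v := ⟨_, rfl⟩
  obtain ⟨v96, e175⟩ : ∃ v, t v95 = v := ⟨_, rfl⟩
  have e176 : t v96 = v77 := by have h := r1 v77; rw [e173, e174, e175] at h; exact h
  obtain ⟨v97, e177⟩ : ∃ v, t v33 = v := ⟨_, rfl⟩
  obtain ⟨v98, e178⟩ : ∃ v, x v97 = v := ⟨_, rfl⟩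
  obtain ⟨v99, e179⟩ : ∃ v, t v98 = v := ⟨_, rfl⟩
  have e180 : x v99 = v96 := by have h := r4 v68; rw [e126, e115, e72, e63, e68, e69, e38, e30, e39, e64, e65, e58, e177, e178, e179] at h; exact ti (xi (h.trans (by rw [e176, e141])))
  obtain ⟨v100, e181⟩ : ∃ v, x v96 = v := ⟨_, rfl⟩
  have e182 : x v100 = v99 := by have h := r0 v99; rw [e180, e181] at h; exact h
  obtain ⟨v101, e183⟩ : ∃ v, t v99 = v := ⟨_, rfl⟩
  obtain ⟨v102, e184⟩ : ∃ v, x v101 = v := ⟨_, rfl⟩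
  have e185 : t v102 = v33 := by have h := r3 v98; rw [e179, e183, e184] at h; exact ti (xi (h.trans (by rw [e177, e178])))
  obtain ⟨v103, e186⟩ : ∃ v, t v100 = v := ⟨_, rfl⟩
  obtain ⟨v104, e187⟩ : ∃ v, t v103 = v := ⟨_, rfl⟩
  obtain ⟨v105, e188⟩ : ∃ v, t v104 = v := ⟨_, rfl⟩
  have e189 : t v105 = v100 := by have h := r1 v100; rw [e186, e187, e188] at h; exact h
  obtain ⟨v106, e190⟩ : ∃ v, x v103 = v := ⟨_, rfl⟩
  obtain ⟨v107, e191⟩ : ∃ v, t v106 = v := ⟨_, rfl⟩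
  obtain ⟨v108, e192⟩ : ∃ v, t v107 = v := ⟨_, rfl⟩
  obtain ⟨v109, e193⟩ : ∃ v, t v108 = v := ⟨_, rfl⟩
  obtain ⟨v110, e194⟩ : ∃ v, x v109 = v := ⟨_, rfl⟩
  obtain ⟨v111, e195⟩ : ∃ v, t v110 = v := ⟨_, rfl⟩
  obtain ⟨v112, e196⟩ : ∃ v, x v111 = v := ⟨_, rfl⟩
  obtain ⟨v113, e197⟩ : ∃ v, t v112 = v := ⟨_, rfl⟩
  obtain ⟨v114, e198⟩ : ∃ v, t v113 = v := ⟨_, rfl⟩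
  obtain ⟨v115, e199⟩ : ∃ v, t v114 = v := ⟨_, rfl⟩
  have e200 : x v115 = v46 := by have h := r7 v87; rw [e162, e164, e161, e157, e162, e163, e153, e154, e155, e144, e110, e108, e102, e99, e100, e93, e97, e130, e165, e166, e137, e169, e170, e140, e173, e174, e175, e181, e186, e190, e191, e192, e193, e194, e195, e196, e197, e198, e199] at h; exact ti (xi (ti (ti (ti (xi (ti (xi (ti (ti (ti (xi (ti (xi (h.trans (by rw [e84, e76, e85, e86, e87, e107, e111, e145, e154, e155, e152, e160, e161, e157])))))))))))))))
  have e201 : t v109 = v106 := by have h := r1 v106; rw [e191, e192, e193] at h; exact h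
  have e202 : t v115 = v112 := by have h := r1 v112; rw [e197, e198, e199] at h; exact h
  obtain ⟨v116, e203⟩ : ∃ v, t v111 = v := ⟨_, rfl⟩
  obtain ⟨v117, e204⟩ : ∃ v, t v116 = v := ⟨_, rfl⟩
  have e205 : t v117 = v110 := by have h := r1 v110; rw [e195, e203, e204] at h; exact h
  obtain ⟨v118, e206⟩ : ∃ v, x v45 = v := ⟨_, rfl⟩
  have c1 : v118 = v113 := by have h := r3 v118; exact ti (ti (xi (ti (ti (xi (h.trans (by rw [e198, e199, e200, e84, e81, e206])))))))
  subst c1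
  have e207 : x v114 = v105 := by have h := r6 v114; exact ti (xi (ti (xi (ti (xi (ti (xi (ti (xi (ti (xi (ti (xi (ti (xi (ti (h.trans (by rw [e189, e182, e183, e184, e185, e59, e36, e34, e24, e16, e25, e43, e49, e75, e81, e206, e198]))))))))))))))))))
  have c2 : v106 = v112 := by have h := r3 v112; rw [e197, e198, e207, e189, e186, e190] at h; exact h
  subst c2
  have c3 : v103 = v111 := xi (e190.trans e196.symm)
  subst c3
  have c4 : v100 = v110 := ti (e186.trans e195.symm)
  subst c4
  have c5 : v96 = v109 := xi (e181.trans e194.symm)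
  subst c5
  have c6 : v77 = v106 := e176.symm.trans e201
  subst c6
  have c7 : v76 = v103 := xi (e140.trans e190.symm)
  subst c7
  have c8 : v92 = v100 := ti (e170.trans e186.symm)
  subst c8
  have c9 : v75 = v96 := xi (e169.trans e181.symm)
  subst c9
  have c10 : v71 = v77 := e138.symm.trans e176
  subst c10
  have c11 : v54 = v76 := xi (e130.trans e140.symm)
  subst c11
  have c12 : v72 = v68 := xi (e132.trans e139.symm)
  subst c12
  have c13 : v63 = v73 := ti (e125.trans e134.symm)
  subst c13
  have c14 : v67 = v69 := ti (e124.trans e133.symm)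
  subst c14
  have c15 : v62 = v74 := e126.symm.trans e135
  subst c15
  have c16 : v49 = v91 := e98.symm.trans e167
  subst c16
  have c17 : v50 = v90 := e90.symm.trans e168
  subst c17
  have c18 : v55 = v70 := e99.symm.trans e166
  subst c18
  have c19 : v57 = v53 := e105.symm.trans e129
  subst c19
  have c20 : v49 = v60 := ti (e95.trans e112.symm)
  subst c20
  have c21 : v52 = v59 := e96.symm.trans e109
  subst c21
  have c22 : v31 = v78 := e94.symm.trans e142
  subst c22
  have c23 : v25 = v82 := e56.symm.trans e148
  subst c23
  have c24 : v26 = v83 := ti (e55.trans e151.symm)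
  subst c24
  have c25 : v30 = v81 := xi (e89.trans e147.symm)
  subst c25
  have c26 : v54 = v58 := e97.symm.trans e110
  subst c26
  have c27 : v47 = v67 := e106.symm.trans e127
  subst c27
  have c28 : v42 = v62 := ti (e85.trans e123.symm)
  subst c28
  have c29 : v28 = v39 := e77.symm.trans e115
  subst c29
  have c30 : v24 = v37 := ti (e49.trans e71.symm)
  subst c30
  have c31 : v25 = v22 := e44.symm.trans e67
  subst c31
  have c32 : v18 = v30 := e40.symm.trans e53
  subst c32
  have c33 : v17 = v31 := ti (e39.trans e56.symm)
  subst c33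
  have c34 : v23 = v26 := e41.symm.trans e54
  subst c34
  have c35 : v15 = v34 := xi (e46.trans e61.symm)
  subst c35
  have c36 : v10 = v32 := ti (e27.trans e60.symm)
  subst c36
  have c37 : v7 = v20 := xi (e18.trans e57.symm)
  subst c37
  have c38 : v5 = v16 := ti (e13.trans e35.symm)
  subst c38
  have c39 : v4 = v12 := xi (e9.trans e29.symm)
  subst c39
  have c40 : v3 = v8 := ti (e6.trans e21.symm)
  subst c40
  have c41 : v5 = v6 := xi (e10.trans e15.symm)
  subst c41
  have c42 : v2 = v5 := ti (e11.trans e12.symm)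
  subst c42
  have c43 : q = v3 := e4.symm.trans e10
  subst c43
  have c44 : v1 = q := ti (e2.trans e5.symm)
  replace c44 := c44.symm
  subst c44
  exact e1

section helpers
variable {G : Type*} [Group G]

/-- Elements commuting with an involution have 2-power order. -/
lemma order_two_pow (hG : HypHStar G) {a g : G} (ha : a ≠ 1) (ha2 : a ^ 2 = 1)
    (h : a * g = g * a) : ∃ n : ℕ, orderOf g = 2 ^ n := by
  have hm : g ∈ Subgroup.centralizer ({a} : Set G) := by
    rw [Subgroup.mem_centralizer_singleton_iff]; first | exact h | exact h.symm
  obtain ⟨n, hn⟩ := (hG.2 a ha ha2).1 ⟨g, hm⟩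
  exact ⟨n, by rw [← hn, Subgroup.orderOf_mk]⟩

/-- The centralizer of an involution is abelian, with a unique involution. -/
lemma cent_cyclic (hG : HypHStar G) {a g k : G} (ha : a ≠ 1) (ha2 : a ^ 2 = 1)
    (hg : a * g = g * a) (hk : a * k = k * a) :
    ∃ c : G, ∃ i j : ℤ, g = c ^ i ∧ k = c ^ j := by
  have hm : g ∈ Subgroup.centralizer ({a} : Set G) := by
    rw [Subgroup.mem_centralizer_singleton_iff]; first | exact hg | exact hg.symm
  have hm' : k ∈ Subgroup.centralizer ({a} : Set G) := by
    rw [Subgroup.mem_centralizer_singleton_iff]; first | exact hk | exact hk.symm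
  set C := Subgroup.centralizer ({a} : Set G)
  let S : Subgroup C := Subgroup.closure {⟨g, hm⟩, ⟨k, hm'⟩}
  classical
  have hfg : S.FG := ⟨({⟨g, hm⟩, ⟨k, hm'⟩} : Finset C), by simp [S]⟩
  obtain ⟨⟨⟨c, hc⟩, hcS⟩, hgen⟩ := ((hG.2 a ha ha2).2 S hfg).exists_generator
  have h1 : (⟨g, hm⟩ : C) ∈ S := Subgroup.subset_closure (by simp)
  have h2 : (⟨k, hm'⟩ : C) ∈ S := Subgroup.subset_closure (by simp)
  obtain ⟨i, hi⟩ := hgen ⟨_, h1⟩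
  obtain ⟨j, hj⟩ := hgen ⟨_, h2⟩
  refine ⟨c, i, j, ?_, ?_⟩
  · simpa using (congrArg (fun z : S => ((z : C) : G)) hi).symm
  · simpa using (congrArg (fun z : S => ((z : C) : G)) hj).symm

lemma cent_comm (hG : HypHStar G) {a g k : G} (ha : a ≠ 1) (ha2 : a ^ 2 = 1)
    (hg : a * g = g * a) (hk : a * k = k * a) : g * k = k * g := by
  obtain ⟨c, i, j, rfl, rfl⟩ := cent_cyclic hG ha ha2 hg hk
  exact (Commute.refl c).zpow_zpow i j

lemma invol_unique (hG : HypHStar G) {a b : G} (ha : a ≠ 1) (ha2 : a ^ 2 = 1)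
    (hb : b ≠ 1) (hb2 : b ^ 2 = 1) (h : a * b = b * a) : a = b := by
  obtain ⟨c, i, j, hi, hj⟩ := cent_cyclic hG ha ha2 rfl h
  have hfin : IsOfFinOrder c := hG.1.1 c
  have : Finite (Subgroup.zpowers c) := (finite_zpowers.2 hfin).to_subtype
  classical
  have := Fintype.ofFinite (Subgroup.zpowers c)
  have hle := IsCyclic.card_pow_eq_one_le (α := Subgroup.zpowers c) (n := 2) (by norm_num)
  by_contra hne
  have hma : a ∈ Subgroup.zpowers c := ⟨i, hi.symm⟩
  have hmb : b ∈ Subgroup.zpowers c := ⟨j, hj.symm⟩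
  have hsub : ({1, ⟨a, hma⟩, ⟨b, hmb⟩} : Finset (Subgroup.zpowers c)) ⊆
      Finset.univ.filter (fun z => z ^ 2 = 1) := by
    intro z hz
    simp only [Finset.mem_insert, Finset.mem_singleton] at hz
    rcases hz with rfl | rfl | rfl <;> simp [Subtype.ext_iff, ha2, hb2]
  have h3 : ({1, ⟨a, hma⟩, ⟨b, hmb⟩} : Finset (Subgroup.zpowers c)).card = 3 := by
    rw [Finset.card_eq_three]
    refine ⟨_, _, _, ?_, ?_, ?_, rfl⟩
    · simp only [ne_eq, Subtype.ext_iff]; exact fun h => ha h.symm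
    · simp only [ne_eq, Subtype.ext_iff]; exact fun h => hb h.symm
    · simpa only [ne_eq, Subtype.ext_iff] using hne
  have := Finset.card_le_card hsub
  omega

/-- An element of even order has an involution among its powers. -/
lemma exists_invol_pow (hG : HypHStar G) {g : G} (h : ¬ Odd (orderOf g)) :
    ∃ k : ℕ, g ^ k ≠ 1 ∧ (g ^ k) ^ 2 = 1 := by
  rw [Nat.not_odd_iff_even] at h
  obtain ⟨m, hm⟩ := h
  have hpos : 0 < orderOf g := (hG.1.1 g).orderOf_pos
  refine ⟨m, fun h1 => ?_, ?_⟩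
  · have := Nat.le_of_dvd (by omega) (orderOf_dvd_of_pow_eq_one h1)
    omega
  · rw [← pow_mul, show m * 2 = orderOf g by omega, pow_orderOf_eq_one]

lemma two_pow_or_odd (hG : HypHStar G) (g : G) :
    (∃ n : ℕ, orderOf g = 2 ^ n) ∨ Odd (orderOf g) := by
  by_cases h : Odd (orderOf g)
  · exact Or.inr h
  · obtain ⟨k, h1, h2⟩ := exists_invol_pow hG h
    exact Or.inl (order_two_pow hG h1 h2 (Commute.pow_self g k))

lemma pow_eight_or_nine (hG : HypHStar G) {g : G} (hg : orderOf g ≤ 9) :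
    g ^ 8 = 1 ∨ g ^ 9 = 1 := by
  have hpos : 0 < orderOf g := (hG.1.1 g).orderOf_pos
  rcases two_pow_or_odd hG g with ⟨n, hn⟩ | h
  · left
    apply orderOf_dvd_iff_pow_eq_one.mp
    have : n ≤ 3 := by
      by_contra hh
      have : 2 ^ 4 ≤ 2 ^ n := Nat.pow_le_pow_right (by norm_num) (by omega)
      omega
    rw [hn]
    exact pow_dvd_pow 2 this
  · right
    apply orderOf_dvd_iff_pow_eq_one.mp
    have h5 : ¬ 5 ∣ orderOf g := fun h5 => by
      have := (hG.1.2.1 5 (by norm_num)).1 ⟨g, h5⟩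
      omega
    have h7 : ¬ 7 ∣ orderOf g := fun h7 => by
      have := (hG.1.2.1 7 (by norm_num)).1 ⟨g, h7⟩
      omega
    generalize orderOf g = n at *
    interval_cases n <;> revert h h5 h7 <;> decide

lemma prod_pow (hG : HypHStar G) {x y : G} (hx : orderOf x ≤ 4) (hy : orderOf y ≤ 4) :
    (x * y) ^ 8 = 1 ∨ (x * y) ^ 9 = 1 :=
  pow_eight_or_nine hG (hG.1.2.2 x y hx hy)

lemma odd_of_pow_nine {g : G} (h : g ^ 9 = 1) : Odd (orderOf g) :=
  Odd.of_dvd_nat (by decide) (orderOf_dvd_of_pow_eq_one h)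

lemma eq_one_of_odd {g : G} (h : Odd (orderOf g)) (h2 : ∃ n : ℕ, orderOf g = 2 ^ n) : g = 1 := by
  obtain ⟨n, hn⟩ := h2
  rcases Nat.eq_zero_or_pos n with rfl | hpos
  · simpa using hn
  · rw [hn] at h
    exact absurd h (by rw [Nat.not_odd_iff_even]; exact (Nat.even_pow.2 ⟨even_two, hpos.ne'⟩))

/-- The product of two involutions has order dividing 9. -/
lemma invol_mul (hG : HypHStar G) {a b : G} (ha : a ≠ 1) (ha2 : a ^ 2 = 1)
    (hb : b ≠ 1) (hb2 : b ^ 2 = 1) : (a * b) ^ 9 = 1 := by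
  have hao : orderOf a ≤ 4 := (orderOf_le_of_pow_eq_one (by norm_num) ha2).trans (by norm_num)
  have hbo : orderOf b ≤ 4 := (orderOf_le_of_pow_eq_one (by norm_num) hb2).trans (by norm_num)
  have hai : a⁻¹ = a := by rw [inv_eq_iff_mul_eq_one, ← pow_two, ha2]
  have hbi : b⁻¹ = b := by rw [inv_eq_iff_mul_eq_one, ← pow_two, hb2]
  rcases prod_pow hG hao hbo with h | h
  swap
  · exact h
  by_cases hodd : Odd (orderOf (a * b))
  · have : a * b = 1 := by
      refine eq_one_of_odd hodd ?_
      obtain ⟨k, -, hk⟩ := (Nat.dvd_prime_pow Nat.prime_two).1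
        (orderOf_dvd_of_pow_eq_one (n := 2 ^ 3) (by simpa using h))
      exact ⟨k, hk⟩
    simp [this]
  · obtain ⟨k, h1, h2⟩ := exists_invol_pow hG hodd
    have hki : ((a * b) ^ k)⁻¹ = (a * b) ^ k := by
      rw [inv_eq_iff_mul_eq_one, ← pow_two, h2]
    have e1 : a * (a * b) ^ k * a⁻¹ = (a * b) ^ k := by
      rw [← conj_pow]
      conv_rhs => rw [← hki, ← inv_pow, mul_inv_rev, hai, hbi]
      congr 1
      rw [hai, ← mul_assoc, ← pow_two, ha2, one_mul]
    have e2 : b * (a * b) ^ k * b⁻¹ = (a * b) ^ k := by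
      rw [← conj_pow]
      conv_rhs => rw [← hki, ← inv_pow, mul_inv_rev, hai, hbi]
      congr 1
      group
    have q1 := invol_unique hG ha ha2 h1 h2 (by rw [← mul_inv_eq_iff_eq_mul]; exact e1)
    have q2 := invol_unique hG hb hb2 h1 h2 (by rw [← mul_inv_eq_iff_eq_mul]; exact e2)
    have : a = b := q1.trans q2.symm
    subst this
    rw [← pow_two, ha2, one_pow]

/-- Centralizers of inverted 3-elements are inverted. -/
lemma cent_inverted (hG : HypHStar G) {a z g : G} (ha : a ≠ 1) (ha2 : a * a = 1)
    (hz : z ^ 9 = 1) (hz1 : z ≠ 1) (haz : a * z * a = z⁻¹) (hgz : g * z = z * g) :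
    a * g * a = g⁻¹ := by
  have hai : a⁻¹ = a := by rw [inv_eq_iff_mul_eq_one, ha2]
  have odd : ∀ k : G, k * z = z * k → Odd (orderOf k) := by
    intro k hk
    by_contra hodd
    obtain ⟨m, h1, h2⟩ := exists_invol_pow hG hodd
    apply hz1
    exact eq_one_of_odd (odd_of_pow_nine hz) (order_two_pow hG h1 h2 ((show Commute k z from hk).pow_left m))
  have hcg : Commute g z := hgz
  have hcag : Commute (a * g * a) z := by
    have h1 : Commute (a * g * a⁻¹) (a * z⁻¹ * a⁻¹) := by
      show _ * _ = _ * _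
      have : g * z⁻¹ = z⁻¹ * g := hcg.inv_right
      calc a * g * a⁻¹ * (a * z⁻¹ * a⁻¹) = a * (g * z⁻¹) * a⁻¹ := by group
        _ = a * (z⁻¹ * g) * a⁻¹ := by rw [this]
        _ = _ := by group
    have h2 : a * z⁻¹ * a⁻¹ = z := by
      rw [← haz, hai]
      calc a * (a * z * a) * a = (a * a) * z * (a * a) := by group
        _ = z := by rw [ha2]; group
    rwa [h2, hai] at h1
  set w := g⁻¹ * (a * g * a) with hw
  have hcw : Commute w z := hcg.inv_left.mul_left hcag
  obtain ⟨m, hm⟩ := odd w hcw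
  set h := w ^ (m + 1) with hh
  have hh2 : h * h = w := by
    rw [hh, ← pow_add, show m + 1 + (m + 1) = orderOf w + 1 by omega, pow_succ, pow_orderOf_eq_one,
      one_mul]
  have haw : a * w * a⁻¹ = w⁻¹ := by
    rw [hw, hai, mul_inv_rev, mul_inv_rev, mul_inv_rev, hai, inv_inv]
    calc a * (g⁻¹ * (a * g * a)) * a = a * g⁻¹ * a * g * (a * a) := by group
      _ = _ := by rw [ha2]; group
  have hah : a * h * a⁻¹ = h⁻¹ := by
    rw [hh, ← conj_pow, haw, inv_pow]
  have hch : Commute h z := hcw.pow_left _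
  have hfix : a * (g * h) = (g * h) * a := by
    have : a * g * a = g * w := by rw [hw]; group
    calc a * (g * h) = (a * g * a) * (a⁻¹ * a⁻¹) * (a * h * a⁻¹) * a := by group
      _ = g * w * h⁻¹ * a := by rw [this, hah, hai, ha2]; group
      _ = g * (h * h) * h⁻¹ * a := by rw [hh2]
      _ = _ := by group
  have h1 : g * h = 1 := eq_one_of_odd (odd _ (hcg.mul_left hch))
    (order_two_pow hG ha (by rw [pow_two, ha2]) hfix)
  have hgh : g = h⁻¹ := eq_inv_of_mul_eq_one_left h1
  rw [hgh, inv_inv]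
  rw [hai] at hah
  rw [← hah]
  calc a * (a * h * a) * a = (a * a) * h * (a * a) := by group
    _ = h := by rw [ha2]; group

lemma cent_abelian (hG : HypHStar G) {a z g k : G} (ha : a ≠ 1) (ha2 : a * a = 1)
    (hz : z ^ 9 = 1) (hz1 : z ≠ 1) (haz : a * z * a = z⁻¹) (hgz : g * z = z * g)
    (hkz : k * z = z * k) : g * k = k * g := by
  have h1 := cent_inverted hG ha ha2 hz hz1 haz hgz
  have h2 := cent_inverted hG ha ha2 hz hz1 haz hkz
  have h3 := cent_inverted hG ha ha2 hz hz1 haz (g := k * g)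
    ((show Commute k z from hkz).mul_left (show Commute g z from hgz))
  have : a * (k * g) * a = (a * k * a) * (a * g * a) := by
    calc a * (k * g) * a = a * k * 1 * g * a := by group
      _ = _ := by rw [← ha2]; group
  rw [this, h1, h2, ← mul_inv_rev] at h3
  exact inv_injective h3

/-- Case of order 9: everything collapses. -/
lemma collapse_nine {t x : G} (ht : t * t * t * t = 1) (hx : x * x * x = 1)
    (h6 : t * t * x * t * t * x = 1) (h9 : (x * t) ^ 9 = 1)
    (h36 : (t * t * t * x * t * x) ^ 9 = 1) : x ∈ Subgroup.zpowers (x * t) := by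
  have key := core_collapse (Q := G ⧸ Subgroup.zpowers (x * t))
    (fun q => t⁻¹ • q) (fun q => x⁻¹ • q) ((1 : G) : G ⧸ Subgroup.zpowers (x * t))
    (fun h => smul_left_cancel _ h) (fun h => smul_left_cancel _ h)
  have hone : ∀ (g : G) (q : G ⧸ Subgroup.zpowers (x * t)), g⁻¹ = 1 → g • q = q := by
    intro g q hg
    rw [inv_eq_one.mp hg, one_smul]
  have h9' : (t * x) ^ 9 = 1 := by
    have : t * x = x⁻¹ * (x * t) * (x⁻¹)⁻¹ := by group
    rw [this, conj_pow, h9]; group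
  have h6a : t * x * t * t * x * t = 1 := by
    have : t * x * t * t * x * t = t⁻¹ * (t * t * x * t * t * x) * t := by group
    rw [this, h6]; group
  have h6b : x * t * t * x * t * t = 1 := by
    have : x * t * t * x * t * t = (t * t)⁻¹ * (t * t * x * t * t * x) * (t * t) := by group
    rw [this, h6]; group
  simp only [pow_succ, pow_zero, one_mul, mul_assoc] at ht hx h6 h9 h36 h9' h6a h6b
  have := key ?_ ?_ ?_ ?_ ?_ ?_ ?_ ?_ ?_
  · simp only [MulAction.Quotient.smul_mk, QuotientGroup.eq, smul_eq_mul] at this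
    simpa using this
  · simp only [smul_smul, MulAction.Quotient.smul_mk, QuotientGroup.eq, smul_eq_mul]
    simp
  all_goals
    intro q
    simp only [smul_smul]
    apply hone
    simp only [mul_inv_rev, inv_inv, mul_assoc]
    assumption

/-- The case `x ^ 3 = 1`. -/
lemma comm_three (hG : HypHStar G) {t x : G} (ht : orderOf t = 4) (hx : x ^ 3 = 1)
    (hinv : t ^ 2 * x * t ^ 2 = x⁻¹) : x * (t * x * t⁻¹) = (t * x * t⁻¹) * x := by
  have ht4 : t ^ 4 = 1 := by rw [← ht, pow_orderOf_eq_one]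
  have ha : t ^ 2 ≠ 1 := fun h => by
    have := Nat.le_of_dvd (by norm_num) (orderOf_dvd_of_pow_eq_one h); omega
  have ha2 : t ^ 2 * t ^ 2 = 1 := by rw [← pow_add, ht4]
  have hx9 : x ^ 9 = 1 := by rw [show 9 = 3 * 3 by norm_num, pow_mul, hx, one_pow]
  have hai : (t ^ 2)⁻¹ = t ^ 2 := by rw [inv_eq_iff_mul_eq_one, ha2]
  obtain ⟨y, hy⟩ : ∃ y, y = t * x * t⁻¹ := ⟨_, rfl⟩
  rw [← hy]
  have hy3 : y ^ 3 = 1 := by rw [hy, conj_pow, hx]; group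
  have htx : t * x = y * t := by rw [hy]; group
  have hax : t ^ 2 * x = x⁻¹ * t ^ 2 := by
    rw [← hinv]
    rw [mul_assoc _ (t ^ 2) (t ^ 2), ha2, mul_one]
  have hty : t * y = x⁻¹ * t := by
    have : t * y = t ^ 2 * x * t⁻¹ := by rw [hy, pow_two]; simp only [mul_assoc]
    rw [this, hax]; group
  have hay : t ^ 2 * y = y⁻¹ * t ^ 2 := by
    have h1 : t * x⁻¹ = y⁻¹ * t := by rw [hy]; group
    rw [pow_two, mul_assoc, hty, ← mul_assoc, h1, mul_assoc]
  have hs2 : (x * t) ^ 2 = x * y * t ^ 2 := by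
    calc (x * t) ^ 2 = x * (t * x) * t := by rw [pow_two]; group
      _ = _ := by rw [htx, pow_two]; group
  have hs4 : (x * t) ^ 4 = x * y * x⁻¹ * y⁻¹ := by
    rw [show 4 = 2 * 2 by norm_num, pow_mul, hs2, pow_two]
    calc x * y * t ^ 2 * (x * y * t ^ 2) = x * y * (t ^ 2 * x) * y * t ^ 2 := by group
      _ = x * y * x⁻¹ * (t ^ 2 * y) * t ^ 2 := by rw [hax]; group
      _ = x * y * x⁻¹ * y⁻¹ * (t ^ 2 * t ^ 2) := by rw [hay]; group
      _ = _ := by rw [ha2, mul_one]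
  rcases prod_pow hG (x := x) (y := t)
    ((orderOf_le_of_pow_eq_one (by norm_num) hx).trans (by norm_num)) ht.le with h8 | h9
  · -- the commutator is an involution, which generates a Klein four-group with a conjugate
    obtain ⟨i, hi⟩ : ∃ i, i = x * y * x⁻¹ * y⁻¹ := ⟨_, rfl⟩
    have hi2 : i ^ 2 = 1 := by
      rw [hi, ← hs4, ← pow_mul, h8]
    have hii : i⁻¹ = i := by rw [inv_eq_iff_mul_eq_one, ← pow_two, hi2]
    by_cases hi1 : i = 1
    · rw [hi, mul_inv_eq_one, mul_inv_eq_iff_eq_mul] at hi1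
      exact hi1
    · have hiy : (i * y) ^ 3 = 1 := by
        have : i * y = x * y * x⁻¹ := by rw [hi]; group
        rw [this, conj_pow, hy3]; group
      -- i * (y i y⁻¹) * (y² i y⁻²) = 1
      have hprod : i * (y * i * y⁻¹) = (y ^ 2 * i * (y ^ 2)⁻¹)⁻¹ := by
        rw [eq_inv_iff_mul_eq_one]
        calc i * (y * i * y⁻¹) * (y ^ 2 * i * (y ^ 2)⁻¹) = (i * y) ^ 3 * (y ^ 3)⁻¹ := by
              simp only [pow_succ, pow_zero]; group
          _ = 1 := by rw [hiy, hy3]; group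
      have hj2 : (y * i * y⁻¹) ^ 2 = 1 := by rw [conj_pow, hi2]; group
      have hj1 : y * i * y⁻¹ ≠ 1 := fun h => hi1 (by simpa using h)
      have hji : (y * i * y⁻¹)⁻¹ = y * i * y⁻¹ := by
        rw [inv_eq_iff_mul_eq_one, ← pow_two, hj2]
      have hki : (y ^ 2 * i * (y ^ 2)⁻¹)⁻¹ = y ^ 2 * i * (y ^ 2)⁻¹ := by
        rw [inv_eq_iff_mul_eq_one, ← pow_two, conj_pow, hi2]; group
      have hcomm : i * (y * i * y⁻¹) = (y * i * y⁻¹) * i := by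
        have : (i * (y * i * y⁻¹))⁻¹ = i * (y * i * y⁻¹) := by
          rw [hprod, inv_inv, hki]
        rw [← this, mul_inv_rev, hji, hii]
      have heq := invol_unique hG hi1 hi2 hj1 hj2 hcomm
      have hiy' : i * y = y * i := by
        rw [eq_mul_inv_iff_mul_eq] at heq
        exact heq
      have hy9 : y ^ 9 = 1 := by rw [show 9 = 3 * 3 by norm_num, pow_mul, hy3, one_pow]
      have hy1 : y = 1 := eq_one_of_odd (odd_of_pow_nine hy9) (order_two_pow hG hi1 hi2 hiy')
      rw [hy1, mul_one, one_mul]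
  · -- order 9
    have hxyx : (x * y * x) ^ 9 = 1 := by
      have hy9 : y ^ 9 = 1 := by rw [show 9 = 3 * 3 by norm_num, pow_mul, hy3, one_pow]
      have hc : t ^ 2 * (x * y * x) = x⁻¹ * (t ^ 2 * y) * x := by
        calc t ^ 2 * (x * y * x) = (t ^ 2 * x) * y * x := by group
          _ = _ := by rw [hax]; group
      have hne : t ^ 2 * y ≠ 1 := fun h => by
        have h1 : y = t ^ 2 := by rw [← hai, eq_comm, inv_eq_iff_mul_eq_one, h]
        have h2 : (t ^ 2) ^ 9 = 1 := by rw [← h1, hy9]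
        apply ha
        calc t ^ 2 = (t ^ 2) ^ 9 * ((t ^ 4) ^ 4)⁻¹ := by group
          _ = 1 := by rw [h2, ht4]; group
      have hsq : (t ^ 2 * y) ^ 2 = 1 := by
        calc (t ^ 2 * y) ^ 2 = (t ^ 2 * y) * t ^ 2 * y := by rw [pow_two]; group
          _ = y⁻¹ * (t ^ 2 * t ^ 2) * y := by rw [hay]; group
          _ = 1 := by rw [ha2]; group
      have := invol_mul hG ha (by rw [pow_two, ha2]) (b := t ^ 2 * (x * y * x))
        (by
          rw [hc]; intro h
          apply hne
          have h' : t ^ 2 * y = x * (x⁻¹ * (t ^ 2 * y) * x) * x⁻¹ := by group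
          rw [h', h]; group)
        (by
          rw [hc]
          have := conj_pow (i := 2) (a := x⁻¹) (b := t ^ 2 * y)
          rw [inv_inv] at this
          rw [this, hsq]; group)
      rwa [← mul_assoc, ha2, one_mul] at this
    have hyx : (y⁻¹ * x) ^ 9 = 1 := by
      have h2 : y⁻¹ * x = (x * (x * y * x) * x⁻¹)⁻¹ := by
        have h3 : x * x = x⁻¹ := by
          rw [eq_inv_iff_mul_eq_one, ← hx]; simp only [pow_succ, pow_zero, one_mul]
        calc y⁻¹ * x = y⁻¹ * (x⁻¹)⁻¹ := by group
          _ = y⁻¹ * (x * x)⁻¹ := by rw [h3]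
          _ = _ := by group
      rw [h2, inv_pow, conj_pow, hxyx]; group
    have ht3 : t * t * t = t⁻¹ := by
      rw [eq_inv_iff_mul_eq_one, ← ht4]; simp only [pow_succ, pow_zero, one_mul]
    have htxt : t⁻¹ * x * t = y⁻¹ := by
      rw [eq_inv_iff_mul_eq_one]
      have : t * y * t⁻¹ = x⁻¹ := by rw [hty]; group
      calc t⁻¹ * x * t * y = t⁻¹ * x * (t * y * t⁻¹) * t := by group
        _ = 1 := by rw [this]; group
    have hmem := collapse_nine (t := t) (x := x)
      (by rw [← ht4]; simp only [pow_succ, pow_zero, one_mul])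
      (by rw [← hx]; simp only [pow_succ, pow_zero, one_mul])
      (by
        calc t * t * x * t * t * x = (t ^ 2 * x * t ^ 2) * x := by
              simp only [pow_two, mul_assoc]
          _ = 1 := by rw [hinv]; group)
      h9 (by rw [ht3, htxt, hyx])
    obtain ⟨n, hn⟩ := hmem
    have hc : Commute x (x * t) := by
      have h := (Commute.refl (x * t)).zpow_left n
      have hn' : (x * t) ^ n = x := hn
      rwa [hn'] at h
    have hxt : x * t = t * x := by
      have h : x * (x * t) = (x * t) * x := hc
      rw [mul_assoc] at h
      exact mul_left_cancel h
    have : y = x := by rw [hy, ← hxt]; group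
    rw [this]

/-- The general case. -/
lemma comm_nine (hG : HypHStar G) {t x : G} (ht : orderOf t = 4) (hx : x ^ 9 = 1)
    (hinv : t ^ 2 * x * t ^ 2 = x⁻¹) : x * (t * x * t⁻¹) = (t * x * t⁻¹) * x := by
  by_cases hx3 : x ^ 3 = 1
  · exact comm_three hG ht hx3 hinv
  have ht4 : t ^ 4 = 1 := by rw [← ht, pow_orderOf_eq_one]
  have ha : t ^ 2 ≠ 1 := fun h => by
    have := Nat.le_of_dvd (by norm_num) (orderOf_dvd_of_pow_eq_one h); omega
  have ha2 : t ^ 2 * t ^ 2 = 1 := by rw [← pow_add, ht4]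
  have hai : (t ^ 2)⁻¹ = t ^ 2 := by rw [inv_eq_iff_mul_eq_one, ha2]
  have hinv3 : t ^ 2 * x ^ 3 * t ^ 2 = (x ^ 3)⁻¹ := by
    have := conj_pow (i := 3) (a := t ^ 2) (b := x)
    rw [hai, hinv] at this
    rw [← this, inv_pow]
  have h3 := comm_three hG ht (x := x ^ 3) (by rw [← pow_mul, hx]) hinv3
  have hw : t * x ^ 3 * t⁻¹ = (t * x * t⁻¹) ^ 3 := by rw [conj_pow]
  obtain ⟨y, hy⟩ : ∃ y, y = t * x * t⁻¹ := ⟨_, rfl⟩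
  rw [hw] at h3
  rw [← hy] at h3 ⊢
  have hz9 : (x ^ 3) ^ 9 = 1 := by rw [← pow_mul, mul_comm, pow_mul, hx, one_pow]
  have hy9 : (y ^ 3) ^ 9 = 1 := by
    rw [← pow_mul, mul_comm, pow_mul, hy, conj_pow, hx]; group
  have hy1 : y ^ 3 ≠ 1 := fun h => by
    rw [hy, conj_pow] at h
    exact hx3 (by simpa using h)
  have hyinv : t ^ 2 * y ^ 3 * t ^ 2 = (y ^ 3)⁻¹ := by
    rw [hy, conj_pow]
    calc t ^ 2 * (t * x ^ 3 * t⁻¹) * t ^ 2 = t * (t ^ 2 * x ^ 3 * t ^ 2) * t⁻¹ := by group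
      _ = _ := by rw [hinv3]; group
  have hxw : x * y ^ 3 = y ^ 3 * x :=
    cent_abelian hG ha ha2 hz9 hx3 hinv3 (Commute.self_pow x 3) h3.symm
  exact cent_abelian hG ha ha2 hy9 hy1 hyinv hxw (Commute.self_pow y 3)

end helpers


theorem statement_10 (G : Type*) [Group G] (hG : HypHStar G)
    (t : G) (ht : orderOf t = 4) (u : G) (g : G) (hu : u = g * t * g⁻¹) :
    (t * u) ^ 2 = 1 ∧ (t * u⁻¹) ^ 9 = 1 ∧ (t * u ^ 2) ^ 4 = 1 := by
  have ht4 : t ^ 4 = 1 := by rw [← ht, pow_orderOf_eq_one]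
  have ha : t ^ 2 ≠ 1 := fun h => by
    have := Nat.le_of_dvd (by norm_num) (orderOf_dvd_of_pow_eq_one h); omega
  obtain ⟨a, haa⟩ : ∃ a, a = t ^ 2 := ⟨_, rfl⟩
  have ha2 : a * a = 1 := by rw [haa, ← pow_add, ht4]
  have hai : a⁻¹ = a := by rw [inv_eq_iff_mul_eq_one, ha2]
  have hane : a ≠ 1 := by rwa [haa]
  obtain ⟨b, hb⟩ : ∃ b, b = g * a * g⁻¹ := ⟨_, rfl⟩
  have hb2 : b * b = 1 := by
    rw [hb]
    calc g * a * g⁻¹ * (g * a * g⁻¹) = g * (a * a) * g⁻¹ := by group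
      _ = 1 := by rw [ha2]; group
  have hbi : b⁻¹ = b := by rw [inv_eq_iff_mul_eq_one, hb2]
  have hbne : b ≠ 1 := fun h => hane (by rw [hb] at h; simpa using h)
  have h9 : (b * a) ^ 9 = 1 := invol_mul hG hbne (by rw [pow_two, hb2]) hane (by rw [pow_two, ha2])
  obtain ⟨d, hd⟩ : ∃ d, d = (b * a) ^ 5 := ⟨_, rfl⟩
  have hd2 : d * d = b * a := by
    rw [hd, ← pow_add, show 5 + 5 = 9 + 1 by norm_num, pow_add, h9, one_mul, pow_one]
  have hd9 : d ^ 9 = 1 := by rw [hd, ← pow_mul, mul_comm, pow_mul, h9, one_pow]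
  have hda : a * d * a = d⁻¹ := by
    have h := conj_pow (i := 5) (a := a) (b := b * a)
    rw [hai] at h
    rw [hd, ← h, ← inv_pow]
    congr 1
    rw [mul_inv_rev, hai, hbi]
    calc a * (b * a) * a = a * b * (a * a) := by group
      _ = a * b := by rw [ha2, mul_one]
  have had : a * d = d⁻¹ * a := by
    rw [← hda]; rw [mul_assoc _ a a, ha2, mul_one]
  have hdad : d * a * d⁻¹ = b := by
    have : a * d⁻¹ = d * a := by
      rw [mul_inv_eq_iff_eq_mul, mul_assoc, had]; group
    rw [mul_assoc, this, ← mul_assoc, hd2, mul_assoc, ha2, mul_one]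
  -- `d⁻¹ * g` centralizes `a`, hence `t`
  have hca : a * (d⁻¹ * g) = (d⁻¹ * g) * a := by
    have h1 : g * a * g⁻¹ = d * a * d⁻¹ := by rw [hdad, hb]
    calc a * (d⁻¹ * g) = d⁻¹ * (d * a * d⁻¹) * g := by group
      _ = d⁻¹ * (g * a * g⁻¹) * g := by rw [h1]
      _ = _ := by group
  have hct : a * t = t * a := by rw [haa]; group
  have hgt := cent_comm hG hane (by rw [pow_two, ha2]) hca hct
  have hu' : u = d * t * d⁻¹ := by
    rw [hu]
    calc g * t * g⁻¹ = d * ((d⁻¹ * g) * t) * g⁻¹ := by group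
      _ = d * (t * (d⁻¹ * g)) * g⁻¹ := by rw [hgt]
      _ = _ := by group
  have hcomm := comm_nine hG ht hd9 (by rw [← haa]; exact hda)
  obtain ⟨e, he⟩ : ∃ e, e = t * d * t⁻¹ := ⟨_, rfl⟩
  rw [← he] at hcomm
  have hc : Commute d e := hcomm
  have he9 : e ^ 9 = 1 := by rw [he, conj_pow, hd9]; group
  have htd : t * d = e * t := by rw [he]; group
  have hae : a * e = e⁻¹ * a := by
    rw [he]
    calc a * (t * d * t⁻¹) = (a * t) * d * t⁻¹ := by group
      _ = t * (a * d) * t⁻¹ := by rw [hct]; group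
      _ = t * d⁻¹ * a * t⁻¹ := by rw [had]; group
      _ = _ := by rw [haa]; group
  have hadi : a * d⁻¹ = d * a := by
    rw [mul_inv_eq_iff_eq_mul, mul_assoc, had]; group
  refine ⟨?_, ?_, ?_⟩
  · have h1 : t * u = e * d * a := by
      rw [hu']
      calc t * (d * t * d⁻¹) = (t * d) * t * d⁻¹ := by group
        _ = e * a * d⁻¹ := by rw [htd, haa, pow_two]; group
        _ = _ := by rw [mul_assoc, hadi]; group
    rw [h1, pow_two]
    calc e * d * a * (e * d * a) = e * d * (a * e) * d * a := by group
      _ = e * d * e⁻¹ * (a * d) * a := by rw [hae]; group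
      _ = e * d * e⁻¹ * d⁻¹ * (a * a) := by rw [had]; group
      _ = d * e * e⁻¹ * d⁻¹ := by rw [ha2, hcomm, mul_one]
      _ = 1 := by group
  · have h1 : t * u⁻¹ = e * d⁻¹ := by rw [hu', he]; group
    rw [h1, (hc.symm.inv_right).mul_pow, inv_pow, he9, hd9]; group
  · have hadi2 : t * (d * d) = e * e * t := by
      rw [← mul_assoc, htd, mul_assoc, htd, mul_assoc]
    have h1 : t * u ^ 2 = e ^ 2 * t * a := by
      have hu2 : u ^ 2 = d * a * d⁻¹ := by rw [hu', conj_pow, haa]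
      rw [hu2]
      calc t * (d * a * d⁻¹) = t * d * (a * d⁻¹) := by simp only [mul_assoc]
        _ = t * (d * d) * a := by rw [hadi]; simp only [mul_assoc]
        _ = e ^ 2 * t * a := by rw [hadi2, pow_two]
    have hte : t * e = d⁻¹ * t := by
      have : t * e = (a * d) * t⁻¹ := by rw [he, haa, pow_two]; simp only [mul_assoc]
      rw [this, had, haa]; group
    have htei : t * e⁻¹ = d * t := by
      rw [mul_inv_eq_iff_eq_mul, mul_assoc, hte]; group
    have hae2 : a * e ^ 2 = e⁻¹ ^ 2 * a := (SemiconjBy.pow_right (show SemiconjBy a e e⁻¹ from hae) 2)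
    have had2 : a * d ^ 2 = d⁻¹ ^ 2 * a := (SemiconjBy.pow_right (show SemiconjBy a d d⁻¹ from had) 2)
    have hte2 : t * e⁻¹ ^ 2 = d ^ 2 * t := (SemiconjBy.pow_right (show SemiconjBy t e⁻¹ d from htei) 2)
    have h2 : (t * u ^ 2) ^ 2 = e ^ 2 * d ^ 2 * a := by
      rw [h1, pow_two]
      calc e ^ 2 * t * a * (e ^ 2 * t * a) = e ^ 2 * t * (a * e ^ 2) * t * a := by
            simp only [mul_assoc]
        _ = e ^ 2 * (t * e⁻¹ ^ 2) * (a * t) * a := by rw [hae2]; simp only [mul_assoc]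
        _ = e ^ 2 * d ^ 2 * (t * t) * (a * a) := by rw [hte2, hct]; simp only [mul_assoc]
        _ = e ^ 2 * d ^ 2 * a := by rw [ha2, mul_one, haa, pow_two t]
    rw [show 4 = 2 * 2 by norm_num, pow_mul, h2, pow_two]
    have hc2 : e ^ 2 * d ^ 2 = d ^ 2 * e ^ 2 := (hc.symm.pow_pow 2 2)
    calc e ^ 2 * d ^ 2 * a * (e ^ 2 * d ^ 2 * a)
        = e ^ 2 * d ^ 2 * (a * e ^ 2) * d ^ 2 * a := by simp only [mul_assoc]
      _ = e ^ 2 * d ^ 2 * e⁻¹ ^ 2 * (a * d ^ 2) * a := by rw [hae2]; simp only [mul_assoc]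
      _ = e ^ 2 * d ^ 2 * e⁻¹ ^ 2 * d⁻¹ ^ 2 * (a * a) := by rw [had2]; simp only [mul_assoc]
      _ = 1 := by rw [ha2, hc2, mul_one, inv_pow, inv_pow]; group
end

section
/- Let G be a group satisfying hypothesis (H*) and let a, b, c be involutions of G. Then a * b * c is an involution of G, i.e., (a * b * c)^2 = 1 and a * b * c ≠ 1. -/
namespace ThreeInv

/-! ### A small certified checker for coset enumerations

Letters: `1 = u`, `2 = u⁻¹`, `3 = c`, anything else is trivial. A fact `(i, x, k, j)` says
`ρ i * x = (u c)^k * ρ j`, where `ρ i` is the value of the `i`-th word. -/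

section Checker

abbrev CFact := ℕ × ℕ × ℕ × ℕ
abbrev CStep := ℕ × ℕ × ℕ × ℕ × List ℕ

def lev {G : Type*} [Group G] (u c : G) (x : ℕ) : G :=
  if x = 1 then u else if x = 2 then u⁻¹ else if x = 3 then c else 1

def linv (x : ℕ) : ℕ :=
  if x = 1 then 2 else if x = 2 then 1 else if x = 3 then 3 else 0

def wev {G : Type*} [Group G] (u c : G) (w : List ℕ) : G := (w.map (lev u c)).prod

def cflip (f : CFact) : CFact := (f.2.2.2, linv f.2.1, (7 * f.2.2.1) % 8, f.1)

def getF (F : List CFact) (r : ℕ) : CFact :=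
  if r % 2 = 0 then F.getD (r / 2) (0, 0, 0, 0) else cflip (F.getD (r / 2) (0, 0, 0, 0))

/-- prepend a letter unless it is trivial -/
def lcons (x : ℕ) (w : List ℕ) : List ℕ := if x = 0 then w else x :: w

def trace (F : List CFact) : ℕ → List ℕ → Option (List ℕ × ℕ × ℕ)
  | i, [] => some ([], 0, i)
  | i, r :: rs =>
    if (getF F r).1 = i then
      match trace F (getF F r).2.2.2 rs with
      | some (w, k, j) => some (lcons (getF F r).2.1 w, ((getF F r).2.2.1 + k) % 8, j)
      | none => none
    else none

def rep (n : ℕ) (w : List ℕ) : List ℕ := (List.replicate n w).flatten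

def rels (extra : List ℕ) : List (List ℕ) :=
  [[3, 3], [1, 1, 1], rep 8 [1, 3], rep 9 [1, 3, 2, 3], rep 9 [2, 3, 1, 3, 1, 3], rep 2 extra]

def isFree (w : List ℕ) : Bool :=
  match w with
  | [x, y] => decide (x = linv y)
  | _ => false

def okWord (extra : List ℕ) (r rot : ℕ) (w : List ℕ) : Bool :=
  if r = 0 then isFree w else decide (((rels extra).getD (r - 1) []).rotate rot = w)

def doStep (extra : List ℕ) (F : List CFact) (s : CStep) : Option (List CFact) :=
  match trace F s.2.2.2.1 s.2.2.2.2 with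
  | some (w, k, j) =>
    if okWord extra s.1 s.2.1 (w ++ lcons s.2.2.1 []) then
      some ((j, s.2.2.1, (7 * k) % 8, s.2.2.2.1) :: F) else none
  | none => none

def doSteps (extra : List ℕ) : List CFact → List CStep → Option (List CFact)
  | F, [] => some F
  | F, s :: ss =>
    match doStep extra F s with
    | some F' => doSteps extra F' ss
    | none => none

def okInit (words : List (List ℕ)) (f : CFact) : Bool :=
  decide (f.2.2.1 = 0) && decide (words.getD f.2.2.2 [] = words.getD f.1 [] ++ [f.2.1])

def okLast (F : List CFact) : Bool :=
  match F with
  | f :: _ => decide (f.1 = f.2.2.2) && decide (f.2.1 = 0) &&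
      decide (4 % Nat.gcd 8 f.2.2.1 = 0)
  | [] => false

def runCheck (words : List (List ℕ)) (init : List CFact) (steps : List CStep)
    (extra : List ℕ) : Bool :=
  decide (words.getD 0 [] = []) && decide (words.getD 1 [] = [1]) &&
  init.all (okInit words) &&
  match doSteps extra (init.reverse ++ [(1, 3, 1, 0)]) steps with
  | some F => okLast F
  | none => false

variable {G : Type*} [Group G]

def Valid (u c : G) (ρ : ℕ → G) (f : CFact) : Prop :=
  ρ f.1 * lev u c f.2.1 = (u * c) ^ f.2.2.1 * ρ f.2.2.2

theorem lev_zero (u c : G) : lev u c 0 = 1 := by simp [lev]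

theorem lev_linv (u c : G) (hc : c * c = 1) (x : ℕ) : lev u c (linv x) = (lev u c x)⁻¹ := by
  have : c⁻¹ = c := inv_eq_of_mul_eq_one_right hc
  unfold linv
  by_cases h1 : x = 1
  · simp [h1, lev]
  by_cases h2 : x = 2
  · simp [h2, lev]
  by_cases h3 : x = 3
  · simp [h3, lev, this]
  simp [h1, h2, h3, lev]

theorem wev_lcons (u c : G) (x : ℕ) (w : List ℕ) :
    wev u c (lcons x w) = lev u c x * wev u c w := by
  unfold lcons
  by_cases h : x = 0
  · simp [h, lev_zero]
  · simp [h, wev]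

theorem wev_append (u c : G) (w w' : List ℕ) :
    wev u c (w ++ w') = wev u c w * wev u c w' := by simp [wev]

theorem wev_rep (u c : G) (n : ℕ) (w : List ℕ) : wev u c (rep n w) = (wev u c w) ^ n := by
  induction n with
  | zero => simp [rep, wev]
  | succ n ih =>
    have : rep (n + 1) w = w ++ rep n w := by simp [rep, List.replicate_succ]
    rw [this, wev_append, ih, pow_succ']

theorem pow_seven (v : G) (hv : v ^ 8 = 1) (k : ℕ) : v ^ ((7 * k) % 8) = (v ^ k)⁻¹ := by
  rw [← pow_eq_pow_mod _ hv]
  apply eq_inv_of_mul_eq_one_left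
  rw [← pow_add, show 7 * k + k = 8 * k by ring, pow_mul, hv, one_pow]

theorem valid_cflip (u c : G) (hc : c * c = 1) (hv : (u * c) ^ 8 = 1) (ρ : ℕ → G) (f : CFact)
    (h : Valid u c ρ f) : Valid u c ρ (cflip f) := by
  unfold Valid at *
  simp only [cflip]
  rw [lev_linv u c hc, pow_seven _ hv, mul_inv_eq_iff_eq_mul, mul_assoc, h]
  group

theorem valid_getF (u c : G) (hc : c * c = 1) (hv : (u * c) ^ 8 = 1) (ρ : ℕ → G)
    (F : List CFact) (hF : ∀ f ∈ F, Valid u c ρ f) (r : ℕ) : Valid u c ρ (getF F r) := by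
  have key : ∀ n : ℕ, Valid u c ρ (F.getD n (0, 0, 0, 0)) := by
    intro n
    rcases lt_or_ge n F.length with h | h
    · rw [List.getD_eq_getElem _ _ h]
      exact hF _ (List.getElem_mem h)
    · rw [List.getD_eq_default _ _ h]
      simp [Valid, lev_zero]
  unfold getF
  split_ifs
  · exact key _
  · exact valid_cflip u c hc hv ρ _ (key _)

theorem trace_sound (u c : G) (hc : c * c = 1) (hv : (u * c) ^ 8 = 1) (ρ : ℕ → G)
    (F : List CFact) (hF : ∀ f ∈ F, Valid u c ρ f) (rs : List ℕ) :
    ∀ (i : ℕ) (w : List ℕ) (k j : ℕ), trace F i rs = some (w, k, j) →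
      ρ i * wev u c w = (u * c) ^ k * ρ j := by
  induction rs with
  | nil =>
    intro i w k j h
    simp only [trace, Option.some.injEq, Prod.mk.injEq] at h
    obtain ⟨rfl, rfl, rfl⟩ := h
    simp [wev]
  | cons r rs ih =>
    intro i w k j h
    rw [trace] at h
    split_ifs at h with hi
    cases ht : trace F (getF F r).2.2.2 rs with
    | none => rw [ht] at h; simp at h
    | some p =>
      obtain ⟨w', k', j'⟩ := p
      rw [ht] at h
      simp only [Option.some.injEq, Prod.mk.injEq] at h
      obtain ⟨rfl, rfl, rfl⟩ := h
      have h1 := ih _ _ _ _ ht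
      have h2 := valid_getF u c hc hv ρ F hF r
      unfold Valid at h2
      rw [hi] at h2
      rw [wev_lcons, ← mul_assoc, h2, mul_assoc, h1, ← pow_eq_pow_mod _ hv, pow_add, mul_assoc]

theorem okWord_sound (u c : G) (hc : c * c = 1) (hu : u ^ 3 = 1) (hv : (u * c) ^ 8 = 1)
    (ht : (u * c * u⁻¹ * c) ^ 9 = 1) (hz : (u⁻¹ * c * u * c * u * c) ^ 9 = 1) (extra : List ℕ)
    (hR : (wev u c extra) ^ 2 = 1) (r rot : ℕ) (w : List ℕ)
    (h : okWord extra r rot w = true) : wev u c w = 1 := by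
  unfold okWord at h
  split_ifs at h with hr
  · unfold isFree at h
    split at h
    · rename_i x y
      rw [decide_eq_true_eq] at h
      subst h
      simp [wev, lev_linv u c hc]
    · simp at h
  · rw [decide_eq_true_eq] at h
    rw [← h]
    have hall : ∀ l ∈ rels extra, wev u c l = 1 := by
      intro l hl
      simp only [rels, List.mem_cons, List.not_mem_nil, or_false] at hl
      rcases hl with rfl | rfl | rfl | rfl | rfl | rfl
      · simpa [wev, lev] using hc
      · rw [← hu, pow_succ, pow_two]; simp [wev, lev, mul_assoc]
      · rw [wev_rep, ← hv]; simp [wev, lev]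
      · rw [wev_rep, ← ht]; simp [wev, lev, mul_assoc]
      · rw [wev_rep, ← hz]; simp [wev, lev, mul_assoc]
      · rw [wev_rep, hR]
    have hl : wev u c ((rels extra).getD (r - 1) []) = 1 := by
      rcases lt_or_ge (r - 1) (rels extra).length with h | h
      · rw [List.getD_eq_getElem _ _ h]
        exact hall _ (List.getElem_mem h)
      · rw [List.getD_eq_default _ _ h]
        simp [wev]
    unfold wev at *
    rw [List.map_rotate]
    exact List.prod_rotate_eq_one_of_prod_eq_one hl rot

theorem cert_sound (u c : G) (hc : c * c = 1) (hu : u ^ 3 = 1) (hv : (u * c) ^ 8 = 1)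
    (ht : (u * c * u⁻¹ * c) ^ 9 = 1) (hz : (u⁻¹ * c * u * c * u * c) ^ 9 = 1)
    (words : List (List ℕ)) (init : List CFact) (steps : List CStep) (extra : List ℕ)
    (hR : (wev u c extra) ^ 2 = 1) (h : runCheck words init steps extra = true) :
    (u * c) ^ 4 = 1 := by
  unfold runCheck at h
  simp only [Bool.and_eq_true, decide_eq_true_eq, List.all_eq_true] at h
  obtain ⟨⟨⟨h0, h1⟩, hi⟩, hs⟩ := h
  set ρ : ℕ → G := fun n => wev u c (words.getD n []) with hρ
  have hstep : ∀ (ss : List CStep) (F F' : List CFact), (∀ f ∈ F, Valid u c ρ f) →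
      doSteps extra F ss = some F' → ∀ f ∈ F', Valid u c ρ f := by
    intro ss
    induction ss with
    | nil =>
      intro F F' hF h
      simp only [doSteps, Option.some.injEq] at h
      subst h; exact hF
    | cons s ss ih =>
      intro F F' hF h
      rw [doSteps] at h
      cases hd : doStep extra F s with
      | none => rw [hd] at h; simp at h
      | some F1 =>
        rw [hd] at h
        refine ih F1 F' ?_ h
        unfold doStep at hd
        cases htr : trace F s.2.2.2.1 s.2.2.2.2 with
        | none => rw [htr] at hd; simp at hd
        | some p =>
          obtain ⟨w, k, j⟩ := p
          rw [htr] at hd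
          simp only at hd
          split_ifs at hd with hok
          simp only [Option.some.injEq] at hd
          subst hd
          intro f hf
          rcases List.mem_cons.1 hf with rfl | hf
          · have e1 := trace_sound u c hc hv ρ F hF _ _ _ _ _ htr
            have e2 := okWord_sound u c hc hu hv ht hz extra hR _ _ _ hok
            rw [wev_append, wev_lcons] at e2
            have e3 : wev u c [] = 1 := by simp [wev]
            rw [e3, mul_one] at e2
            unfold Valid
            simp only
            rw [pow_seven _ hv, eq_inv_mul_iff_mul_eq, ← mul_assoc, ← e1, mul_assoc, e2, mul_one]
          · exact hF f hf
  cases hd : doSteps extra (init.reverse ++ [(1, 3, 1, 0)]) steps with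
  | none => rw [hd] at hs; simp at hs
  | some F =>
    rw [hd] at hs
    simp only at hs
    have hF := hstep steps _ F ?_ hd
    · unfold okLast at hs
      split at hs
      · rename_i f _
        simp only [Bool.and_eq_true, decide_eq_true_eq] at hs
        obtain ⟨⟨h2, h3⟩, h4⟩ := hs
        have := hF f (by simp)
        unfold Valid at this
        rw [h3, lev_zero, mul_one, h2, right_eq_mul] at this
        have h5 := pow_gcd_eq_one.2 ⟨hv, this⟩
        obtain ⟨m, hm⟩ := Nat.dvd_of_mod_eq_zero h4
        rw [hm, pow_mul, h5, one_pow]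
      · simp at hs
    · intro f hf
      rcases List.mem_append.1 hf with hf | hf
      · have := hi f (List.mem_reverse.1 hf)
        unfold okInit at this
        simp only [Bool.and_eq_true, decide_eq_true_eq] at this
        unfold Valid
        rw [this.1, hρ]
        simp only
        rw [this.2, wev_append]
        simp [wev]
      · rw [List.mem_singleton] at hf
        subst hf
        simp only [Valid, hρ]
        rw [h0, h1]
        simp [wev, lev]


def words_three : List (List ℕ) :=
  [
    [], [1], [1, 1], [1, 1, 3], [1, 1, 3, 2], [1, 1, 3, 2, 3], [1, 1, 3, 2, 3, 2],
    [1, 1, 3, 2, 3, 2, 3], [1, 1, 3, 2, 3, 2, 3, 1], [1, 1, 3, 2, 3, 2, 3, 1, 3],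
    [1, 1, 3, 2, 3, 2, 3, 1, 3, 1], [1, 1, 3, 2, 3, 2, 3, 1, 3, 1, 3],
    [1, 1, 3, 2, 3, 2, 3, 1, 3, 1, 3, 1], [1, 1, 3, 2, 3, 2, 3, 1, 3, 1, 3, 1, 3],
    [1, 1, 3, 2, 3, 2, 3, 1, 3, 1, 3, 1, 3, 2], [1, 1, 3, 2, 3, 2, 3, 1, 3, 1, 3, 1, 3, 2, 3],
    [1, 1, 3, 1], [1, 1, 3, 1, 3], [1, 1, 3, 1, 3, 1], [1, 1, 3, 1, 3, 1, 3],
    [1, 1, 3, 1, 3, 1, 3, 2], [1, 1, 3, 1, 3, 1, 3, 2, 3], [1, 1, 3, 1, 3, 1, 3, 1],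
    [1, 1, 3, 1, 3, 1, 3, 1, 3], [1, 1, 3, 2, 3, 2, 3, 1, 3, 1, 3, 1, 3, 2, 3, 1],
    [1, 1, 3, 2, 3, 2, 3, 1, 3, 1, 3, 1, 3, 2, 3, 1, 3]]

def init_three : List CFact :=
  [
    (0, 1, 0, 1), (1, 1, 0, 2), (2, 3, 0, 3), (3, 2, 0, 4), (4, 3, 0, 5), (5, 2, 0, 6),
    (6, 3, 0, 7), (7, 1, 0, 8), (8, 3, 0, 9), (9, 1, 0, 10), (10, 3, 0, 11), (11, 1, 0, 12),
    (12, 3, 0, 13), (13, 2, 0, 14), (14, 3, 0, 15), (3, 1, 0, 16), (16, 3, 0, 17),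
    (17, 1, 0, 18), (18, 3, 0, 19), (19, 2, 0, 20), (20, 3, 0, 21), (19, 1, 0, 22),
    (22, 3, 0, 23), (15, 1, 0, 24), (24, 3, 0, 25)]

def steps_three : List CStep :=
  [
    (2, 0, 1, 0, [48, 46]),
    (6, 6, 2, 5, [43, 45, 47, 0, 53, 48, 46, 44, 42, 40, 38, 36, 34, 32, 30, 28, 26, 24, 22]),
    (3, 1, 1, 7, [41, 43, 45, 47, 49, 2, 55, 50, 48, 22, 20, 18, 16, 10, 8]),
    (6, 2, 1, 17, [23, 25, 51, 53, 56, 54, 56, 54, 56, 54, 56, 5, 50, 48, 46, 3, 27, 29, 31]),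
    (6, 0, 1, 21, [17, 19, 21, 23, 25, 27, 53, 6, 59, 54, 52, 26, 24, 1, 32, 30, 28, 10, 8]),
    (6, 7, 0, 6, [49, 51, 53, 55, 8, 61, 59, 61, 59, 61, 56, 54, 28, 26, 24, 22, 20, 18, 1, 11]),
    (0, 0, 2, 15, [14, 0]), (0, 0, 0, 25, [15, 2, 50]), (0, 0, 0, 21, [7, 1, 50]),
    (0, 0, 0, 20, [26, 1, 50]), (0, 0, 0, 19, [30, 1, 50]), (0, 0, 1, 22, [29, 1]),
    (5, 0, 0, 3, [66, 64, 21, 45, 47, 49, 51, 53, 0, 28, 18, 61, 10, 45, 47, 49, 16, 41, 43, 69, 22, 75, 70, 68, 66, 64, 21, 45, 47, 49, 51, 53, 0, 28, 18, 61, 10, 45, 47, 49, 16, 41, 43, 69, 22, 75, 70, 68, 66, 64, 21, 45, 47, 49]),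
    (0, 0, 0, 11, [52, 0, 68]), (0, 0, 0, 13, [53, 2, 73]), (0, 0, 0, 10, [58, 3, 70]),
    (0, 0, 0, 14, [55, 3, 79]), (0, 0, 0, 22, [11, 3, 31]), (0, 0, 0, 9, [66, 5, 74]),
    (0, 0, 0, 15, [59, 5, 88]), (0, 0, 0, 23, [45, 5, 1, 91]), (0, 0, 0, 8, [74, 5, 78]),
    (0, 0, 0, 6, [30, 5, 92]), (0, 0, 0, 7, [41, 5, 92]), (0, 0, 0, 2, [0, 82, 5, 1, 95]),
    (0, 0, 0, 1, [0, 2, 87, 5, 100]), (0, 0, 0, 0, [51, 3, 1, 100, 1])]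

def extra_three : List ℕ := [3, 1, 3, 2, 3, 2, 3, 1, 3, 1]

theorem check_three :
    runCheck words_three init_three steps_three extra_three = true := by decide +kernel

def words_five : List (List ℕ) :=
  [
    [], [1], [1, 1], [1, 1, 3], [1, 1, 3, 1], [1, 1, 3, 1, 3], [1, 1, 3, 1, 3, 2],
    [1, 1, 3, 1, 3, 2, 3], [1, 1, 3, 1, 3, 2, 3, 1], [1, 1, 3, 1, 3, 2, 3, 1, 3],
    [1, 1, 3, 1, 3, 2, 3, 1, 3, 1], [1, 1, 3, 1, 3, 2, 3, 1, 3, 1, 3],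
    [1, 1, 3, 1, 3, 2, 3, 1, 3, 1, 3, 2], [1, 1, 3, 1, 3, 2, 3, 1, 3, 1, 3, 2, 3]]

def init_five : List CFact :=
  [
    (0, 1, 0, 1), (1, 1, 0, 2), (2, 3, 0, 3), (3, 1, 0, 4), (4, 3, 0, 5), (5, 2, 0, 6),
    (6, 3, 0, 7), (7, 1, 0, 8), (8, 3, 0, 9), (9, 1, 0, 10), (10, 3, 0, 11), (11, 2, 0, 12),
    (12, 3, 0, 13)]

def steps_five : List CStep :=
  [
    (2, 0, 1, 0, [24, 22]),
    (6, 5, 1, 3, [23, 25, 28, 26, 28, 26, 28, 1, 22, 20, 18, 16, 14, 12, 10, 8, 6, 4, 2]),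
    (5, 0, 0, 1, [29, 31, 26, 24, 22, 20, 18, 16, 14, 12, 10, 8, 6, 4, 0, 25, 2, 31, 29, 31, 26, 24, 22, 20, 18, 16, 14, 12, 10, 8, 6, 4, 0, 25, 2, 31, 29, 31, 26, 24, 22, 20, 18, 16, 14, 12, 10, 8, 6, 4, 0, 25, 2, 31])]

def extra_five : List ℕ := [1, 3, 2, 3, 1, 3, 2, 3, 1, 3]

theorem check_five :
    runCheck words_five init_five steps_five extra_five = true := by decide +kernel

def words_seven : List (List ℕ) :=
  [
    [], [1], [1, 1], [1, 1, 3], [1, 1, 3, 2], [1, 1, 3, 2, 3]]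

def init_seven : List CFact :=
  [
    (0, 1, 0, 1), (1, 1, 0, 2), (2, 3, 0, 3), (3, 2, 0, 4), (4, 3, 0, 5)]

def steps_seven : List CStep :=
  [
    (2, 0, 1, 0, [8, 6]), (6, 2, 2, 3, [7, 0, 13, 11, 13, 11, 13, 8, 6, 4, 2]),
    (5, 0, 0, 0, [3, 8, 1, 5, 7, 9, 11, 14, 12, 14, 12, 14, 3, 8, 1, 5, 7, 9, 11, 14, 12, 14, 12, 14, 3, 8, 1, 5, 7, 9, 11, 14, 12, 14, 12, 14, 3, 8, 1, 5, 7, 9, 11, 14, 12, 14, 12, 14, 3, 8, 1, 5, 7, 9]),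
    (0, 0, 0, 1, [15, 1, 4]), (0, 0, 0, 0, [3, 15, 1, 16, 1])]

def extra_seven : List ℕ := [3, 2, 3, 1, 3, 2]

theorem check_seven :
    runCheck words_seven init_seven steps_seven extra_seven = true := by decide +kernel

def words_four : List (List ℕ) :=
  [
    [], [1], [1, 1], [1, 1, 3], [1, 1, 3, 1], [1, 1, 3, 1, 3], [1, 1, 3, 1, 3, 2],
    [1, 1, 3, 1, 3, 2, 3], [1, 1, 3, 1, 3, 2, 3, 1], [1, 1, 3, 1, 3, 2, 3, 1, 3],
    [1, 1, 3, 1, 3, 2, 3, 1, 3, 2], [1, 1, 3, 1, 3, 2, 3, 1, 3, 2, 3],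
    [1, 1, 3, 1, 3, 2, 3, 1, 3, 2, 3, 1], [1, 1, 3, 1, 3, 2, 3, 1, 3, 2, 3, 1, 3],
    [1, 1, 3, 1, 3, 2, 3, 1, 3, 2, 3, 1, 3, 2], [1, 1, 3, 1, 3, 2, 3, 1, 3, 2, 3, 1, 3, 2, 3],
    [1, 1, 3, 1, 3, 2, 3, 1, 3, 2, 3, 1, 3, 2, 3, 1],
    [1, 1, 3, 1, 3, 2, 3, 1, 3, 2, 3, 1, 3, 2, 3, 1, 3],
    [1, 1, 3, 1, 3, 2, 3, 1, 3, 2, 3, 1, 3, 2, 3, 1, 3, 2],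
    [1, 1, 3, 1, 3, 2, 3, 1, 3, 2, 3, 1, 3, 2, 3, 1, 3, 2, 3],
    [1, 1, 3, 1, 3, 2, 3, 1, 3, 2, 3, 1, 3, 2, 3, 1, 3, 2, 3, 1],
    [1, 1, 3, 1, 3, 2, 3, 1, 3, 2, 3, 1, 3, 2, 3, 1, 3, 2, 3, 1, 3],
    [1, 1, 3, 1, 3, 2, 3, 1, 3, 2, 3, 1, 3, 2, 3, 1, 3, 2, 3, 1, 3, 2],
    [1, 1, 3, 1, 3, 2, 3, 1, 3, 2, 3, 1, 3, 2, 3, 1, 3, 2, 3, 1, 3, 2, 3],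
    [1, 1, 3, 1, 3, 2, 3, 1, 3, 2, 3, 1, 3, 2, 3, 1, 3, 2, 3, 1, 3, 2, 3, 1],
    [1, 1, 3, 1, 3, 2, 3, 1, 3, 2, 3, 1, 3, 2, 3, 1, 3, 2, 3, 1, 3, 2, 3, 1, 3],
    [1, 1, 3, 1, 3, 2, 3, 1, 3, 2, 3, 1, 3, 2, 3, 1, 3, 2, 3, 1, 3, 2, 3, 1, 3, 2],
    [1, 1, 3, 1, 3, 2, 3, 1, 3, 2, 3, 1, 3, 2, 3, 1, 3, 2, 3, 1, 3, 2, 3, 1, 3, 2, 3],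
    [1, 1, 3, 1, 3, 2, 3, 1, 3, 2, 3, 1, 3, 2, 3, 1, 3, 2, 3, 1, 3, 2, 3, 1, 3, 2, 3, 1],
    [1, 1, 3, 1, 3, 2, 3, 1, 3, 2, 3, 1, 3, 2, 3, 1, 3, 2, 3, 1, 3, 2, 3, 1, 3, 2, 3, 1, 3],
    [1, 1, 3, 1, 3, 2, 3, 1, 3, 2, 3, 1, 3, 2, 3, 1, 3, 2, 3, 1, 3, 2, 3, 1, 3, 2, 3, 1, 3, 2],
    [1, 1, 3, 1, 3, 2, 3, 1, 3, 2, 3, 1, 3, 2, 3, 1, 3, 2, 3, 1, 3, 2, 3, 1, 3, 2, 3, 1, 3, 2, 3]]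

def init_four : List CFact :=
  [
    (0, 1, 0, 1), (1, 1, 0, 2), (2, 3, 0, 3), (3, 1, 0, 4), (4, 3, 0, 5), (5, 2, 0, 6),
    (6, 3, 0, 7), (7, 1, 0, 8), (8, 3, 0, 9), (9, 2, 0, 10), (10, 3, 0, 11), (11, 1, 0, 12),
    (12, 3, 0, 13), (13, 2, 0, 14), (14, 3, 0, 15), (15, 1, 0, 16), (16, 3, 0, 17),
    (17, 2, 0, 18), (18, 3, 0, 19), (19, 1, 0, 20), (20, 3, 0, 21), (21, 2, 0, 22),
    (22, 3, 0, 23), (23, 1, 0, 24), (24, 3, 0, 25), (25, 2, 0, 26), (26, 3, 0, 27),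
    (27, 1, 0, 28), (28, 3, 0, 29), (29, 2, 0, 30), (30, 3, 0, 31)]

def steps_four : List CStep :=
  [
    (2, 0, 1, 0, [60, 58]),
    (4, 1, 1, 3, [59, 61, 64, 62, 64, 1, 58, 56, 54, 52, 50, 48, 46, 44, 42, 40, 38, 36, 34, 32, 30, 28, 26, 24, 22, 20, 18, 16, 14, 12, 10, 8, 6, 4, 2]),
    (6, 6, 1, 26, [12, 10, 8, 6, 4, 0, 61, 63, 66, 64, 66, 64, 66, 64, 66, 3, 60, 58, 56, 54, 52, 50, 48]),
    (6, 6, 1, 11, [47, 49, 51, 53, 55, 57, 59, 61, 63, 4, 69, 64, 62, 60, 58, 56, 54, 52, 50, 48, 46, 44, 42]),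
    (2, 0, 0, 10, [51, 2, 19]), (0, 0, 2, 26, [21, 0]), (0, 0, 0, 24, [24, 2, 52]),
    (0, 0, 0, 23, [28, 1, 7]), (0, 0, 0, 22, [32, 1, 53]), (0, 0, 1, 21, [36, 1]),
    (2, 0, 0, 13, [12, 58, 0]), (0, 0, 0, 14, [57, 1, 3]), (0, 0, 0, 20, [44, 2, 61]),
    (0, 0, 0, 15, [59, 3, 62]), (0, 0, 0, 19, [50, 3, 67]), (0, 0, 0, 16, [61, 3, 22]),
    (0, 0, 0, 18, [56, 3, 73]), (0, 0, 0, 17, [63, 3, 75]), (0, 0, 0, 10, [0, 62, 3, 79]),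
    (0, 0, 0, 26, [33, 0, 81]), (0, 0, 0, 9, [2, 28, 1, 34, 1])]

def extra_four : List ℕ := [3, 2, 3, 1, 3, 1, 3, 1, 3, 2, 3, 1]

theorem check_four :
    runCheck words_four init_four steps_four extra_four = true := by decide +kernel


end Checker

section Theory

variable {G : Type*} [Group G]

theorem cyc_pow {K : Type*} [Group K] (hK : IsLocallyCyclic2Group K) (x y : K)
    (h : orderOf x = orderOf y) : ∃ n : ℤ, y = x ^ n := by
  have hfin : ∀ k : K, IsOfFinOrder k := by
    intro k
    obtain ⟨n, hn⟩ := hK.1 k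
    rw [← orderOf_pos_iff, hn]; positivity
  have hcyc := hK.2 (Subgroup.closure {x, y})
    ((Subgroup.fg_iff _).2 ⟨{x, y}, rfl, by simp⟩)
  obtain ⟨g, hg⟩ := hcyc.exists_generator
  obtain ⟨p, hp⟩ := Subgroup.mem_zpowers_iff.1 (hg ⟨x, Subgroup.subset_closure (by simp)⟩)
  obtain ⟨q, hq⟩ := Subgroup.mem_zpowers_iff.1 (hg ⟨y, Subgroup.subset_closure (by simp)⟩)
  have hp' : (g : K) ^ p = x := by
    have := congrArg Subtype.val hp
    simpa using this
  have hq' : (g : K) ^ q = y := by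
    have := congrArg Subtype.val hq
    simpa using this
  generalize (g : K) = k at hp' hq'
  have hk := hfin k
  have hN : 0 < orderOf k := hk.orderOf_pos
  have red : ∀ m : ℤ, ∃ r : ℕ, k ^ m = k ^ r := by
    intro m
    refine ⟨(m % (orderOf k : ℤ)).toNat, ?_⟩
    rw [← zpow_natCast, Int.toNat_of_nonneg (Int.emod_nonneg _ (by omega)), zpow_mod_orderOf]
  obtain ⟨p', hpp⟩ := red p
  obtain ⟨q', hqq⟩ := red q
  rw [hpp] at hp'
  rw [hqq] at hq'
  have h1 : orderOf x = orderOf k / Nat.gcd (orderOf k) p' := by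
    rw [← hp', IsOfFinOrder.orderOf_pow _ _ hk]
  have h2 : orderOf y = orderOf k / Nat.gcd (orderOf k) q' := by
    rw [← hq', IsOfFinOrder.orderOf_pow _ _ hk]
  have h3 : Nat.gcd (orderOf k) p' = Nat.gcd (orderOf k) q' := by
    rw [h1, h2] at h
    have d1 := Nat.gcd_dvd_left (orderOf k) p'
    have d2 := Nat.gcd_dvd_left (orderOf k) q'
    rw [← Nat.div_div_self d1 hN.ne', h, Nat.div_div_self d2 hN.ne']
  obtain ⟨t, ht⟩ := Nat.gcd_dvd_right (orderOf k) q'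
  have h4 : k ^ (Nat.gcd (orderOf k) p') = x ^ (Nat.gcdB (orderOf k) p') := by
    rw [← zpow_natCast, Nat.gcd_eq_gcd_ab, zpow_add, zpow_mul, zpow_mul, zpow_natCast,
      zpow_natCast, pow_orderOf_eq_one, one_zpow, one_mul, hp']
  refine ⟨Nat.gcdB (orderOf k) p' * t, ?_⟩
  rw [zpow_mul, ← h4, h3, zpow_natCast, ← pow_mul, ← ht, hq']

def IsInv (x : G) : Prop := x ≠ 1 ∧ x ^ 2 = 1

theorem IsInv.mul_self {x : G} (h : IsInv x) : x * x = 1 := by rw [← pow_two]; exact h.2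

theorem IsInv.inv {x : G} (h : IsInv x) : x⁻¹ = x := inv_eq_of_mul_eq_one_right h.mul_self

theorem IsInv.order {x : G} (h : IsInv x) : orderOf x = 2 := orderOf_eq_prime h.2 h.1

theorem IsInv.conj {x : G} (h : IsInv x) (g : G) : IsInv (g * x * g⁻¹) := by
  refine ⟨?_, ?_⟩
  · intro h'
    rw [conj_eq_one_iff] at h'
    exact h.1 h'
  · rw [conj_pow, h.2]; simp

theorem cent_pow (hG : HypHStar G) {a x y : G} (ha : IsInv a) (hx : x * a = a * x)
    (hy : y * a = a * y) (h : orderOf x = orderOf y) : ∃ n : ℤ, y = x ^ n := by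
  have hK := hG.2 a ha.1 ha.2
  obtain ⟨n, hn⟩ := cyc_pow hK ⟨x, Subgroup.mem_centralizer_singleton_iff.2 hx⟩
    ⟨y, Subgroup.mem_centralizer_singleton_iff.2 hy⟩ (by
      rw [← Subgroup.orderOf_coe, ← Subgroup.orderOf_coe]; exact h)
  refine ⟨n, ?_⟩
  have := congrArg Subtype.val hn
  simpa using this

theorem cent_two (hG : HypHStar G) {a x : G} (ha : IsInv a) (hx : x * a = a * x) :
    ∃ n : ℕ, orderOf x = 2 ^ n := by
  obtain ⟨n, hn⟩ := (hG.2 a ha.1 ha.2).1 ⟨x, Subgroup.mem_centralizer_singleton_iff.2 hx⟩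
  exact ⟨n, by rw [← hn, ← Subgroup.orderOf_coe]⟩

theorem comm_inv (hG : HypHStar G) {a d : G} (ha : IsInv a) (hd : IsInv d)
    (h : d * a = a * d) : d = a := by
  obtain ⟨n, hn⟩ := cent_pow hG ha rfl h (by rw [ha.order, hd.order])
  rcases Int.even_or_odd n with ⟨m, hm⟩ | ⟨m, hm⟩
  · exfalso
    apply hd.1
    rw [hn, hm, ← two_mul, zpow_mul, zpow_ofNat, ha.2, one_zpow]
  · rw [hn, hm, zpow_add, zpow_mul, zpow_ofNat, ha.2, one_zpow, one_mul, zpow_one]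

theorem prod9 (hG : HypHStar G) {d e : G} (hd : IsInv d) (he : IsInv e) :
    (d * e) ^ 9 = 1 := by
  have hle : orderOf (d * e) ≤ 9 :=
    hG.1.2.2 d e (by rw [hd.order]; norm_num) (by rw [he.order]; norm_num)
  have hpos : 0 < orderOf (d * e) := (hG.1.1 _).orderOf_pos
  have hpr := fun p hp => (hG.1.2.1 p hp).1
  by_cases hev : 2 ∣ orderOf (d * e)
  · exfalso
    obtain ⟨m, hm⟩ := hev
    have hk : IsInv ((d * e) ^ m) := by
      refine ⟨?_, ?_⟩
      · intro h
        have := Nat.le_of_dvd (by omega) (orderOf_dvd_of_pow_eq_one h)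
        omega
      · rw [← pow_mul, mul_comm m 2, ← hm, pow_orderOf_eq_one]
    have hinv : (d * e)⁻¹ = e * d := by rw [mul_inv_rev, hd.inv, he.inv]
    have h1 : d * (d * e) ^ m * d⁻¹ = (d * e) ^ m := by
      rw [← conj_pow, show d * (d * e) * d⁻¹ = (d * e)⁻¹ by
        rw [hinv, hd.inv, ← mul_assoc, hd.mul_self, one_mul], inv_pow, hk.inv]
    have h2 : e * (d * e) ^ m * e⁻¹ = (d * e) ^ m := by
      rw [← conj_pow, show e * (d * e) * e⁻¹ = (d * e)⁻¹ by
        rw [hinv]; group, inv_pow, hk.inv]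
    have e1 := comm_inv hG hd hk (mul_inv_eq_iff_eq_mul.1 h1).symm
    have e2 := comm_inv hG he hk (mul_inv_eq_iff_eq_mul.1 h2).symm
    have : d = e := e1.symm.trans e2
    subst this
    rw [hd.mul_self, orderOf_one] at hm
    omega
  · have h5 : ¬ 5 ∣ orderOf (d * e) := fun h => by
      have := hpr 5 (by norm_num) ⟨_, h⟩
      omega
    have h7 : ¬ 7 ∣ orderOf (d * e) := fun h => by
      have := hpr 7 (by norm_num) ⟨_, h⟩
      omega
    apply orderOf_dvd_iff_pow_eq_one.1
    generalize orderOf (d * e) = n at *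
    interval_cases n <;> revert hev h5 h7 <;> decide

theorem factor (hG : HypHStar G) {a : G} (ha : IsInv a) (g : G) :
    ∃ s x : G, s * a = a * s ∧ a * x * a = x⁻¹ ∧ x ^ 9 = 1 ∧ g = s * x ∧
      x = ((g⁻¹ * a * g * a) ^ 5)⁻¹ := by
  set h := g⁻¹ * a * g * a with hh
  have h9 : h ^ 9 = 1 := by
    have := prod9 hG (ha.conj g⁻¹) ha
    simpa [hh] using this
  have ainv := ha.inv
  have aa := ha.mul_self
  have aa' : ∀ y, a * (a * y) = y := fun y => by rw [← mul_assoc, aa, one_mul]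
  have hah : a * h * a⁻¹ = h⁻¹ := by
    simp only [hh, mul_inv_rev, ainv, inv_inv, mul_assoc, aa, aa', mul_one]
  have hah5 : a * h ^ 5 * a⁻¹ = (h ^ 5)⁻¹ := by rw [← conj_pow, hah, inv_pow]
  refine ⟨g * h ^ 5, (h ^ 5)⁻¹, ?_, ?_, ?_, by group, rfl⟩
  · have e1 : a * g = g * h * a := by
      simp only [hh, mul_assoc, aa, mul_one, mul_inv_cancel_left]
    have e2 : a * h ^ 5 = (h ^ 5)⁻¹ * a := mul_inv_eq_iff_eq_mul.1 hah5
    have e3 : h * (h ^ 5)⁻¹ = h ^ 5 := by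
      rw [mul_inv_eq_iff_eq_mul, ← pow_add, show 5 + 5 = 9 + 1 from rfl, pow_add, h9]; simp
    calc g * h ^ 5 * a = g * (h * (h ^ 5)⁻¹) * a := by rw [e3]
      _ = g * h * ((h ^ 5)⁻¹ * a) := by simp only [mul_assoc]
      _ = g * h * a * h ^ 5 := by rw [← e2]; simp only [mul_assoc]
      _ = a * (g * h ^ 5) := by rw [← e1, mul_assoc]
  · have h6 := congrArg (fun z => z⁻¹) hah5
    simp only [mul_inv_rev, inv_inv, ainv] at h6
    rw [inv_inv, mul_assoc]
    exact h6
  · rw [inv_pow, ← pow_mul, mul_comm, pow_mul, h9]; simp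

theorem dichotomy (hG : HypHStar G) {a θ : G} (ha : IsInv a) (h3 : θ ^ 3 = 1) (h1 : θ ≠ 1) :
    a * θ * a = θ⁻¹ ∨ ∃ s d : G, s * a = a * s ∧ s ^ 4 = a ∧ orderOf s = 8 ∧ IsInv d ∧
      θ = s * d := by
  obtain ⟨s0, x, hs0, hx, hx9, hg, -⟩ := factor hG ha θ
  have aa := ha.mul_self
  have aa' : ∀ y, a * (a * y) = y := fun y => by rw [← mul_assoc, aa, one_mul]
  have hd : IsInv (a * x) := by
    refine ⟨?_, ?_⟩
    · intro h
      have : x = a := by rw [← ha.inv]; exact (inv_eq_of_mul_eq_one_right h).symm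
      rw [this] at hx9
      apply ha.1
      rw [show a ^ 9 = (a ^ 2) ^ 4 * a by group, ha.2] at hx9
      simpa using hx9
    · rw [pow_two, ← mul_assoc, hx, inv_mul_cancel]
  have hθ3 : orderOf θ = 3 := orderOf_eq_prime h3 h1
  obtain ⟨s, hs⟩ : ∃ s, s = s0 * a := ⟨_, rfl⟩
  obtain ⟨d, hdd⟩ : ∃ d, d = a * x := ⟨_, rfl⟩
  rw [← hdd] at hd
  have hsa : s * a = a * s := by rw [hs, ← mul_assoc, ← hs0]
  have hsd : θ = s * d := by rw [hs, hdd, mul_assoc, aa', hg]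
  have hs' : θ * d = s := by rw [hsd, mul_assoc, hd.mul_self, mul_one]
  have hle : orderOf s ≤ 9 := by
    rw [← hs']
    exact hG.1.2.2 θ d (by rw [hθ3]; norm_num) (by rw [hd.order]; norm_num)
  obtain ⟨n, hn⟩ := cent_two hG ha hsa
  have hn4 : n < 4 := by
    by_contra hcon
    have := Nat.pow_le_pow_right (n := 2) (by norm_num) (not_lt.1 hcon)
    omega
  have hord : ∀ m, orderOf s = m → s ^ m = 1 := fun m hm => by
    rw [← hm, pow_orderOf_eq_one]
  interval_cases n
  · exfalso
    rw [pow_zero, orderOf_eq_one_iff] at hn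
    rw [hn, one_mul] at hsd
    rw [hsd, hd.order] at hθ3
    omega
  · left
    have hsi : IsInv s := ⟨fun h => by rw [h, orderOf_one] at hn; omega, hord _ hn⟩
    have : s = a := comm_inv hG ha hsi hsa
    rw [hsd, this, hdd, aa', aa']
    exact hx
  · exfalso
    have hs4 : s ^ 4 = 1 := hord _ hn
    have hsi : IsInv (s ^ 2) := by
      refine ⟨fun h => ?_, by rw [← pow_mul, hs4]⟩
      have := orderOf_dvd_of_pow_eq_one h
      rw [hn] at this
      revert this; decide
    have hsa2 : s ^ 2 = a := comm_inv hG ha hsi (by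
      rw [pow_two, mul_assoc, hsa, ← mul_assoc, hsa, mul_assoc])
    have e1 : d * s * d = s⁻¹ * d * s⁻¹ := by
      rw [hsd, pow_succ, pow_two] at h3
      have : d * s * d = s⁻¹ * ((s * d) * (s * d) * (s * d)) * d⁻¹ * s⁻¹ := by group
      rw [this, h3, hd.inv, mul_one]
    have e2 : d * a * d = s⁻¹ * (d * a * d) * s⁻¹ := by
      have : d * a * d = (d * s * d) * (d * s * d) := by
        rw [← hsa2, pow_two]
        have : d * s * d * (d * s * d) = d * s * (d * d) * s * d := by group
        rw [this, hd.mul_self]; group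
      have h7 : s⁻¹ * d * s⁻¹ * (s⁻¹ * d * s⁻¹) = s⁻¹ * (d * (s ^ 2)⁻¹ * d) * s⁻¹ := by group
      calc d * a * d = (d * s * d) * (d * s * d) := this
        _ = s⁻¹ * (d * (s ^ 2)⁻¹ * d) * s⁻¹ := by rw [e1, h7]
        _ = s⁻¹ * (d * a * d) * s⁻¹ := by rw [hsa2, ha.inv]
    have hb : IsInv (d * a * d) := by
      have := ha.conj d
      rwa [hd.inv] at this
    generalize hbdef : d * a * d = b at e2 hb
    have e3 : s * b = b * s⁻¹ := by
      calc s * b = s * (s⁻¹ * b * s⁻¹) := by rw [← e2]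
        _ = b * s⁻¹ := by group
    have e4 : a * b = b * a := by
      calc a * b = s * (s * b) := by rw [← hsa2, pow_two, mul_assoc]
        _ = b * (s ^ 2)⁻¹ := by rw [e3, ← mul_assoc, e3]; group
        _ = b * a := by rw [hsa2, ha.inv]
    have e5 : b = a := comm_inv hG ha hb e4.symm
    have e6 : d * a = a * d := by
      calc d * a = d * a * (d * d) := by rw [hd.mul_self, mul_one]
        _ = d * a * d * d := by simp only [mul_assoc]
        _ = a * d := by rw [hbdef, e5]
    have e7 : d = a := comm_inv hG ha hd e6
    have e8 : θ = s ^ 3 := by rw [hsd, e7, ← hsa2, pow_succ' s 2]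
    rw [e8, ← pow_mul, show 3 * 3 = 4 + 4 + 1 from rfl, pow_succ, pow_add, hs4] at h3
    have e9 : s = 1 := by simpa using h3
    rw [e9, orderOf_one] at hn
    omega
  · right
    have h8 : s ^ 8 = 1 := hord _ hn
    have hsi : IsInv (s ^ 4) := by
      refine ⟨fun h => ?_, by rw [← pow_mul, h8]⟩
      have := orderOf_dvd_of_pow_eq_one h
      rw [hn] at this
      revert this; decide
    have hc : Commute s a := hsa
    exact ⟨s, d, hsa, comm_inv hG ha hsi (hc.pow_left 4), hn, hd, hsd⟩

theorem conj_sq {d : G} (hd : IsInv d) (g : G) : (g * d * g⁻¹) ^ 2 = 1 := (hd.conj g).2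

theorem all3 (hG : HypHStar G) {a u : G} (ha : IsInv a) (hu : u ^ 3 = 1) (hu1 : u ≠ 1) :
    a * u * a = u⁻¹ := by
  rcases dichotomy hG ha hu hu1 with h | ⟨s, c, hsa, hs4, hs8, hc, husc⟩
  · exact h
  exfalso
  have cc := hc.mul_self
  have ci := hc.inv
  have hv : u * c = s := by rw [husc, mul_assoc, cc, mul_one]
  have c' : ∀ x, c * (c * x) = x := fun x => by rw [← mul_assoc, cc, one_mul]
  have uuu : u * (u * u) = 1 := by rw [← hu, pow_succ', pow_two]
  have uu : u * u = u⁻¹ := (inv_eq_of_mul_eq_one_right uuu).symm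
  have uu' : ∀ x, u * (u * x) = u⁻¹ * x := fun x => by rw [← mul_assoc, uu]
  have ii : u⁻¹ * u⁻¹ = u := by rw [← mul_inv_rev, uu, inv_inv]
  have ii' : ∀ x, u⁻¹ * (u⁻¹ * x) = u * x := fun x => by rw [← mul_assoc, ii]
  have hs : s ^ 8 = 1 := by rw [← hs8, pow_orderOf_eq_one]
  have hv8 : (u * c) ^ 8 = 1 := by rw [hv, hs]
  have hne : (u * c) ^ 4 ≠ 1 := by rw [hv, hs4]; exact ha.1
  have haw : a = u * c * (u * c) * (u * c) * (u * c) := by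
    rw [← hs4, ← hv]; simp only [pow_succ, pow_zero, one_mul]
  have ht : (u * c * u⁻¹ * c) ^ 9 = 1 := prod9 hG (hc.conj u) hc
  have hz : (u⁻¹ * c * u * c * u * c) ^ 9 = 1 := by
    have := prod9 hG (ha.conj u) (hc.conj u)
    rw [← this]
    congr 1
    rw [haw]
    simp only [mul_assoc, inv_mul_cancel_left, mul_inv_cancel_left, c', cc, uu', ii', uu, ii,
      mul_one, inv_mul_cancel, mul_inv_cancel]
  have hθ3 : (u⁻¹ * c * u * c * u) ^ 3 = 1 := by
    have : u⁻¹ * c * u * c * u = (u⁻¹ * c) * u * (u⁻¹ * c)⁻¹ := by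
      rw [mul_inv_rev, ci, inv_inv]; simp only [mul_assoc]
    rw [this, conj_pow, hu]; group
  have hθ1 : u⁻¹ * c * u * c * u ≠ 1 := by
    have : u⁻¹ * c * u * c * u = (u⁻¹ * c) * u * (u⁻¹ * c)⁻¹ := by
      rw [mul_inv_rev, ci, inv_inv]; simp only [mul_assoc]
    rw [this, Ne, conj_eq_one_iff]
    exact hu1
  rcases dichotomy hG ha hθ3 hθ1 with h | ⟨s', d, hsa', hs4', hs8', hd, hθ⟩
  · apply hne
    refine cert_sound u c cc hu hv8 ht hz _ _ _ _ ?_ check_four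
    have hd2 : (a * (u⁻¹ * c * u * c * u)) ^ 2 = 1 := by
      rw [pow_two, ← mul_assoc, h, inv_mul_cancel]
    have key : wev u c extra_four =
        (c * u) * (a * (u⁻¹ * c * u * c * u)) * (c * u)⁻¹ := by
      rw [haw]
      simp [wev, lev, extra_four, mul_assoc, c', cc, uu', ii', uu, ii, ci]
    rw [key, conj_pow, hd2]; group
  · obtain ⟨n, hn⟩ := cent_pow hG ha hsa hsa' (by rw [hs8, hs8'])
    obtain ⟨i, hi, hn'⟩ : ∃ i : ℕ, i < 8 ∧ s' = s ^ i := by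
      refine ⟨(n % 8).toNat, by omega, ?_⟩
      rw [← zpow_natCast, Int.toNat_of_nonneg (Int.emod_nonneg _ (by norm_num)), hn]
      have := zpow_mod_orderOf s n
      rw [hs8] at this
      exact this.symm
    have heven : ∀ k, i = 2 * k → False := by
      intro k hk
      apply ha.1
      rw [← hs4', hn', hk, ← pow_mul, show 2 * k * 4 = 8 * k by ring, pow_mul, hs, one_pow]
    have hdd : d = s ^ (8 - i) * (u⁻¹ * c * u * c * u) := by
      rw [hθ, hn', ← mul_assoc, ← pow_add, show 8 - i + i = 8 by omega, hs, one_mul]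
    have hdi : d = (s ^ i)⁻¹ * (u⁻¹ * c * u * c * u) := by
      rw [hθ, hn', inv_mul_cancel_left]
    rw [← hv] at hdd hdi
    interval_cases i
    · exact heven 0 rfl
    · have key : d = (c * u) ^ 3 := by
        rw [hdi]
        simp only [pow_succ, pow_zero, one_mul, mul_inv_rev, mul_assoc, c', cc, uu', ii', uu, ii,
          ci]
      have h6 : (c * u) ^ 6 = 1 := by
        rw [show 6 = 3 * 2 from rfl, pow_mul, ← key, hd.2]
      have h6' : (u * c) ^ 6 = 1 := by
        have : u * c = u * (c * u) * u⁻¹ := by group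
        rw [this, conj_pow, h6]; group
      rw [hv] at h6'
      have := orderOf_dvd_of_pow_eq_one h6'
      rw [hs8] at this
      revert this; decide
    · exact heven 1 rfl
    · apply hne
      refine cert_sound u c cc hu hv8 ht hz _ _ _ _ ?_ check_three
      have key : wev u c extra_three = (c * u) * d * (c * u)⁻¹ := by
        rw [hdi]
        simp [wev, lev, extra_three, pow_succ, mul_assoc, c', cc, uu', ii', uu, ii, ci]
      rw [key]
      exact conj_sq hd _
    · exact heven 2 rfl
    · apply hne
      refine cert_sound u c cc hu hv8 ht hz _ _ _ _ ?_ check_five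
      have key : wev u c extra_five =
          ((u⁻¹ * c * u * c)⁻¹ * u) * d * ((u⁻¹ * c * u * c)⁻¹ * u)⁻¹ := by
        rw [hdd]
        simp [wev, lev, extra_five, pow_succ, mul_assoc, c', cc, uu', ii', uu, ii, ci]
      rw [key]
      exact conj_sq hd _
    · exact heven 3 rfl
    · apply hne
      refine cert_sound u c cc hu hv8 ht hz _ _ _ _ ?_ check_seven
      have key : wev u c extra_seven = u⁻¹ * d * u⁻¹⁻¹ := by
        rw [hdd]
        simp [wev, lev, extra_seven, pow_succ, mul_assoc, c', cc, uu', ii', uu, ii, ci]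
      rw [key]
      exact conj_sq hd _

/-- An involution inverts every element of order dividing `9`. -/
theorem inverts (hG : HypHStar G) {c w : G} (hc : IsInv c) (hw : w ^ 9 = 1) :
    c * w * c = w⁻¹ := by
  by_cases hw1 : w = 1
  · rw [hw1, mul_one, hc.mul_self, inv_one]
  by_cases hw3 : w ^ 3 = 1
  · exact all3 hG hc hw3 hw1
  have hu3 : (w ^ 3) ^ 3 = 1 := by rw [← pow_mul, hw]
  have hcu := all3 hG hc hu3 hw3
  obtain ⟨u, hu⟩ : ∃ u, u = w ^ 3 := ⟨_, rfl⟩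
  rw [← hu] at hcu hu3 hw3
  have hcu' : c * u = u⁻¹ * c := by
    rw [← hcu, mul_assoc, hc.mul_self, mul_one]
  have hci' : c * u⁻¹ = u * c := by
    have h6 := congrArg (fun z => z⁻¹) hcu
    simp only [mul_inv_rev, inv_inv, hc.inv] at h6
    calc c * u⁻¹ = c * u⁻¹ * (c * c) := by rw [hc.mul_self, mul_one]
      _ = c * (u⁻¹ * c) * c := by simp only [mul_assoc]
      _ = u * c := by rw [h6]
  have hwu : Commute w u := by rw [hu]; exact (Commute.refl w).pow_right 3
  obtain ⟨s, x, hs, hx, hx9, hwsx, hxdef⟩ := factor hG hc w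
  have hh : Commute (w⁻¹ * c * w * c) u := by
    have hwui : Commute w u⁻¹ := hwu.inv_right
    change w⁻¹ * c * w * c * u = u * (w⁻¹ * c * w * c)
    calc w⁻¹ * c * w * c * u = w⁻¹ * c * w * (c * u) := by simp only [mul_assoc]
      _ = w⁻¹ * c * (w * u⁻¹) * c := by rw [hcu']; simp only [mul_assoc]
      _ = w⁻¹ * (c * u⁻¹) * w * c := by rw [hwui.eq]; simp only [mul_assoc]
      _ = (w⁻¹ * u) * c * w * c := by rw [hci']; simp only [mul_assoc]
      _ = u * (w⁻¹ * c * w * c) := by rw [hwu.inv_left.eq]; simp only [mul_assoc]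
  have hxu : Commute x u := by rw [hxdef]; exact (hh.pow_left 5).inv_left
  have hsu : Commute s u := by
    have : s = w * x⁻¹ := by rw [hwsx]; group
    rw [this]; exact hwu.mul_left hxu.inv_left
  obtain ⟨n, hn⟩ := cent_two hG hc hs
  cases n with
  | zero =>
    rw [pow_zero, orderOf_eq_one_iff] at hn
    rw [hn, one_mul] at hwsx
    rw [hwsx, hx]
  | succ n =>
    exfalso
    have hj : IsInv (s ^ (2 ^ n)) := by
      refine ⟨fun h => ?_, ?_⟩
      · have h5 := Nat.le_of_dvd (by positivity) (orderOf_dvd_of_pow_eq_one h)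
        rw [hn, pow_succ] at h5
        have : 0 < 2 ^ n := by positivity
        omega
      · rw [← pow_mul, ← pow_succ, ← hn, pow_orderOf_eq_one]
    obtain ⟨m, hm⟩ := cent_two hG hj (hsu.pow_left (2 ^ n)).symm.eq
    rw [orderOf_eq_prime hu3 hw3] at hm
    cases m with
    | zero => omega
    | succ m => rw [pow_succ] at hm; omega

end Theory

end ThreeInv

/-- Lemma 7: in a group satisfying (H*), the product of three involutions is an involution. -/
theorem statement_11 (G : Type*) [Group G] (hG : HypHStar G)
    (a b c : G) (ha1 : a ≠ 1) (ha2 : a ^ 2 = 1) (hb1 : b ≠ 1) (hb2 : b ^ 2 = 1)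
    (hc1 : c ≠ 1) (hc2 : c ^ 2 = 1) :
    (a * b * c) ^ 2 = 1 ∧ a * b * c ≠ 1 := by
  have ha : ThreeInv.IsInv a := ⟨ha1, ha2⟩
  have hb : ThreeInv.IsInv b := ⟨hb1, hb2⟩
  have hc : ThreeInv.IsInv c := ⟨hc1, hc2⟩
  have hw := ThreeInv.prod9 hG ha hb
  have h := ThreeInv.inverts hG hc hw
  refine ⟨?_, fun h1 => hc1 ?_⟩
  · rw [pow_two, mul_assoc (a * b), ← mul_assoc c, h, mul_inv_cancel]
  · have h2 : c = (a * b)⁻¹ := (inv_eq_of_mul_eq_one_right h1).symm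
    have h9 : c ^ 9 = 1 := by rw [h2, inv_pow, hw, inv_one]
    rw [show 9 = 2 * 4 + 1 from rfl, pow_succ, pow_mul, hc2, one_pow, one_mul] at h9
    exact h9
end

section
/- Let G be a group satisfying hypothesis (H*). Then every product of an odd number of involutions of G is an involution (in particular its square is 1), and every product of an even number of involutions of G has 9-th power equal to 1. -/
namespace HStar

variable {G : Type*} [Group G]

/-- Being an involution. -/
def Inv (a : G) : Prop := a ≠ 1 ∧ a ^ 2 = 1

theorem Inv.mul_self {a : G} (h : Inv a) : a * a = 1 := by rw [← pow_two]; exact h.2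

theorem Inv.inv_eq {a : G} (h : Inv a) : a⁻¹ = a := inv_eq_of_mul_eq_one_left h.mul_self

theorem Inv.conj {a : G} (h : Inv a) (g : G) : Inv (g * a * g⁻¹) := by
  refine ⟨?_, ?_⟩
  · intro h1
    exact h.1 (conj_eq_one_iff.mp h1)
  · rw [conj_pow, h.2]; group

theorem common_root_aux {K : Type*} [Group K] (hK : IsLocallyCyclic2Group K) (u v : K) :
    ∃ (g : K) (k l : ℤ), g ^ k = u ∧ g ^ l = v := by
  have hS : IsCyclic (Subgroup.closure ({u, v} : Set K)) :=
    hK.2 _ ((Subgroup.fg_iff _).mpr ⟨{u, v}, rfl, Set.toFinite _⟩)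
  obtain ⟨g, hg⟩ := hS.exists_generator
  have hu : u ∈ Subgroup.closure ({u, v} : Set K) := Subgroup.subset_closure (by simp)
  have hv : v ∈ Subgroup.closure ({u, v} : Set K) := Subgroup.subset_closure (by simp)
  obtain ⟨k, hk⟩ := Subgroup.mem_zpowers_iff.mp (hg ⟨u, hu⟩)
  obtain ⟨l, hl⟩ := Subgroup.mem_zpowers_iff.mp (hg ⟨v, hv⟩)
  refine ⟨g.1, k, l, ?_, ?_⟩
  · rw [← Subgroup.coe_zpow, hk]
  · rw [← Subgroup.coe_zpow, hl]

/-- Two commuting elements `i`, `t` with `i` an involution are powers of one element. -/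
theorem common_root (hG : HypHStar G) {i t : G} (hi : Inv i)
    (hc : t * i = i * t) : ∃ (g : G) (k l : ℤ), g ^ k = i ∧ g ^ l = t := by
  have hiC : i ∈ Subgroup.centralizer {i} := Subgroup.mem_centralizer_singleton_iff.mpr rfl
  have htC : t ∈ Subgroup.centralizer {i} := Subgroup.mem_centralizer_singleton_iff.mpr hc
  obtain ⟨g, k, l, hk, hl⟩ := common_root_aux (hG.2 i hi.1 hi.2) ⟨i, hiC⟩ ⟨t, htC⟩
  refine ⟨g.1, k, l, ?_, ?_⟩
  · rw [← Subgroup.coe_zpow, hk]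
  · rw [← Subgroup.coe_zpow, hl]

/-- The centralizer of an involution has a unique involution. -/
theorem unique_inv (hG : HypHStar G) {i t : G} (hi : Inv i) (ht : Inv t)
    (hc : t * i = i * t) : t = i := by
  obtain ⟨g, k, l, hk, hl⟩ := common_root hG hi hc
  have hk2 : g ^ (2 * k) = 1 := by rw [mul_comm, zpow_mul, hk]; exact_mod_cast hi.2
  have hl2 : g ^ (2 * l) = 1 := by rw [mul_comm, zpow_mul, hl]; exact_mod_cast ht.2
  rw [← orderOf_dvd_iff_zpow_eq_one] at hk2 hl2
  have hk1 : ¬ (orderOf g : ℤ) ∣ k := by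
    rw [orderOf_dvd_iff_zpow_eq_one, hk]; exact hi.1
  have hl1 : ¬ (orderOf g : ℤ) ∣ l := by
    rw [orderOf_dvd_iff_zpow_eq_one, hl]; exact ht.1
  obtain ⟨u, hu⟩ := hk2
  obtain ⟨v, hv⟩ := hl2
  have hdiff : (orderOf g : ℤ) ∣ (l - k) := by
    rcases Int.even_or_odd u with ⟨u', hu'⟩ | ⟨u', hu'⟩
    · exact absurd ⟨u', by rw [hu'] at hu; linarith⟩ hk1
    rcases Int.even_or_odd v with ⟨v', hv'⟩ | ⟨v', hv'⟩
    · exact absurd ⟨v', by rw [hv'] at hv; linarith⟩ hl1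
    refine ⟨v' - u', ?_⟩
    rw [hu'] at hu
    rw [hv'] at hv
    linarith
  rw [orderOf_dvd_iff_zpow_eq_one, zpow_sub, hk, hl] at hdiff
  exact mul_inv_eq_one.mp hdiff

/-- Nontrivial elements of the centralizer of an involution. -/
theorem centralizer_pow (hG : HypHStar G) {i t : G} (hi : Inv i)
    (hc : t * i = i * t) (h1 : t ≠ 1) : ∃ n : ℕ, orderOf t = 2 ^ (n + 1) ∧ t ^ (2 ^ n) = i := by
  obtain ⟨h2, -⟩ := hG.2 i hi.1 hi.2
  obtain ⟨m, hm⟩ := h2 ⟨t, Subgroup.mem_centralizer_singleton_iff.mpr hc⟩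
  rw [Subgroup.orderOf_mk] at hm
  cases m with
  | zero => exact absurd (orderOf_eq_one_iff.mp (by simpa using hm)) h1
  | succ n =>
    refine ⟨n, hm, unique_inv hG hi ⟨?_, ?_⟩ ?_⟩
    · intro h
      have := orderOf_dvd_of_pow_eq_one h
      rw [hm] at this
      have := Nat.le_of_dvd (by positivity) this
      have := Nat.pow_lt_pow_right (a := 2) (by norm_num) (Nat.lt_succ_self n)
      omega
    · rw [← pow_mul, ← pow_succ, ← hm, pow_orderOf_eq_one]
    · exact (Commute.pow_left (show Commute t i from hc) _)

theorem mul_pow_nine (hG : HypHStar G) {a b : G} (ha : Inv a) (hb : Inv b) :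
    (a * b) ^ 9 = 1 := by
  have hpos := (hG.1.1 (a * b)).orderOf_pos
  have o2 : ∀ c : G, Inv c → orderOf c ≤ 4 := fun c hc =>
    (orderOf_le_of_pow_eq_one (by norm_num) hc.2).trans (by norm_num)
  have hle := hG.1.2.2 a b (o2 a ha) (o2 b hb)
  have h5 : ¬ 5 ∣ orderOf (a * b) := fun h => by
    have := (hG.1.2.1 5 (by norm_num)).mp ⟨_, h⟩
    omega
  have h7 : ¬ 7 ∣ orderOf (a * b) := fun h => by
    have := (hG.1.2.1 7 (by norm_num)).mp ⟨_, h⟩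
    omega
  have hodd : ¬ 2 ∣ orderOf (a * b) := by
    rintro ⟨k, hk⟩
    have hz : Inv ((a * b) ^ k) := by
      refine ⟨?_, ?_⟩
      · intro h
        have := Nat.le_of_dvd (by omega) (orderOf_dvd_of_pow_eq_one h)
        omega
      · rw [← pow_mul, mul_comm, ← hk, pow_orderOf_eq_one]
    have hza : a * (a * b) ^ k * a⁻¹ = (a * b) ^ k := by
      rw [← conj_pow]
      have : a * (a * b) * a⁻¹ = (a * b)⁻¹ := by
        rw [mul_inv_rev, hb.inv_eq, ha.inv_eq, ← mul_assoc, ha.mul_self, one_mul]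
      rw [this, inv_pow, hz.inv_eq]
    have hzb : b * (a * b) ^ k * b⁻¹ = (a * b) ^ k := by
      rw [← conj_pow]
      have : b * (a * b) * b⁻¹ = (a * b)⁻¹ := by
        rw [mul_inv_rev, hb.inv_eq, ha.inv_eq, mul_assoc, mul_assoc, hb.mul_self, mul_one]
      rw [this, inv_pow, hz.inv_eq]
    have e1 := unique_inv hG ha hz (mul_inv_eq_iff_eq_mul.mp hza).symm
    have e2 := unique_inv hG hb hz (mul_inv_eq_iff_eq_mul.mp hzb).symm
    have : a = b := e1.symm.trans e2
    subst this
    rw [ha.mul_self, orderOf_one] at hk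
    omega
  apply orderOf_dvd_iff_pow_eq_one.mp
  generalize orderOf (a * b) = m at *
  interval_cases m <;> simp_all

/-- Every element is a product of an element of `C(i)` and an involution. -/
theorem decomp (hG : HypHStar G) {i : G} (hi : Inv i) (g : G) :
    ∃ s : G, Inv s ∧ (g * s) * i = i * (g * s) := by
  set j := g⁻¹ * i * g with hj
  have hjI : Inv j := by simpa using hi.conj g⁻¹
  set p := i * j with hp
  have hp9 : p ^ 9 = 1 := mul_pow_nine hG hi hjI
  have hip : i * p * i⁻¹ = p⁻¹ := by
    rw [hp, mul_inv_rev, hjI.inv_eq, hi.inv_eq, ← mul_assoc, hi.mul_self, one_mul]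
  have hipk : ∀ k : ℕ, i * p ^ k * i = (p ^ k)⁻¹ := by
    intro k
    rw [← inv_pow, ← hip, conj_pow, hi.inv_eq]
  have hs2 : (i * p ^ 5) * (i * p ^ 5) = 1 := by
    rw [← mul_assoc, hipk]; group
  have hsI : Inv (i * p ^ 5) := by
    refine ⟨?_, by rw [pow_two]; exact hs2⟩
    intro h
    have h5 : p ^ 5 = i := by
      have := eq_inv_of_mul_eq_one_right h
      rw [this, hi.inv_eq]
    apply hi.1
    have h45 : i ^ 9 = 1 := by rw [← h5, ← pow_mul, mul_comm, pow_mul, hp9, one_pow]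
    have h8 : i ^ 8 = 1 := by rw [show 8 = 2 * 4 by norm_num, pow_mul, hi.2, one_pow]
    rwa [pow_succ, h8, one_mul] at h45
  refine ⟨_, hsI, ?_⟩
  set s := i * p ^ 5 with hs
  have h1 : s * i = j * s := by
    have e1 : s * i = (p ^ 5)⁻¹ := by rw [hs, hipk]
    have e2 : j = i * p := by rw [hp, ← mul_assoc, hi.mul_self, one_mul]
    have e3 : j * s = (p ^ 1)⁻¹ * p ^ 5 := by rw [e2, hs, ← mul_assoc, ← hipk 1, pow_one]
    rw [e1, e3, inv_eq_iff_mul_eq_one]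
    calc p ^ 5 * ((p ^ 1)⁻¹ * p ^ 5) = p ^ 9 := by group
      _ = 1 := hp9
  rw [mul_assoc, h1, hj]
  group

theorem eq_one_of_coprime {t : G} {m n : ℕ} (h : Nat.Coprime m n) (hm : t ^ m = 1)
    (hn : t ^ n = 1) : t = 1 := by
  have := Nat.dvd_gcd (orderOf_dvd_of_pow_eq_one hm) (orderOf_dvd_of_pow_eq_one hn)
  rw [Nat.Coprime] at h
  rw [h, Nat.dvd_one] at this
  exact orderOf_eq_one_iff.mp this

/-- If `i` does not invert the element `x` of order 3 then `(i x⁻¹)^9 = 1` and there is an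
involution `s` with `x s` of order 8. -/
theorem bad_pair (hG : HypHStar G) {i x : G} (hi : Inv i) (hx1 : x ≠ 1) (hx : x ^ 3 = 1)
    (hbad : i * x * i ≠ x⁻¹) :
    (i * x⁻¹) ^ 9 = 1 ∧ ∃ s : G, Inv s ∧ (x * s) ^ 2 ≠ 1 ∧ (x * s) ^ 8 = 1 := by
  obtain ⟨s, hs, hc⟩ := decomp hG hi x
  have hxx : x * x = x⁻¹ := by
    apply eq_inv_of_mul_eq_one_left
    rw [← hx, pow_succ, pow_two]
  have hxi : x⁻¹ * x⁻¹ = x := by rw [← mul_inv_rev, hxx, inv_inv]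
  have ht1 : x * s ≠ 1 := by
    intro h
    have h2 : x = s := by rw [eq_inv_of_mul_eq_one_left h, hs.inv_eq]
    exact hx1 (eq_one_of_coprime (m := 2) (n := 3) (by norm_num) (by rw [h2]; exact hs.2) hx)
  obtain ⟨n, hn, hni⟩ := centralizer_pow hG hi hc ht1
  have hle : orderOf (x * s) ≤ 9 := hG.1.2.2 x s
    ((orderOf_le_of_pow_eq_one (by norm_num) hx).trans (by norm_num))
    ((orderOf_le_of_pow_eq_one (by norm_num) hs.2).trans (by norm_num))
  have hn3 : n < 3 := by
    by_contra h
    have : 2 ^ (3 + 1) ≤ 2 ^ (n + 1) := Nat.pow_le_pow_right (by norm_num) (by omega)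
    omega
  interval_cases n
  · exfalso
    apply hbad
    rw [pow_zero, pow_one] at hni
    have hxe : x = i * s := by rw [← hni, mul_assoc, hs.mul_self, mul_one]
    rw [hxe, mul_inv_rev, hs.inv_eq, hi.inv_eq, ← mul_assoc, hi.mul_self, one_mul]
  · exfalso
    have h9 := mul_pow_nine hG hi hs
    have e : i * s = x * (x * s)⁻¹ * x⁻¹ := by
      have e1 : i * s = x * s * x := by
        have : (x * s) ^ 2 * s = x * s * x * (s * s) := by rw [pow_two]; group
        rw [← hni, pow_one, this, hs.mul_self, mul_one]
      have e2 : x * (x * s)⁻¹ * x⁻¹ = x * s⁻¹ * (x⁻¹ * x⁻¹) := by group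
      rw [e1, e2, hxi, hs.inv_eq]
    rw [e, conj_pow, conj_eq_one_iff, inv_pow, inv_eq_one] at h9
    have h4 : (x * s) ^ 4 = 1 := by
      have := pow_orderOf_eq_one (x * s)
      rwa [hn] at this
    exact ht1 (eq_one_of_coprime (by norm_num) h9 h4)
  · have h8 : (x * s) ^ 8 = 1 := by
      have := pow_orderOf_eq_one (x * s)
      rwa [hn] at this
    refine ⟨?_, s, hs, ?_, h8⟩
    · have h9 := mul_pow_nine hG (hs.conj x⁻¹) hs
      have e : i * x⁻¹ =
          (x * s * x⁻¹) * (x⁻¹ * s * x⁻¹⁻¹ * s) * (x * s * x⁻¹)⁻¹ := by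
        have e1 : (x * s * x⁻¹) * (x⁻¹ * s * x⁻¹⁻¹ * s) * (x * s * x⁻¹)⁻¹ =
            x * s * (x⁻¹ * x⁻¹) * s * x * s * x * s⁻¹ * x⁻¹ := by group
        have e2 : i = (x * s) * (x * s) * (x * s) * (x * s) := by
          rw [← hni, show 2 ^ 2 = 3 + 1 by norm_num, pow_succ, pow_succ, pow_two]
        rw [e1, hxi, hs.inv_eq, e2]; group
      rw [e, conj_pow, h9]; group
    · intro h
      have := orderOf_le_of_pow_eq_one (by norm_num) h
      omega

/-- Every involution inverts every element of order 3. -/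
theorem inverts (hG : HypHStar G) {i x : G} (hi : Inv i) (hx : x ^ 3 = 1) :
    i * x * i = x⁻¹ := by
  by_cases hx1 : x = 1
  · rw [hx1, mul_one, hi.mul_self, inv_one]
  by_contra hbad
  obtain ⟨-, s, hs, h2, h8⟩ := bad_pair hG hi hx1 hx hbad
  have hb : s * x * s ≠ x⁻¹ := by
    intro h
    apply h2
    have : (x * s) ^ 2 = x * (s * x * s) := by rw [pow_two]; group
    rw [this, h, mul_inv_cancel]
  obtain ⟨h9, -⟩ := bad_pair hG hs hx1 hx hb
  have e : s * x⁻¹ = (x * s)⁻¹ := by rw [mul_inv_rev, hs.inv_eq]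
  rw [e, inv_pow, inv_eq_one] at h9
  apply h2
  rw [eq_one_of_coprime (by norm_num) h9 h8, one_pow]

theorem triple (hG : HypHStar G) {a b c : G} (ha : Inv a) (hb : Inv b) (hc : Inv c) :
    Inv (a * b * c) := by
  have h9 := mul_pow_nine hG ha hb
  -- it suffices to write `a * b` as `c * s`
  suffices h : a * b = 1 ∨ ∃ s, Inv s ∧ a * b = c * s by
    rcases h with h | ⟨s, hs, h⟩
    · rw [h, one_mul]; exact hc
    · have := hs.conj c
      rwa [hc.inv_eq, ← h] at this
  by_cases h1 : a * b = 1
  · exact Or.inl h1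
  right
  by_cases h3 : (a * b) ^ 3 = 1
  · have h := inverts hG hc h3
    refine ⟨c * (a * b), ⟨?_, ?_⟩, by rw [← mul_assoc, hc.mul_self, one_mul]⟩
    · intro h'
      have e : a * b = c := by rw [eq_inv_of_mul_eq_one_right h', hc.inv_eq]
      exact h1 (eq_one_of_coprime (m := 2) (n := 3) (by norm_num) (by rw [e]; exact hc.2) h3)
    · rw [pow_two, ← mul_assoc, h, inv_mul_cancel]
  obtain ⟨s, hs, hcomm⟩ := decomp hG hc (a * b)
  set e := (a * b) ^ 3 with he
  have he3 : e ^ 3 = 1 := by rw [he, ← pow_mul]; exact h9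
  have he2 : e⁻¹ ≠ e := by
    intro h
    have : e ^ 2 = 1 := by rw [pow_two]; nth_rewrite 1 [← h]; exact inv_mul_cancel e
    exact h3 (eq_one_of_coprime (m := 2) (n := 3) (by norm_num) this he3)
  have hI : ∀ d, Inv d → d * e * d⁻¹ = e⁻¹ := fun d hd => by
    rw [hd.inv_eq]; exact inverts hG hd he3
  have hI' : ∀ d, Inv d → d * e⁻¹ * d⁻¹ = e := fun d hd => by
    rw [← conj_inv, hI d hd, inv_inv]
  have htinv : (a * b * s) * e * (a * b * s)⁻¹ = e⁻¹ := by
    have : (a * b * s) * e * (a * b * s)⁻¹ = a * (b * (s * e * s⁻¹) * b⁻¹) * a⁻¹ := by group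
    rw [this, hI s hs, hI' b hb, hI a ha]
  have ht1 : a * b * s ≠ 1 := by
    intro h
    rw [h] at htinv
    apply he2
    rw [← htinv]; group
  obtain ⟨n, -, hn⟩ := centralizer_pow hG hc hcomm ht1
  have hab : a * b = a * b * s * s := by rw [mul_assoc, hs.mul_self, mul_one]
  generalize a * b * s = t at hab htinv hn
  cases n with
  | zero =>
    rw [pow_zero, pow_one] at hn
    exact ⟨s, hs, by rw [← hn]; exact hab⟩
  | succ n =>
    exfalso
    have hcom2 : Commute (t ^ 2) e := by
      have : t ^ 2 * e * (t ^ 2)⁻¹ = e := by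
        have h' : t ^ 2 * e * (t ^ 2)⁻¹ = t * (t * e * t⁻¹) * t⁻¹ := by rw [pow_two]; group
        rw [h', htinv, ← conj_inv, htinv, inv_inv]
      exact mul_inv_eq_iff_eq_mul.mp this
    have hce : Commute c e := by
      rw [← hn, pow_succ', pow_mul]
      exact hcom2.pow_left _
    apply he2
    rw [← hI c hc, hce.eq, mul_inv_cancel_right]

theorem list_prod (hG : HypHStar G) (L : List G) (hL : ∀ g ∈ L, g ≠ 1 ∧ g ^ 2 = 1) :
    (Odd L.length → Inv L.prod) ∧
    (Even L.length → L.prod = 1 ∨ ∃ a b, Inv a ∧ Inv b ∧ L.prod = a * b) := by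
  induction L with
  | nil => simp
  | cons g L ih =>
    obtain ⟨ih1, ih2⟩ := ih (fun x hx => hL x (List.mem_cons_of_mem _ hx))
    have hg : Inv g := hL g List.mem_cons_self
    rw [List.length_cons, List.prod_cons]
    refine ⟨fun h => ?_, fun h => ?_⟩
    · rcases ih2 (by grind) with h1 | ⟨a, b, ha, hb, h1⟩
      · rw [h1, mul_one]; exact hg
      · rw [h1, ← mul_assoc]; exact triple hG hg ha hb
    · exact Or.inr ⟨g, L.prod, hg, ih1 (by grind), rfl⟩

end HStar

/-- In a group satisfying (H*), a product of an odd number of involutions is an involution,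
and a product of an even number of involutions has ninth power equal to 1. -/
theorem statement_12 (G : Type*) [Group G] (hG : HypHStar G)
    (L : List G) (hL : ∀ g ∈ L, g ≠ 1 ∧ g ^ 2 = 1) :
    (Odd L.length → L.prod ≠ 1 ∧ L.prod ^ 2 = 1) ∧
    (Even L.length → L.prod ^ 9 = 1) := by
  obtain ⟨h1, h2⟩ := HStar.list_prod hG L hL
  refine ⟨h1, fun h => ?_⟩
  rcases h2 h with h | ⟨a, b, ha, hb, h⟩
  · rw [h, one_pow]
  · rw [h]; exact HStar.mul_pow_nine hG ha hb
end

section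
/- Let G be a group satisfying hypothesis (H*) that contains at least one involution, and let S be the set of all elements of G expressible as a product of an even number of involutions of G (including the empty product 1). Then S is a subgroup of G, S is commutative, S is normal in G, every element s of S satisfies s^9 = 1, every involution a of G satisfies a * s * a⁻¹ = s⁻¹ for all s ∈ S, and for every involution a the subgroup R of G generated by the set of all involutions satisfies R = S ∪ S·a (i.e., R is the semidirect product of S by the subgroup ⟨a⟩ of order 2). -/
namespace Inv13

variable {G : Type*} [Group G]

/-- Involutions. -/
def Invol (a : G) : Prop := a ≠ 1 ∧ a * a = 1

theorem Invol.inv {a : G} (h : Invol a) : a⁻¹ = a := inv_eq_of_mul_eq_one_left h.2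

theorem Invol.conj {a : G} (h : Invol a) (g : G) : Invol (g * a * g⁻¹) := by
  refine ⟨fun e => h.1 ?_, ?_⟩
  · have := congrArg (fun z => g⁻¹ * z * g) e
    simpa [mul_assoc] using this
  · have h2 := h.2
    calc g * a * g⁻¹ * (g * a * g⁻¹) = g * (a * a) * g⁻¹ := by group
      _ = 1 := by rw [h2]; group

theorem Invol.order {a : G} (h : Invol a) : orderOf a = 2 := by
  apply orderOf_eq_prime
  · rw [pow_two, h.2]
  · exact h.1

theorem cent2 (hG : HypHStar G) {a z : G} (ha : Invol a) (hz : a * z = z * a) :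
    ∃ n : ℕ, orderOf z = 2 ^ n := by
  have h := (hG.2 a ha.1 (by rw [pow_two, ha.2])).1
  obtain ⟨n, hn⟩ := h ⟨z, by
    rw [Subgroup.mem_centralizer_iff]
    intro h hh
    rw [Set.mem_singleton_iff] at hh
    rw [hh, hz]⟩
  exact ⟨n, by rw [← hn, Subgroup.orderOf_mk]⟩

theorem comm_eq (hG : HypHStar G) {a b : G} (ha : Invol a) (hb : Invol b)
    (hab : a * b = b * a) : a = b := by
  have h := (hG.2 a ha.1 (by rw [pow_two, ha.2])).2
  have memA : a ∈ Subgroup.centralizer ({a} : Set G) := by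
    rw [Subgroup.mem_centralizer_iff]
    intro h hh
    rw [Set.mem_singleton_iff] at hh
    rw [hh]
  have memB : b ∈ Subgroup.centralizer ({a} : Set G) := by
    rw [Subgroup.mem_centralizer_iff]
    intro h hh
    rw [Set.mem_singleton_iff] at hh
    rw [hh, hab]
  set A : Subgroup.centralizer ({a} : Set G) := ⟨a, memA⟩
  set B : Subgroup.centralizer ({a} : Set G) := ⟨b, memB⟩
  obtain ⟨⟨z, hz⟩, hgen⟩ := h (Subgroup.closure {A, B})
    (Subgroup.fg_iff _ |>.2 ⟨{A, B}, rfl, by simp⟩)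
  obtain ⟨i, hi⟩ := hgen ⟨A, Subgroup.subset_closure (by simp)⟩
  obtain ⟨j, hj⟩ := hgen ⟨B, Subgroup.subset_closure (by simp)⟩
  have hi' : (z : G) ^ i = a := by
    have := congrArg (fun t : Subgroup.closure {A, B} => ((t : Subgroup.centralizer ({a} : Set G)) : G)) hi
    simpa [A] using this
  have hj' : (z : G) ^ j = b := by
    have := congrArg (fun t : Subgroup.closure {A, B} => ((t : Subgroup.centralizer ({a} : Set G)) : G)) hj
    simpa [B] using this
  generalize (z : G) = w at hi' hj'
  have hN : 0 < orderOf w := (hG.1.1 w).orderOf_pos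
  have key : ∀ (i : ℤ), Invol (w ^ i) → ∃ m : ℤ, (orderOf w : ℤ) = 2 * m ∧ w ^ i = w ^ m := by
    intro i hw
    have h1 : w ^ (2 * i) = 1 := by rw [two_mul, zpow_add, hw.2]
    have h2 := orderOf_dvd_iff_zpow_eq_one.2 h1
    have h3 : ¬ ((orderOf w : ℤ) ∣ i) := fun hd => hw.1 (orderOf_dvd_iff_zpow_eq_one.1 hd)
    obtain ⟨t, ht⟩ := h2
    have ht2 : ¬ (2 ∣ t) := by
      rintro ⟨s, rfl⟩
      exact h3 ⟨s, by linarith⟩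
    obtain ⟨s, hs⟩ : ∃ s, t = 2 * s + 1 := ⟨t / 2, by omega⟩
    refine ⟨i - orderOf w * s, by rw [hs] at ht; linarith, ?_⟩
    rw [zpow_sub, zpow_mul, zpow_natCast, pow_orderOf_eq_one]; simp
  obtain ⟨m, hm, e1⟩ := key i (hi' ▸ ha)
  obtain ⟨m', hm', e2⟩ := key j (hj' ▸ hb)
  have : m = m' := by linarith
  rw [← hi', ← hj', e1, e2, this]

/-- possible orders of periodic elements with 2,3 primes -/
theorem smallord (hG : HypHStar G) {x : G} (h : orderOf x ≤ 9) :
    orderOf x = 1 ∨ orderOf x = 2 ∨ orderOf x = 3 ∨ orderOf x = 4 ∨ orderOf x = 8 ∨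
      orderOf x = 9 := by
  have h0 : 0 < orderOf x := (hG.1.1 x).orderOf_pos
  have h5 : ¬ 5 ∣ orderOf x := fun hd => by
    have := (hG.1.2.1 5 (by norm_num)).1 ⟨x, hd⟩
    omega
  have h7 : ¬ 7 ∣ orderOf x := fun hd => by
    have := (hG.1.2.1 7 (by norm_num)).1 ⟨x, hd⟩
    omega
  have h6 : orderOf x ≠ 6 := by
    intro h6
    have h3 : orderOf (x ^ 3) = 2 := by
      rw [orderOf_pow_of_dvd (by norm_num) (by omega), h6]
    have h2 : orderOf (x ^ 2) = 3 := by
      rw [orderOf_pow_of_dvd (by norm_num) (by omega), h6]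
    have hi : Invol (x ^ 3) := by
      refine ⟨fun e => by rw [e] at h3; simp at h3, ?_⟩
      rw [← pow_two, ← h3, pow_orderOf_eq_one]
    obtain ⟨n, hn⟩ := cent2 hG hi (z := x ^ 2) (by rw [← pow_add, ← pow_add])
    rw [h2] at hn
    have : (3 : ℕ) ∣ 2 ^ n := by rw [← hn]
    have := (Nat.prime_dvd_prime_iff_eq Nat.prime_three Nat.prime_two).1
      (Nat.prime_three.dvd_of_dvd_pow this)
    omega
  omega

theorem pow2_odd {z : G} (h : ∃ n : ℕ, orderOf z = 2 ^ n) (ho : Odd (orderOf z)) : z = 1 := by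
  obtain ⟨n, hn⟩ := h
  rcases Nat.eq_zero_or_pos n with rfl | hpos
  · exact orderOf_eq_one_iff.1 (by simpa using hn)
  · rw [hn] at ho
    exact absurd (Even.pow_of_ne_zero even_two hpos.ne') (Nat.not_even_iff_odd.2 ho)

theorem odd_of_no {z : G} (hf : IsOfFinOrder z)
    (h : ∀ m : ℕ, ¬ Invol (z ^ m)) : Odd (orderOf z) := by
  rw [← Nat.not_even_iff_odd]
  rintro ⟨m, hm⟩
  have h0 : 0 < orderOf z := hf.orderOf_pos
  refine h m ⟨fun e => ?_, by rw [← pow_add, ← hm, pow_orderOf_eq_one]⟩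
  have := Nat.le_of_dvd (by omega) (orderOf_dvd_of_pow_eq_one e)
  omega

theorem dd_odd (hG : HypHStar G) {a b : G} (ha : Invol a) (hb : Invol b) :
    Odd (orderOf (a * b)) := by
  apply odd_of_no (hG.1.1 _)
  intro m hm
  have e1 : a * (a * b) ^ m * a⁻¹ = (a * b) ^ m := by
    rw [← conj_pow]
    have : a * (a * b) * a⁻¹ = (a * b)⁻¹ := by
      rw [mul_inv_rev, ha.inv, hb.inv, ← mul_assoc, ha.2, one_mul]
    rw [this, inv_pow, hm.inv]
  have ca : a * (a * b) ^ m = (a * b) ^ m * a := by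
    rw [mul_inv_eq_iff_eq_mul] at e1; exact e1
  have h1 := comm_eq hG ha hm ca
  have h2 := comm_eq hG hb hm (by
    have c2 : (a * b) * (a * b) ^ m = (a * b) ^ m * (a * b) := by rw [← pow_succ, ← pow_succ']
    have := congrArg (fun t => a⁻¹ * t) c2
    simp only [← mul_assoc, inv_mul_cancel, one_mul] at this
    rw [this, ha.inv, ca, mul_assoc _ a a, ha.2, mul_one])
  apply hm.1
  rw [show a * b = 1 by rw [h1.trans h2.symm, hb.2], one_pow]

theorem dd_ord (hG : HypHStar G) {a b : G} (ha : Invol a) (hb : Invol b) (hne : a ≠ b) :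
    orderOf (a * b) = 3 ∨ orderOf (a * b) = 9 := by
  have h := dd_odd hG ha hb
  have h9 := hG.1.2.2 a b (by rw [ha.order]; norm_num) (by rw [hb.order]; norm_num)
  have h1 : orderOf (a * b) ≠ 1 := by
    rw [Ne, orderOf_eq_one_iff]
    intro e
    exact hne (by rw [← hb.inv]; exact eq_inv_of_mul_eq_one_left e)
  rcases smallord hG h9 with e | e | e | e | e | e <;> rw [e] at h h1 ⊢ <;> revert h h1 <;> decide

theorem dd9 (hG : HypHStar G) {a b : G} (ha : Invol a) (hb : Invol b) :
    (a * b) ^ 9 = 1 := by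
  by_cases hne : a = b
  · rw [hne, hb.2, one_pow]
  · rw [← orderOf_dvd_iff_pow_eq_one]
    rcases dd_ord hG ha hb hne with e | e <;> rw [e] <;> norm_num

theorem dd4 (hG : HypHStar G) {a b : G} (ha : Invol a) (hb : Invol b)
    (h : (a * b) ^ 4 = 1) : a = b := by
  have h9 := dd9 hG ha hb
  have h1 : a * b = 1 := by
    calc a * b = (a * b) ^ 9 * (((a * b) ^ 4) ^ 2)⁻¹ := by group
      _ = 1 := by rw [h9, h]; simp
  rw [← hb.inv]; exact eq_inv_of_mul_eq_one_left h1

/-- Fixed point free action on the centralizer of an inverted element of order three. -/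
theorem cent_inv (hG : HypHStar G) {a x z : G} (ha : Invol a) (hx3 : orderOf x = 3)
    (hax : a * x * a = x⁻¹) (hz : z * x = x * z) : a * z * a = z⁻¹ := by
  have hodd : ∀ t : G, t * x = x * t → Odd (orderOf t) := by
    intro t ht
    apply odd_of_no (hG.1.1 _)
    intro m hm
    have hc : t ^ m * x = x * t ^ m := (Commute.pow_left ht m)
    obtain h := cent2 hG hm hc
    have := pow2_odd h (by rw [hx3]; decide)
    rw [this] at hx3; simp at hx3
  have hai := ha.inv
  have haa := ha.2
  have hCx : Commute (a * z * a) x := by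
    have h1 : Commute (a * z * a⁻¹) (a * x⁻¹ * a⁻¹) :=
      (Commute.conj_iff a).2 (Commute.inv_right hz)
    have h2 : a * x⁻¹ * a⁻¹ = x := by
      rw [← hax, hai]; simp only [mul_assoc, haa, mul_one]; rw [← mul_assoc, haa, one_mul]
    rw [h2, hai] at h1; exact h1
  set s := z⁻¹ * (a * z * a) with hs
  have hsx : Commute s x := (Commute.inv_left hz).mul_left hCx
  have has : a * s * a = s⁻¹ := by
    rw [hs]; simp only [mul_inv_rev, inv_inv, hai]
    calc a * (z⁻¹ * (a * z * a)) * a = a * z⁻¹ * a * z * (a * a) := by group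
      _ = _ := by rw [haa]; group
  obtain ⟨m, hm⟩ := hodd s hsx
  set w := s ^ (m + 1) with hw
  have hww : w * w = s := by
    rw [hw, ← pow_add, show m + 1 + (m + 1) = orderOf s + 1 by omega, pow_succ,
      pow_orderOf_eq_one, one_mul]
  have haw : a * w * a = w⁻¹ := by
    have := conj_pow (i := m + 1) (a := a) (b := s)
    rw [hai, has, inv_pow] at this
    exact this.symm
  have hwx : Commute w x := hsx.pow_left _
  have hfix : a * (z * w) = z * w * a := by
    have h1 : a * (z * w) * a = z * w := by
      calc a * (z * w) * a = (a * z * a) * (a * w * a) := by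
            calc _ = a * z * 1 * w * a := by group
              _ = a * z * (a * a) * w * a := by rw [haa]
              _ = _ := by group
        _ = z * s * w⁻¹ := by rw [haw, hs]; group
        _ = z * (w * w) * w⁻¹ := by rw [hww]
        _ = z * w := by group
    calc a * (z * w) = a * (z * w) * (a * a) := by rw [haa, mul_one]
      _ = a * (z * w) * a * a := by group
      _ = _ := by rw [h1]
  have h1 := pow2_odd (cent2 hG ha hfix) (hodd _ (Commute.mul_left hz hwx))
  have hzw : z = w⁻¹ := eq_inv_of_mul_eq_one_left h1
  rw [hzw, inv_inv]
  calc a * w⁻¹ * a = a * (a * w * a) * a := by rw [haw]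
    _ = (a * a) * w * (a * a) := by group
    _ = w := by rw [haa]; group

end Inv13
namespace Inv13

variable {G : Type*} [Group G]

theorem lemS (hG : HypHStar G) {p d : G} (hp : Invol (p * p)) (hd : Invol d)
    (h3 : (p * d) ^ 3 = 1) : p * p = d := by
  apply dd4 hG hp hd
  have e1 : d * p * d = p⁻¹ * d * p⁻¹ := by
    have h := h3
    have hdi := hd.inv
    calc d * p * d = p⁻¹ * (p * d) ^ 3 * d⁻¹ * p⁻¹ := by
          simp only [pow_succ, pow_zero, one_mul]; group
      _ = p⁻¹ * d * p⁻¹ := by rw [h3, hdi]; group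
  have hdd := hd.2
  have e2 : (p * p * d) ^ 2 = p * d * (p⁻¹ * p⁻¹) * d * p⁻¹ := by
    calc (p * p * d) ^ 2 = p * p * (d * p * 1 * p * d) := by
          simp only [pow_succ, pow_zero, one_mul]; group
      _ = p * p * (d * p * (d * d) * p * d) := by rw [hdd]
      _ = p * p * ((d * p * d) * (d * p * d)) := by group
      _ = _ := by rw [e1]; group
  have hpp := hp.2
  calc (p * p * d) ^ 4 = ((p * p * d) ^ 2) * ((p * p * d) ^ 2) := by group
    _ = p * d * (p⁻¹ * p⁻¹) * (d * d) * (p⁻¹ * p⁻¹) * d * p⁻¹ := by rw [e2]; group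
    _ = p * d * (p * p * (p * p))⁻¹ * d * p⁻¹ := by rw [hdd]; group
    _ = p * (d * d) * p⁻¹ := by rw [hpp]; group
    _ = 1 := by rw [hdd]; group

theorem lemT (hG : HypHStar G) {c y u : G} (hc : Invol c) (hy : y ^ 3 = 1)
    (hu : u = c * y * c * y * c * y⁻¹) (huu : Invol (u * u)) : False := by
  have hci := hc.inv
  have hcc := hc.2
  have hcc' : ∀ z, c * (c * z) = z := fun z => by rw [← mul_assoc, hcc, one_mul]
  have hyy : y * y = y⁻¹ := by
    apply eq_inv_of_mul_eq_one_left
    rw [← hy]; simp only [pow_succ, pow_zero, one_mul, mul_assoc]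
  have hyy' : ∀ z, y * (y * z) = y⁻¹ * z := fun z => by rw [← mul_assoc, hyy]
  have key : (y * c * y * c * y⁻¹) * (c * (u * u)) = u⁻¹ * (y * c * y * c * y⁻¹) := by
    rw [hu]
    simp only [mul_assoc, mul_inv_rev, hci, hcc', hyy', inv_inv, inv_mul_cancel_left]
  generalize y * c * y * c * y⁻¹ = h at key
  have key2 : c * (u * u) = h⁻¹ * u⁻¹ * h := by
    rw [mul_assoc, ← key]; group
  have h4 : (c * (u * u)) ^ 4 = 1 := by
    rw [key2]
    calc (h⁻¹ * u⁻¹ * h) ^ 4 = h⁻¹ * (u * u * (u * u))⁻¹ * h := by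
          simp only [pow_succ, pow_zero, one_mul]; group
      _ = 1 := by rw [huu.2]; group
  have h5 := dd4 hG hc huu h4
  have h6 : c * (u * u) = 1 := by rw [← h5, hcc]
  rw [h6] at key2
  have h7 : u = 1 := by
    have : u⁻¹ = h * 1 * h⁻¹ := by rw [key2]; group
    rw [mul_one, mul_inv_cancel] at this
    exact inv_eq_one.1 this
  exact huu.1 (by rw [h7, one_mul])

theorem Invol.sq_conj_inv {u : G} (h : Invol (u * u)) (q : G) :
    Invol ((q * u⁻¹ * q⁻¹) * (q * u⁻¹ * q⁻¹)) := by
  have h1 := h.conj q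
  have h2 : (q * u⁻¹ * q⁻¹) * (q * u⁻¹ * q⁻¹) = q * (u * u)⁻¹ * q⁻¹ := by group
  rw [h2, h.inv]; exact h1

theorem ord4 {u : G} (h : Invol (u * u)) : orderOf u ≤ 4 := by
  apply Nat.le_of_dvd (by norm_num)
  apply orderOf_dvd_of_pow_eq_one
  rw [← h.2]; simp only [pow_succ, pow_zero, one_mul, mul_assoc]

theorem lem3 (hG : HypHStar G) {u d : G} (hu : Invol (u * u)) (hd : Invol d)
    (h3 : orderOf (u * u * d) = 3) : (u * d) ^ 4 = 1 := by
  have hy : (u * u * d) ^ 3 = 1 := by rw [← h3, pow_orderOf_eq_one]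
  have hne : u * u ≠ d := by
    intro e
    rw [e, hd.2] at h3; simp at h3
  have hdd := hd.2
  have hdi := hd.inv
  have h9 := hG.1.2.2 u d (ord4 hu) (by rw [hd.order]; norm_num)
  obtain ⟨g, hg⟩ : ∃ g, g = u * d := ⟨_, rfl⟩
  have hug : u = g * d := by rw [hg, mul_assoc, hdd, mul_one]
  rw [← hg] at h9 ⊢
  have hydef : u * u * d = g * d * g := by
    rw [hug]; simp only [mul_assoc, hdd, mul_one]
  have hr : d * g * g * d * g * g * d = g⁻¹ * g⁻¹ := by
    calc _ = g⁻¹ * (g * d * g) ^ 3 * g⁻¹ := by simp only [pow_succ, pow_zero, one_mul]; group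
      _ = _ := by rw [← hydef, hy, mul_one]
  have gp : g ^ orderOf g = 1 := pow_orderOf_eq_one g
  rcases smallord hG h9 with e | e | e | e | e | e
  · rw [orderOf_eq_one_iff.1 e, one_pow]
  · rw [e] at gp
    rw [show (4 : ℕ) = 2 * 2 from rfl, pow_mul, gp, one_pow]
  · rw [e, hg] at gp
    exact absurd (lemS hG hu hd gp) hne
  · rw [e] at gp; exact gp
  · exfalso
    have hk : Invol ((g * g) * (g * g)) := by
      refine ⟨fun h1 => ?_, ?_⟩
      · have : g ^ 4 = 1 := by rw [← h1]; simp only [pow_succ, pow_zero, one_mul, mul_assoc]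
        have := Nat.le_of_dvd (by norm_num) (orderOf_dvd_of_pow_eq_one this)
        omega
      · rw [e] at gp; rw [← gp]; simp only [pow_succ, pow_zero, one_mul, mul_assoc]
    have h1 : (g * g * d) ^ 3 = 1 := by
      calc (g * g * d) ^ 3 = g * g * (d * g * g * d * g * g * d) := by
            simp only [pow_succ, pow_zero, one_mul]; group
        _ = 1 := by rw [hr]; group
    have h2 := lemS hG hk hd h1
    apply hne
    apply comm_eq hG hu hd
    have cg : Commute d g := by
      rw [← h2]
      exact ((Commute.refl g).mul_left (Commute.refl g)).mul_left
        ((Commute.refl g).mul_left (Commute.refl g))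
    have cu : Commute d u := by rw [hug]; exact cg.mul_right (Commute.refl d)
    exact (cu.mul_right cu).symm
  · exfalso
    rw [e] at gp
    refine lemT hG (c := g * d * g⁻¹) (y := u * u * d) (u := (g⁻¹ * d) * u⁻¹ * (g⁻¹ * d)⁻¹)
      (hd.conj g) hy ?_ (hu.sq_conj_inv _)
    have hdd' : ∀ z, d * (d * z) = z := fun z => by rw [← mul_assoc, hdd, one_mul]
    have hr2 : d * g⁻¹ * g⁻¹ * d = g * g * d * g * g := by
      calc d * g⁻¹ * g⁻¹ * d = d * (g⁻¹ * g⁻¹) * d := by group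
        _ = d * (d * g * g * d * g * g * d) * d := by rw [hr]
        _ = (d * d) * g * g * d * g * g * (d * d) := by group
        _ = _ := by rw [hdd]; group
    rw [hydef, hug]
    simp only [mul_inv_rev, inv_inv, hdi]
    calc g⁻¹ * d * (d * g⁻¹) * (d * g) = g⁻¹ * (d * d) * g⁻¹ * d * g := by group
      _ = g ^ 9 * g⁻¹ * g⁻¹ * d * g := by rw [hdd, gp]; group
      _ = g ^ 5 * (g * g * d * g * g) * g⁻¹ := by group
      _ = g ^ 5 * (d * g⁻¹ * g⁻¹ * d) * g⁻¹ := by rw [← hr2]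
      _ = _ := by
        simp only [pow_succ, pow_zero, one_mul, mul_assoc, hdd', inv_mul_cancel_left]

/-- Elements of order four times involutions satisfy `(ud)^4 = 1`. -/
theorem lemK (hG : HypHStar G) {u d : G} (hu : Invol (u * u)) (hd : Invol d) :
    (u * d) ^ 4 = 1 := by
  by_cases hne : u * u = d
  · have hh := hu.2
    rw [← hne]
    calc (u * (u * u)) ^ 4 = (u * u * (u * u)) ^ 3 := by
          simp only [pow_succ, pow_zero, one_mul]; group
      _ = 1 := by rw [hh, one_pow]
  obtain ⟨a, ha⟩ : ∃ a, a = u * u := ⟨_, rfl⟩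
  have hua : Commute u a := by
    rw [ha]; exact (Commute.refl u).mul_right (Commute.refl u)
  have hA : Invol a := ha ▸ hu
  have haa := hA.2
  have hai := hA.inv
  rw [← ha] at hne
  obtain ⟨y, hy⟩ : ∃ y, y = a * d := ⟨_, rfl⟩
  have hay : a * y * a⁻¹ = y⁻¹ := by
    rw [hy, mul_inv_rev, hA.inv, hd.inv, ← mul_assoc, haa, one_mul]
  have eqv : ∀ z : G, a * z * a⁻¹ = z⁻¹ →
      ((u * (a * z)) ^ 4 = ((u * z * u⁻¹)⁻¹ * z⁻¹ * (u * z * u⁻¹) * z)) := by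
    intro z hz
    have haz' : a * (u * z * u⁻¹) * a⁻¹ = (u * z * u⁻¹)⁻¹ := by
      have h1 : a * u = u * a := hua.symm
      have h2 : u⁻¹ * a⁻¹ = a⁻¹ * u⁻¹ := by rw [← mul_inv_rev, h1, mul_inv_rev]
      calc a * (u * z * u⁻¹) * a⁻¹ = (a * u) * z * (u⁻¹ * a⁻¹) := by group
        _ = u * (a * z * a⁻¹) * u⁻¹ := by rw [h1, h2]; group
        _ = _ := by rw [hz]; group
    have h2 : (u * (a * z)) ^ 2 = a * (u * z * u⁻¹) * z := by
      have h1 : a * u = u * a := hua.symm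
      calc (u * (a * z)) ^ 2 = u * a * z * u * a * z := by
            simp only [pow_succ, pow_zero, one_mul]; group
        _ = (a * u) * z * u⁻¹ * (u * u) * a * z := by rw [h1]; group
        _ = a * u * z * u⁻¹ * (a * a) * z := by rw [← ha]; group
        _ = _ := by rw [haa]; group
    calc (u * (a * z)) ^ 4 = (u * (a * z)) ^ 2 * (u * (a * z)) ^ 2 := by rw [← pow_add]
      _ = (a * (u * z * u⁻¹) * a⁻¹) * (a * z * a⁻¹) * (a * a) * (u * z * u⁻¹) * z := by
        rw [h2]; group
      _ = _ := by rw [haz', hz, haa, mul_one]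
  have main : ∃ z, orderOf z = 3 ∧ a * z * a⁻¹ = z⁻¹ ∧ Commute y z := by
    rcases dd_ord hG hA hd hne with e | e
    · exact ⟨y, by rw [hy, e], hay, Commute.refl y⟩
    · refine ⟨y ^ 3, ?_, ?_, Commute.self_pow y 3⟩
      · rw [hy, orderOf_pow_of_dvd (by norm_num) (by rw [e]; norm_num), e]
      · rw [← conj_pow, hay, inv_pow]
  obtain ⟨z, hz3, haz, hyz⟩ := main
  have hd0 : Invol (a * z) := by
    refine ⟨fun e => ?_, ?_⟩
    · have : z = a := by
        rw [← hai]; exact eq_inv_of_mul_eq_one_right e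
      rw [this, hA.order] at hz3; omega
    · calc a * z * (a * z) = (a * z * a⁻¹) * (a * a) * z := by group
        _ = 1 := by rw [haz, haa]; group
  have h4 := lem3 hG hu hd0 (by rw [← ha, ← mul_assoc, haa, one_mul, hz3])
  rw [eqv z haz] at h4
  obtain ⟨x, hx⟩ : ∃ x, x = u * z * u⁻¹ := ⟨_, rfl⟩
  rw [← hx] at h4
  have hxz : Commute x z := by
    have : x * z = z * x := by
      calc x * z = z * x * (x⁻¹ * z⁻¹ * x * z) := by group
        _ = z * x := by rw [h4, mul_one]
    exact this
  have hx3 : orderOf x = 3 := by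
    rw [hx, ← hz3]
    exact orderOf_injective (MulAut.conj u).toMonoidHom (MulAut.conj u).injective z
  rw [hai] at haz hay
  have comm_of_inv : ∀ s t : G, a * s * a = s⁻¹ → a * t * a = t⁻¹ →
      a * (s * t) * a = (s * t)⁻¹ → Commute s t := by
    intro s t hs ht hst
    have : s⁻¹ * t⁻¹ = t⁻¹ * s⁻¹ := by
      rw [← hs, ← ht, hs, ht, ← mul_inv_rev s t, ← hst]
      calc s⁻¹ * t⁻¹ = (a * s * a) * (a * t * a) := by rw [hs, ht]
        _ = a * s * (a * a) * t * a := by group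
        _ = _ := by rw [haa]; group
    have h2 := congrArg (·⁻¹) this
    simp only [mul_inv_rev, inv_inv] at h2
    exact h2.symm
  have abel : ∀ w, orderOf w = 3 → a * w * a = w⁻¹ → ∀ s t, Commute s w → Commute t w →
      Commute s t := fun w hw3 haw s t hs ht =>
    comm_of_inv s t (cent_inv hG hA hw3 haw hs) (cent_inv hG hA hw3 haw ht)
      (cent_inv hG hA hw3 haw (hs.mul_left ht))
  have hax : a * x * a = x⁻¹ := cent_inv hG hA hz3 haz hxz
  have hyx : Commute y x := abel z hz3 haz y x hyz hxz
  have hyx' : Commute (u * y * u⁻¹) x := by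
    rw [hx]; exact (Commute.conj_iff u).2 hyz
  have hyy : Commute (u * y * u⁻¹) y := abel x hx3 hax _ _ hyx' hyx
  have := eqv y (by rw [hai]; exact hay)
  rw [hy, ← mul_assoc a a d, haa, one_mul, ← hy] at this
  rw [this]
  generalize u * y * u⁻¹ = y' at hyy
  have h := hyy.eq
  calc y'⁻¹ * y⁻¹ * y' * y = (y * y')⁻¹ * (y' * y) := by group
    _ = 1 := by rw [h]; group

theorem lemK2 (hG : HypHStar G) {u d : G} (hu : Invol (u * u)) (hd : Invol d) :
    Invol ((u * d) * (u * d)) := by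
  have h4 := lemK hG hu hd
  refine ⟨fun e => ?_, by rw [← h4]; simp only [pow_succ, pow_zero, one_mul, mul_assoc]⟩
  have hdi := hd.inv
  have h1 : d * u * d = u⁻¹ := by
    calc d * u * d = u⁻¹ * (u * d * (u * d)) := by group
      _ = u⁻¹ := by rw [e, mul_one]
  have h2 : u * u = d := by
    apply comm_eq hG hu hd
    have : d * (u * u) * d = u * u := by
      calc d * (u * u) * d = d * u * 1 * u * d := by group
        _ = d * u * (d * d) * u * d := by rw [hd.2]
        _ = (d * u * d) * (d * u * d) := by group
        _ = (u * u)⁻¹ := by rw [h1]; group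
        _ = u * u := hu.inv
    calc u * u * d = d * (u * u) * d * d := by rw [this]
      _ = d * (u * u) * (d * d) := by group
      _ = _ := by rw [hd.2, mul_one]
  apply hu.1
  have h3 := hu.2
  calc u * u = u * u * ((u * u) * (u * u)) := by rw [h3, mul_one]
    _ = (u * (u * u)) * (u * (u * u)) := by group
    _ = 1 := by rw [h2]; exact e

/-- Products of involutions never have order four. -/
theorem lemQ (hG : HypHStar G) (L : List G) (hL : ∀ g ∈ L, Invol g) :
    ∀ u : G, Invol (u * u) → Invol ((u * L.prod) * (u * L.prod)) := by
  induction L with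
  | nil => intro u hu; simpa using hu
  | cons d L ih =>
    intro u hu
    have := ih (fun g hg => hL g (List.mem_cons_of_mem _ hg)) (u * d)
      (lemK2 hG hu (hL d List.mem_cons_self))
    have e : u * (d * L.prod) = u * d * L.prod := (mul_assoc _ _ _).symm
    rw [List.prod_cons, e]; exact this

theorem lemQ2 (hG : HypHStar G) (L : List G) (hL : ∀ g ∈ L, Invol g) :
    ¬ Invol (L.prod * L.prod) := by
  intro h
  have h2 : Invol (L.prod⁻¹ * L.prod⁻¹) := by
    have := h.sq_conj_inv 1
    simpa using this
  have := lemQ hG L hL _ h2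
  exact this.1 (by simp)

end Inv13
namespace Inv13

variable {G : Type*} [Group G]

/-- `z` is a product of involutions. -/
def IsProd (z : G) : Prop := ∃ L : List G, (∀ g ∈ L, Invol g) ∧ L.prod = z

theorem IsProd.mul {x y : G} (hx : IsProd x) (hy : IsProd y) : IsProd (x * y) := by
  obtain ⟨L, hL, rfl⟩ := hx
  obtain ⟨M, hM, rfl⟩ := hy
  refine ⟨L ++ M, fun g hg => ?_, List.prod_append⟩
  rcases List.mem_append.1 hg with h | h
  · exact hL g h
  · exact hM g h

theorem IsProd.one : IsProd (1 : G) := ⟨[], by simp, rfl⟩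

theorem IsProd.pow {x : G} (hx : IsProd x) (n : ℕ) : IsProd (x ^ n) := by
  induction n with
  | zero => rw [pow_zero]; exact IsProd.one
  | succ n ih => rw [pow_succ]; exact ih.mul hx

theorem Invol.isProd {a : G} (ha : Invol a) : IsProd a := ⟨[a], by simpa using ha, by simp⟩

theorem IsProd.inv {x : G} (hx : IsProd x) : IsProd x⁻¹ := by
  obtain ⟨L, hL, rfl⟩ := hx
  induction L with
  | nil => simpa using IsProd.one
  | cons d L ih =>
    rw [List.prod_cons, mul_inv_rev]
    refine (ih fun g hg => hL g (List.mem_cons_of_mem _ hg)).mul ?_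
    have hd := hL d List.mem_cons_self
    rw [hd.inv]; exact hd.isProd

theorem cent_R (hG : HypHStar G) {a z : G} (ha : Invol a) (hz : IsProd z)
    (hc : a * z = z * a) : z = 1 ∨ z = a := by
  obtain ⟨n, hn⟩ := cent2 hG ha hc
  have hsq : z * z = 1 := by
    by_contra hne
    have hn2 : 2 ≤ n := by
      by_contra hlt
      apply hne
      rw [← pow_two, ← orderOf_dvd_iff_pow_eq_one, hn]
      exact pow_dvd_pow 2 (by omega : n ≤ 1)
    obtain ⟨m, rfl⟩ : ∃ m, n = m + 2 := ⟨n - 2, by omega⟩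
    obtain ⟨L, hL, hLz⟩ := hz.pow (2 ^ m)
    apply lemQ2 hG L hL
    rw [hLz]
    refine ⟨fun e => ?_, ?_⟩
    · rw [← pow_add, ← orderOf_dvd_iff_pow_eq_one, hn] at e
      have := Nat.le_of_dvd (by positivity) e
      have h0 : 0 < 2 ^ m := by positivity
      rw [pow_add] at this
      omega
    · rw [← pow_add, ← pow_add, ← orderOf_dvd_iff_pow_eq_one, hn]
      exact ⟨1, by ring⟩
  by_cases h1 : z = 1
  · exact Or.inl h1
  · exact Or.inr (comm_eq hG ha ⟨h1, hsq⟩ hc).symm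

theorem dicho (hG : HypHStar G) {a z : G} (ha : Invol a) (hz : IsProd z) :
    a * z * a = z⁻¹ ∨ z * z = 1 := by
  have haa := ha.2
  have hai := ha.inv
  have hb := ha.conj z
  obtain ⟨s, hs⟩ : ∃ s, s = z * a * z⁻¹ * a := ⟨_, rfl⟩
  have hs9 : s ^ 9 = 1 := by rw [hs]; exact dd9 hG hb ha
  have hsP : IsProd s := by rw [hs]; exact hb.isProd.mul ha.isProd
  have has : a * s * a⁻¹ = s⁻¹ := by
    rw [hs, mul_inv_rev, hb.inv, hai, mul_assoc a, mul_assoc _ a a, haa, mul_one]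
  obtain ⟨w, hw⟩ : ∃ w, w = s ^ 5 := ⟨_, rfl⟩
  have hww : w * w = s := by
    rw [hw, ← pow_add, show 5 + 5 = 9 + 1 from rfl, pow_succ, hs9, one_mul]
  have haw : a * w * a = w⁻¹ := by
    have : a * w * a⁻¹ = w⁻¹ := by rw [hw, ← conj_pow, has, inv_pow]
    rwa [hai] at this
  have hP : IsProd (w⁻¹ * z) := by
    refine IsProd.mul ?_ hz
    rw [hw]; exact (hsP.pow 5).inv
  have haw2 : a * w⁻¹ = w * a := by
    rw [← haw]
    calc a * (a * w * a) = (a * a) * w * a := by group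
      _ = _ := by rw [haa, one_mul]
  have hc : a * (w⁻¹ * z) = w⁻¹ * z * a := by
    have h1 : z * a = s * a * z := by
      rw [hs]
      calc z * a = z * a * z⁻¹ * 1 * z := by group
        _ = z * a * z⁻¹ * (a * a) * z := by rw [haa]
        _ = _ := by group
    calc a * (w⁻¹ * z) = (a * w⁻¹) * z := by group
      _ = w⁻¹ * (w * w) * a * z := by rw [haw2]; group
      _ = w⁻¹ * (s * a * z) := by rw [hww]; group
      _ = _ := by rw [← h1]; group
  rcases cent_R hG ha hP hc with h | h
  · left
    have : z = w := (inv_mul_eq_one.1 h).symm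
    rw [this]; exact haw
  · right
    have : z = w * a := inv_mul_eq_iff_eq_mul.1 h
    rw [this]
    calc w * a * (w * a) = w * (a * w * a) := by group
      _ = 1 := by rw [haw]; group

theorem triple (hG : HypHStar G) {a b c : G} (ha : Invol a) (hb : Invol b) (hc : Invol c) :
    Invol (a * b * c) := by
  have hP : IsProd (a * b * c) := (ha.isProd.mul hb.isProd).mul hc.isProd
  have hinv : (a * b * c)⁻¹ = c * b * a := by
    rw [mul_inv_rev, mul_inv_rev, ha.inv, hb.inv, hc.inv, mul_assoc]
  refine ⟨fun e => ?_, ?_⟩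
  · have h1 : a * b = c := by
      rw [← hc.inv]; exact eq_inv_of_mul_eq_one_left e
    have h9 := dd9 hG ha hb
    rw [h1] at h9
    apply hc.1
    calc c = c ^ 9 * ((c * c) ^ 4)⁻¹ := by
          simp only [pow_succ, pow_zero, one_mul]; group
      _ = 1 := by rw [h9, hc.2]; simp
  · rcases dicho hG hc hP with h | h
    · rcases dicho hG ha hP with h' | h'
      · rw [hinv] at h
        have h1 : c * (a * b) = c * (b * a) := by
          calc c * (a * b) = c * (a * b) * (c * c) := by rw [hc.2, mul_one]
            _ = c * (a * b * c) * c := by group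
            _ = _ := by rw [h]; group
        have h2 := comm_eq hG ha hb (mul_left_cancel h1)
        rw [h2, hb.2, one_mul, hc.2]
      · exact h'
    · exact h

theorem triple_rev (hG : HypHStar G) {a b c : G} (ha : Invol a) (hb : Invol b) (hc : Invol c) :
    a * b * c = c * b * a := by
  rw [← (triple hG ha hb hc).inv, mul_inv_rev, mul_inv_rev, ha.inv, hb.inv, hc.inv, mul_assoc]

theorem lists (hG : HypHStar G) {a : G} (ha : Invol a) (L : List G) (hL : ∀ g ∈ L, Invol g) :
    (Even L.length → ∃ e, Invol e ∧ L.prod = a * e) ∧ (¬ Even L.length → Invol L.prod) := by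
  induction L with
  | nil => exact ⟨fun _ => ⟨a, ha, by simp [ha.2]⟩, fun h => absurd (by simp) h⟩
  | cons d L ih =>
    have hd := hL d List.mem_cons_self
    obtain ⟨i1, i2⟩ := ih fun g hg => hL g (List.mem_cons_of_mem _ hg)
    rw [List.length_cons, Nat.even_add_one, List.prod_cons, not_not]
    constructor
    · intro h
      refine ⟨_, triple hG ha hd (i2 h), ?_⟩
      rw [← mul_assoc, ← mul_assoc, ha.2, one_mul]
    · intro h
      obtain ⟨e, he, h2⟩ := i1 h
      rw [h2, ← mul_assoc]
      exact triple hG hd ha he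

theorem invol_iff {a : G} : (a ≠ 1 ∧ a ^ 2 = 1) ↔ Invol a := by
  rw [Invol, pow_two]

end Inv13

/-- Lemma 8: in a group satisfying (H*) possessing an involution, the set `S` of products
of an even number of involutions is an abelian normal subgroup of exponent at most 9,
inverted by every involution, and the subgroup `R` generated by all involutions satisfies
`R = S ∪ S·a` for every involution `a`. -/
theorem statement_13 (G : Type*) [Group G] (hG : HypHStar G)
    (a₀ : G) (ha₀1 : a₀ ≠ 1) (ha₀2 : a₀ ^ 2 = 1)
    (S : Set G)
    (hS : S = {s : G | ∃ L : List G, (∀ g ∈ L, g ≠ 1 ∧ g ^ 2 = 1) ∧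
      Even L.length ∧ L.prod = s}) :
    ∃ S' : Subgroup G, (S' : Set G) = S ∧
      (∀ s ∈ S', ∀ u ∈ S', s * u = u * s) ∧
      S'.Normal ∧
      (∀ s ∈ S', s ^ 9 = 1) ∧
      (∀ a : G, a ≠ 1 → a ^ 2 = 1 → ∀ s ∈ S', a * s * a⁻¹ = s⁻¹) ∧
      (∀ a : G, a ≠ 1 → a ^ 2 = 1 →
        (Subgroup.closure {g : G | g ≠ 1 ∧ g ^ 2 = 1} : Set G) =
          S ∪ (fun s => s * a) '' S) := by
  simp only [Inv13.invol_iff] at hS ⊢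
  have ha₀ : Inv13.Invol a₀ := Inv13.invol_iff.1 ⟨ha₀1, ha₀2⟩
  have char : ∀ a : G, Inv13.Invol a → ∀ s : G, s ∈ S ↔ ∃ e, Inv13.Invol e ∧ s = a * e := by
    intro a ha s
    rw [hS]
    constructor
    · rintro ⟨L, hL, hev, rfl⟩
      exact (Inv13.lists hG ha L hL).1 hev
    · rintro ⟨e, he, rfl⟩
      exact ⟨[a, e], by simp [ha, he], by simp, by simp⟩
  have inver : ∀ a : G, Inv13.Invol a → ∀ s ∈ S, a * s * a⁻¹ = s⁻¹ := by
    intro a ha s hs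
    obtain ⟨e, he, rfl⟩ := (char a ha s).1 hs
    rw [mul_inv_rev, ha.inv, he.inv, ← mul_assoc, ha.2, one_mul]
  have mulmem : ∀ s ∈ S, ∀ t ∈ S, s * t ∈ S := by
    intro s hs t ht
    obtain ⟨e, he, rfl⟩ := (char a₀ ha₀ s).1 hs
    obtain ⟨f, hf, rfl⟩ := (char a₀ ha₀ t).1 ht
    exact (char a₀ ha₀ _).2 ⟨_, Inv13.triple hG he ha₀ hf, by simp only [mul_assoc]⟩
  have invmem : ∀ s ∈ S, s⁻¹ ∈ S := by
    intro s hs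
    obtain ⟨e, he, rfl⟩ := (char a₀ ha₀ s).1 hs
    refine (char e he _).2 ⟨a₀, ha₀, ?_⟩
    rw [mul_inv_rev, ha₀.inv, he.inv]
  have onemem : (1 : G) ∈ S := (char a₀ ha₀ 1).2 ⟨a₀, ha₀, ha₀.2.symm⟩
  let S' : Subgroup G :=
    { carrier := S
      mul_mem' := fun {s t} hs ht => mulmem s hs t ht
      one_mem' := onemem
      inv_mem' := fun {s} hs => invmem s hs }
  have hmem : ∀ s, s ∈ S' ↔ s ∈ S := fun s => Iff.rfl
  refine ⟨S', rfl, ?_, ⟨?_⟩, ?_, ?_, ?_⟩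
  · intro s hs t ht
    have h1 := inver a₀ ha₀ _ (mulmem s hs t ht)
    have h2 := inver a₀ ha₀ _ hs
    have h3 := inver a₀ ha₀ _ ht
    have h4 : s⁻¹ * t⁻¹ = (s * t)⁻¹ := by rw [← h1, ← h2, ← h3]; group
    have h5 := congrArg (·⁻¹) h4
    simp only [mul_inv_rev, inv_inv] at h5
    exact h5.symm
  · intro s hs g
    obtain ⟨e, he, rfl⟩ := (char a₀ ha₀ s).1 hs
    exact (char _ (ha₀.conj g) _).2 ⟨_, he.conj g, by group⟩
  · intro s hs
    obtain ⟨e, he, rfl⟩ := (char a₀ ha₀ s).1 hs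
    exact Inv13.dd9 hG ha₀ he
  · intro a ha1 ha2 s hs
    exact inver a (Inv13.invol_iff.1 ⟨ha1, ha2⟩) s hs
  · intro a ha1 ha2
    have ha : Inv13.Invol a := Inv13.invol_iff.1 ⟨ha1, ha2⟩
    ext z
    constructor
    · intro hz
      obtain ⟨L, hL, rfl⟩ : Inv13.IsProd z := by
        induction hz using Subgroup.closure_induction with
        | mem x hx => exact Inv13.Invol.isProd hx
        | one => exact Inv13.IsProd.one
        | mul x y _ _ hx hy => exact hx.mul hy
        | inv x _ hx => exact hx.inv
      by_cases hev : Even L.length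
      · left
        exact (char a ha _).2 ((Inv13.lists hG ha L hL).1 hev)
      · right
        have h := (Inv13.lists hG ha L hL).2 hev
        refine ⟨L.prod * a, (char _ h _).2 ⟨a, ha, rfl⟩, ?_⟩
        simp only [mul_assoc, ha.2, mul_one]
    · have hSR : ∀ s ∈ S, s ∈ Subgroup.closure {g : G | Inv13.Invol g} := by
        intro s hs
        obtain ⟨e, he, rfl⟩ := (char a ha s).1 hs
        exact mul_mem (Subgroup.subset_closure ha) (Subgroup.subset_closure he)
      rintro (h | ⟨s, hs, rfl⟩)
      · exact hSR z h
      · exact mul_mem (hSR s hs) (Subgroup.subset_closure ha)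
end

section
/- The group presented on two generators t, x with defining relations t^4 = 1, x^3 = 1, (t^2 * x)^2 = 1, (t * x)^8 = 1, and (t⁻¹ * x⁻¹ * t * x)^9 = 1 has cardinality 36; it is isomorphic to a semidirect product (C3 × C3) ⋊ C4. -/
/-- The relations `t⁴, x³, (t²x)², (tx)⁸, [t,x]⁹` on generators `t = of 0`, `x = of 1`. -/
def rels14 : Set (FreeGroup (Fin 2)) :=
  { (FreeGroup.of 0) ^ 4, (FreeGroup.of 1) ^ 3,
    ((FreeGroup.of 0) ^ 2 * FreeGroup.of 1) ^ 2,
    (FreeGroup.of 0 * FreeGroup.of 1) ^ 8,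
    ((FreeGroup.of 0)⁻¹ * (FreeGroup.of 1)⁻¹ * FreeGroup.of 0 * FreeGroup.of 1) ^ 9 }

/-- Key computation: `x, y` of order 3 with `[x,y]² = (xy)⁹ = (x⁻¹y)⁹`-type relations commute. -/
lemma key_commute {G : Type*} [Group G] (x y : G) (hx : x ^ 3 = 1) (hy : y ^ 3 = 1)
    (hc : (x * y * x⁻¹ * y⁻¹) ^ 2 = 1) (h1 : (x * y) ^ 9 = 1) (h2 : (x * y⁻¹) ^ 9 = 1) :
    x * y = y * x := by
  have hyy : y⁻¹ = y * y := by
    rw [inv_eq_iff_mul_eq_one, ← hy, pow_three]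
  obtain ⟨r, hr⟩ : ∃ r, r = y⁻¹ * x * y := ⟨_, rfl⟩
  obtain ⟨a, ha⟩ : ∃ a, a = y * x * y⁻¹ := ⟨_, rfl⟩
  have hr' : r = y * a * y⁻¹ := by
    rw [hr, ha]
    have : y = y⁻¹ * y⁻¹ := by rw [← mul_inv_rev, ← hyy, inv_inv]
    calc y⁻¹ * x * y = y⁻¹ * x * (y⁻¹ * y⁻¹) := by rw [← this]
      _ = (y * y) * x * (y⁻¹ * y⁻¹) := by rw [← hyy]
      _ = _ := by group
  have hx' : x = y * r * y⁻¹ := by rw [hr]; group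
  have conjp : ∀ (g b : G) (n : ℕ), b ^ n = 1 → (g * b * g⁻¹) ^ n = 1 := by
    intro g b n h; rw [conj_pow, h]; group
  have a3 : a ^ 3 = 1 := by rw [ha]; exact conjp _ _ _ hx
  have r3 : r ^ 3 = 1 := by rw [hr']; exact conjp _ _ _ a3
  -- the three involutions
  have p2 : (x * a⁻¹) ^ 2 = 1 := by
    rw [← hc, ha]; group
  have q2 : (a * r⁻¹) ^ 2 = 1 := by
    have := conjp y _ _ p2
    rw [← this, hr']
    congr 1
    nth_rewrite 1 [ha]
    group
  have w2' : (r * x⁻¹) ^ 2 = 1 := by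
    have := conjp y _ _ q2
    rw [← this, hx']
    congr 1
    nth_rewrite 1 [hr']
    group
  have w2 : (x * r⁻¹) ^ 2 = 1 := by
    have : x * r⁻¹ = (r * x⁻¹)⁻¹ := by group
    rw [this, inv_pow, w2', inv_one]
  obtain ⟨q, hq⟩ : ∃ q, q = a * r⁻¹ := ⟨_, rfl⟩
  obtain ⟨w, hw⟩ : ∃ w, w = x * r⁻¹ := ⟨_, rfl⟩
  have ea : a = q * r := by rw [hq]; group
  have ex : x = w * r := by rw [hw]; group
  rw [← hq] at q2
  rw [← hw] at w2
  have wq2 : (w * q⁻¹) ^ 2 = 1 := by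
    rw [← p2, ea, ex]; congr 1; group
  have n1 : (x * a * r) ^ 3 = 1 := by
    rw [← h1, show (9 : ℕ) = 3 * 3 from rfl, pow_mul]
    congr 1
    have : r = y * y * x * y := by rw [hr, hyy]
    rw [this, ha]; simp only [pow_succ, pow_zero]; group
  have n2 : (x * r * a) ^ 3 = 1 := by
    rw [← h2, show (9 : ℕ) = 3 * 3 from rfl, pow_mul]
    congr 1
    have : a = y⁻¹ * y⁻¹ * x * y⁻¹ := by
      rw [← mul_inv_rev, ← hyy, inv_inv, ha]
    rw [this, hr]; simp only [pow_succ, pow_zero]; group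
  have qi : q⁻¹ = q := by rw [inv_eq_iff_mul_eq_one, ← pow_two, q2]
  have wi : w⁻¹ = w := by rw [inv_eq_iff_mul_eq_one, ← pow_two, w2]
  have cqw : Commute q w := by
    have : (w * q)⁻¹ = w * q := by
      rw [inv_eq_iff_mul_eq_one, ← pow_two, ← wq2, qi]
    rw [mul_inv_rev, qi, wi] at this
    exact this
  obtain ⟨u, hu⟩ : ∃ u, u = r * q * r⁻¹ := ⟨_, rfl⟩
  obtain ⟨v, hv⟩ : ∃ v, v = r⁻¹ * q * r := ⟨_, rfl⟩
  have rr : r * r = r⁻¹ := by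
    symm; rw [inv_eq_iff_mul_eq_one, ← r3, pow_three]
  have u2 : u * u = 1 := by rw [hu, ← pow_two]; exact conjp _ _ _ q2
  have v2 : v * v = 1 := by
    have := conjp r⁻¹ _ _ q2
    rw [inv_inv, ← hv, pow_two] at this; exact this
  have quv : q * u * v = 1 := by
    have : q * u * v = (q * r) ^ 3 := by
      rw [hu, hv, pow_three]
      calc _ = q * r * q * (r * r)⁻¹ * q * r := by group
        _ = _ := by rw [rr]; group
    rw [this, ← ea, a3]
  have vq : v = q * u := by
    rw [mul_eq_one_iff_inv_eq] at quv
    have := mul_eq_one_iff_eq_inv.1 v2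
    rw [← quv, inv_inv] at this
    rw [← quv]; exact this
  have cqu : Commute q u := by
    have h : (q * u)⁻¹ = q * u := by rw [inv_eq_iff_mul_eq_one, ← vq, v2]
    rw [mul_inv_rev, qi, inv_eq_of_mul_eq_one_right u2] at h
    exact h.symm
  have m1 : (w * u) ^ 3 = 1 := by
    rw [← n1, ex, ea, hu]; congr 1
    rw [show w * r * (q * r) * r = w * r * q * (r * r) by group, rr]; group
  have m2 : (w * v) ^ 3 = 1 := by
    rw [← n2, ex, ea, hv]; congr 1
    rw [show w * r * r * (q * r) = w * (r * r) * q * r by group, rr]; group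
  have q1 : q = 1 := by
    have e : w * v = q * (w * u) := by
      rw [vq, ← mul_assoc, ← mul_assoc, cqw.eq]
    rw [e, (cqw.mul_right cqu).mul_pow, m1, mul_one, pow_succ, q2, one_mul] at m2
    exact m2
  have ar : a = r := by rw [ea, q1, one_mul]
  have xa : x = a := by rw [hx', ← ar, ← hr', ar]
  calc x * y = a * y := by rw [← xa]
    _ = y * x := by rw [ha]; group

/-- A hom out of the cyclic group of order `n`. -/
lemma exists_cyc {G : Type*} [Group G] (n : ℕ) (g : G) (h : g ^ n = 1) :
    ∃ f : Multiplicative (ZMod n) →* G, f (Multiplicative.ofAdd 1) = g := by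
  refine ⟨AddMonoidHom.toMultiplicativeLeft
    (ZMod.lift n ⟨zmultiplesHom (Additive G) (Additive.ofMul g), ?_⟩), ?_⟩
  · simp [← ofMul_pow, h]
  · have : (1 : ZMod n) = ((1 : ℤ) : ZMod n) := by simp
    rw [AddMonoidHom.toMultiplicativeLeft_apply_apply, toAdd_ofAdd, this, ZMod.lift_coe]
    simp

lemma cyc_pow (n : ℕ) [NeZero n] (z : Multiplicative (ZMod n)) :
    ∃ k : ℕ, z = (Multiplicative.ofAdd 1) ^ k := by
  refine ⟨(Multiplicative.toAdd z).val, ?_⟩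
  rw [← ofAdd_nsmul]
  simp

lemma cyc_ext {G : Type*} [Group G] (n : ℕ) [NeZero n] {f g : Multiplicative (ZMod n) →* G}
    (h : f (Multiplicative.ofAdd 1) = g (Multiplicative.ofAdd 1)) : f = g := by
  refine MonoidHom.ext fun z => ?_
  obtain ⟨k, hk⟩ := cyc_pow n z
  rw [hk, map_pow, map_pow, h]

abbrev V14 := Multiplicative (ZMod 3) × Multiplicative (ZMod 3)

/-- The automorphism `(a, b) ↦ (b, a⁻¹)`. -/
def tau14 : MulAut V14 where
  toFun v := (v.2, v.1⁻¹)
  invFun v := (v.2⁻¹, v.1)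
  left_inv v := by simp
  right_inv v := by simp
  map_mul' v w := by simp [mul_comm]

def phi14 : Multiplicative (ZMod 4) →* MulAut V14 where
  toFun k := tau14 ^ (Multiplicative.toAdd k).val
  map_one' := rfl
  map_mul' := by
    have : ∀ a b : Multiplicative (ZMod 4), ∀ v : V14,
      (tau14 ^ (Multiplicative.toAdd (a * b)).val) v =
      (tau14 ^ (Multiplicative.toAdd a).val * tau14 ^ (Multiplicative.toAdd b).val) v := by decide
    intro a b
    exact MulEquiv.ext (this a b)

abbrev S14 := V14 ⋊[phi14] Multiplicative (ZMod 4)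

def T14 : S14 := ⟨1, Multiplicative.ofAdd 1⟩
def X14 : S14 := ⟨(Multiplicative.ofAdd 1, 1), 1⟩

lemma rel_S : ∀ r : FreeGroup (Fin 2), r ∈ rels14 → FreeGroup.lift ![T14, X14] r = 1 := by
  intro r hr
  simp only [rels14, Set.mem_insert_iff, Set.mem_singleton_iff] at hr
  rcases hr with rfl | rfl | rfl | rfl | rfl <;>
  simp only [map_pow, map_mul, map_inv, FreeGroup.lift_apply_of, Matrix.cons_val_zero, Matrix.cons_val_one] <;>
  decide

theorem statement_14 :
    Nat.card (PresentedGroup rels14) = 36 ∧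
    ∃ φ : Multiplicative (ZMod 4) →*
        MulAut (Multiplicative (ZMod 3) × Multiplicative (ZMod 3)),
      Nonempty (PresentedGroup rels14 ≃*
        (Multiplicative (ZMod 3) × Multiplicative (ZMod 3)) ⋊[φ] Multiplicative (ZMod 4)) := by
  suffices h : Nonempty (PresentedGroup rels14 ≃* S14) by
    refine ⟨?_, phi14, h⟩
    obtain ⟨e⟩ := h
    rw [Nat.card_congr e.toEquiv, SemidirectProduct.card, Nat.card_prod]
    simp
  -- the generators and their relations
  obtain ⟨t, ht⟩ : ∃ t : PresentedGroup rels14, t = PresentedGroup.of 0 := ⟨_, rfl⟩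
  obtain ⟨x, hx⟩ : ∃ x : PresentedGroup rels14, x = PresentedGroup.of 1 := ⟨_, rfl⟩
  have R : ∀ r : FreeGroup (Fin 2), r ∈ rels14 → PresentedGroup.mk rels14 r = 1 :=
    fun r hr => PresentedGroup.one_of_mem hr
  have t4 : t ^ 4 = 1 := by
    rw [ht]; exact R (FreeGroup.of 0 ^ 4) (by simp [rels14])
  have x3 : x ^ 3 = 1 := by
    rw [hx]; exact R (FreeGroup.of 1 ^ 3) (by simp [rels14])
  have h2 : (t ^ 2 * x) ^ 2 = 1 := by
    rw [ht, hx]; exact R ((FreeGroup.of 0 ^ 2 * FreeGroup.of 1) ^ 2) (by simp [rels14])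
  have h8 : (t * x) ^ 8 = 1 := by
    rw [ht, hx]; exact R ((FreeGroup.of 0 * FreeGroup.of 1) ^ 8) (by simp [rels14])
  have h9 : (t⁻¹ * x⁻¹ * t * x) ^ 9 = 1 := by
    rw [ht, hx]
    exact R (((FreeGroup.of 0)⁻¹ * (FreeGroup.of 1)⁻¹ * FreeGroup.of 0 * FreeGroup.of 1) ^ 9)
      (by simp [rels14])
  obtain ⟨y, hy⟩ : ∃ y, y = t⁻¹ * x * t := ⟨_, rfl⟩
  have t2 : t⁻¹ * t⁻¹ = t * t := by
    rw [← mul_inv_rev, inv_eq_iff_mul_eq_one, ← t4]; simp only [pow_succ, pow_zero]; group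
  have sx : t * t * x * t * t = x⁻¹ := by
    rw [eq_inv_iff_mul_eq_one, ← h2]; simp only [pow_succ, pow_zero]; group
  have hyt : t⁻¹ * y * t = x⁻¹ := by
    rw [hy, ← sx, ← t2]; group
  have hyt' : t * x * t⁻¹ = y⁻¹ := by
    have : x = t⁻¹ * y⁻¹ * t := by rw [← inv_inv x, ← hyt]; group
    rw [this]; group
  have y3 : y ^ 3 = 1 := by
    have : y = t⁻¹ * x * t⁻¹⁻¹ := by rw [hy, inv_inv]
    rw [this, conj_pow, x3]; group
  -- `(tx)⁴ = y⁻¹ x⁻¹ y x`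
  have e4 : (t * x) ^ 4 = y⁻¹ * x⁻¹ * y * x := by
    calc (t * x) ^ 4 = (t * x * t⁻¹) * (t * t * x * t * t) * (t⁻¹ * x * t) * x := by
          simp only [pow_succ, pow_zero]; group
      _ = _ := by rw [hyt', sx, hy]
  have hc : (y⁻¹ * x⁻¹ * y * x) ^ 2 = 1 := by
    rw [← e4, ← pow_mul]; exact h8
  have k9 : (y⁻¹ * x) ^ 9 = 1 := by
    rw [← h9, hy]; congr 1; group
  have k9' : (x * y) ^ 9 = 1 := by
    have e : x * y = t⁻¹ * (y⁻¹ * x) * t⁻¹⁻¹ := by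
      rw [← hyt', hy]; group
    rw [e, conj_pow, k9]; group
  have hxy : x * y = y * x := by
    refine key_commute x y x3 y3 ?_ k9' ?_
    · have e : x * y * x⁻¹ * y⁻¹ = (y * x) * (y⁻¹ * x⁻¹ * y * x)⁻¹ * (y * x)⁻¹ := by group
      rw [e, conj_pow, inv_pow, hc]; group
    · have e : x * y⁻¹ = y * (y⁻¹ * x) * y⁻¹ := by group
      rw [e, conj_pow, k9]; group
  obtain ⟨fx, hfx⟩ := exists_cyc 3 x x3
  obtain ⟨fy, hfy⟩ := exists_cyc 3 y y3
  obtain ⟨ft, hft⟩ := exists_cyc 4 t t4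
  have comm : ∀ a b, Commute (fx a) (fy b) := by
    intro a b
    obtain ⟨i, rfl⟩ := cyc_pow 3 a
    obtain ⟨j, rfl⟩ := cyc_pow 3 b
    rw [map_pow, map_pow, hfx, hfy]
    exact Commute.pow_pow hxy i j
  obtain ⟨fn, hfn⟩ : ∃ fn, fn = MonoidHom.noncommCoprod fx fy comm := ⟨_, rfl⟩
  have fn1 : ∀ a, fn (a, 1) = fx a := by intro a; simp [hfn]
  have fn2 : ∀ a, fn (1, a) = fy a := by intro a; simp [hfn]
  have fnab : ∀ a b, fn (a, b) = fx a * fy b := by intro a b; simp [hfn]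
  have conj1 : ∀ v, fn (tau14 v) = t * fn v * t⁻¹ := by
    rintro ⟨a, b⟩
    change fn (b, a⁻¹) = _
    obtain ⟨i, rfl⟩ := cyc_pow 3 a
    obtain ⟨j, rfl⟩ := cyc_pow 3 b
    rw [fnab, fnab, map_inv]
    simp only [map_pow, hfx, hfy]
    have e : t * (x ^ i * y ^ j) * t⁻¹ = (t * x * t⁻¹) ^ i * (t * y * t⁻¹) ^ j := by
      rw [conj_pow, conj_pow]; group
    have e' : t * y * t⁻¹ = x := by rw [hy]; group
    rw [e, hyt', e', inv_pow]
    exact ((Commute.pow_pow hxy j i).inv_right).eq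
  have conjk : ∀ (k : ℕ) (v), fn ((tau14 ^ k) v) = t ^ k * fn v * (t ^ k)⁻¹ := by
    intro k
    induction k with
    | zero => intro v; simp
    | succ k ih =>
      intro v
      rw [pow_succ, MulAut.mul_apply, ih, conj1, pow_succ]; group
  have phi1 : phi14 (Multiplicative.ofAdd 1) = tau14 := pow_one tau14
  have compat : ∀ g, fn.comp (phi14 g).toMonoidHom =
      (MulAut.conj (ft g)).toMonoidHom.comp fn := by
    intro g
    obtain ⟨k, rfl⟩ := cyc_pow 4 g
    refine MonoidHom.ext fun v => ?_
    rw [map_pow, map_pow, phi1, hft]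
    exact conjk k v
  let F : PresentedGroup rels14 →* S14 := PresentedGroup.toGroup (f := ![T14, X14]) rel_S
  let B : S14 →* PresentedGroup rels14 := SemidirectProduct.lift fn ft compat
  have Ft : F t = T14 := by rw [ht]; exact PresentedGroup.toGroup.of _
  have Fx : F x = X14 := by rw [hx]; exact PresentedGroup.toGroup.of _
  have BT : B T14 = t := by
    change fn 1 * ft (Multiplicative.ofAdd 1) = t
    rw [map_one, one_mul, hft]
  have BX : B X14 = x := by
    change fn (Multiplicative.ofAdd 1, 1) * ft 1 = x
    rw [map_one ft, mul_one, fn1, hfx]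
  have Fy : F y = SemidirectProduct.inl (1, Multiplicative.ofAdd 1) := by
    rw [hy, map_mul, map_mul, map_inv, Ft, Fx]; decide
  refine ⟨MonoidHom.toMulEquiv F B ?_ ?_⟩
  · apply PresentedGroup.ext
    intro i
    fin_cases i
    · change B (F (PresentedGroup.of 0)) = PresentedGroup.of 0
      rw [← ht, Ft, BT]
    · change B (F (PresentedGroup.of 1)) = PresentedGroup.of 1
      rw [← hx, Fx, BX]
  · apply SemidirectProduct.hom_ext
    · refine MonoidHom.ext fun v => ?_
      obtain ⟨a, b⟩ := v
      change F (B (SemidirectProduct.inl (a, b))) = SemidirectProduct.inl (a, b)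
      have hB : B (SemidirectProduct.inl (a, b)) = fx a * fy b := by
        rw [← fnab]; exact SemidirectProduct.lift_inl _ _ _ _
      have hx1 : F.comp fx = SemidirectProduct.inl.comp (MonoidHom.inl _ _) := by
        apply cyc_ext
        change F (fx _) = _
        rw [hfx, Fx]; rfl
      have hy1 : F.comp fy = SemidirectProduct.inl.comp (MonoidHom.inr _ _) := by
        apply cyc_ext
        change F (fy _) = _
        rw [hfy, Fy]; rfl
      have hxa := DFunLike.congr_fun hx1 a
      have hyb := DFunLike.congr_fun hy1 b
      simp only [MonoidHom.comp_apply, MonoidHom.inl_apply, MonoidHom.inr_apply] at hxa hyb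
      rw [hB, map_mul, hxa, hyb, ← map_mul]
      simp
    · apply cyc_ext
      change F (B T14) = T14
      rw [BT, Ft]
end
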